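/- arXiv:2401.03091 — 5 statements merged into one kernel-verified Lean document; each statement's English description precedes it below -/
import Mathlib

section
/- Let n ≥ 5, and let H be a maximal subgroup of A_n that is transitive as a subgroup of S_n (acting on {1,…,n}). Then for every nonidentity g ∈ A_n, the fixed point ratio of g acting on A_n/H satisfies fpr(g, A_n/H) ≤ 1/2. -/
namespace FPR
open Finset Equiv

/-- A one-factorization of `K₆`. -/
def mt5 : Fin 5 → Perm (Fin 6) :=
  ![swap 0 1 * swap 2 3 * swap 4 5, swap 0 2 * swap 1 4 * swap 3 5,
    swap 0 3 * swap 1 5 * swap 2 4, swap 0 4 * swap 1 3 * swap 2 5,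
    swap 0 5 * swap 1 2 * swap 3 4]

set_option maxRecDepth 100000 in
lemma mt5_count : ∀ c : Fin 6 → Bool, (∀ x y, c x = c y) ∨
    (univ.filter fun i : Fin 5 => ∀ x y, (c x = c y ↔ c (mt5 i x) = c (mt5 i y))).card ≤ 2 := by
  decide +kernel

set_option maxRecDepth 100000 in
lemma mt5_conj : ∀ i, ∃ t, mt5 i = t * mt5 0 * t⁻¹ := by decide +kernel

/-- Extension of a permutation along an embedding. -/
noncomputable abbrev emb {n k : ℕ} (φ : Fin k ↪ Fin n) : Perm (Fin k) →* Perm (Fin n) :=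
  Perm.viaEmbeddingHom φ

lemma emb_apply {n k : ℕ} (φ : Fin k ↪ Fin n) (w : Perm (Fin k)) (x : Fin k) :
    emb φ w (φ x) = φ (w x) := by
  rw [emb, Perm.viaEmbeddingHom_apply, Perm.viaEmbedding_apply]

lemma emb_apply_not {n k : ℕ} (φ : Fin k ↪ Fin n) (w : Perm (Fin k)) (x : Fin n)
    (hx : x ∉ Set.range φ) : emb φ w x = x := by
  rw [emb, Perm.viaEmbeddingHom_apply, Perm.viaEmbedding_apply_of_notMem _ _ _ hx]

/-- Three edges of a fixed-point-free involution. -/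
lemma exists_six {n : ℕ} (hn : 5 < n) (g : Perm (Fin n)) (hg : ∀ x, g (g x) = x)
    (hfix : ∀ x, g x ≠ x) : ∃ φ : Fin 6 ↪ Fin n, ∀ x, g (φ x) = φ (mt5 0 x) := by
  have hex : ∀ S : Finset (Fin n), S.card < n → ∃ x, x ∉ S := by
    intro S hS
    by_contra h
    push Not at h
    have : S = univ := by ext; simp [h]
    rw [this, card_univ, Fintype.card_fin] at hS
    omega
  obtain ⟨a, -⟩ := hex ∅ (by simp; omega)
  obtain ⟨c, hc⟩ := hex {a, g a} (lt_of_le_of_lt card_le_two (by omega))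
  obtain ⟨e, he⟩ := hex {a, g a, c, g c} (lt_of_le_of_lt card_le_four (by omega))
  simp only [mem_insert, mem_singleton, not_or] at hc he
  have inj : ∀ x y, g x = y → x = g y := fun x y h => by rw [← h, hg]
  have h1 : ∀ x y, g x = g y ↔ x = y := fun x y => g.injective.eq_iff
  have h2 : ∀ x y, g x = y ↔ x = g y := fun x y => ⟨inj x y, fun h => by rw [h, hg]⟩
  refine ⟨⟨![a, g a, c, g c, e, g e], ?_⟩, ?_⟩
  · rw [← List.nodup_ofFn]
    simp only [List.ofFn_succ, List.ofFn_zero, List.nodup_cons, List.mem_cons, List.not_mem_nil,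
      not_or, Matrix.cons_val_zero, Matrix.cons_val_succ, List.nodup_nil, not_false_eq_true,
      and_true]
    have := hfix a
    have := hfix c
    have := hfix e
    grind
  · intro x
    fin_cases x
    · rfl
    · exact hg a
    · rfl
    · exact hg c
    · rfl
    · exact hg e

section Impr
open scoped Classical
variable {n : ℕ} {κ : Type*} (f : Fin n → κ)

/-- `g` preserves the partition of the points into the fibres of `f ∘ v`. -/
def Good (g v : Perm (Fin n)) : Prop :=
  ∀ i j, f (v i) = f (v j) ↔ f (v (g i)) = f (v (g j))

/-- Permutations `v` such that all points of `S` are in the same fibre of `f ∘ v`. -/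
noncomputable def Same (S : Finset (Fin n)) : Finset (Perm (Fin n)) :=
  univ.filter fun v => ∀ x ∈ S, ∀ y ∈ S, f (v x) = f (v y)

lemma card_same_insert_eq (S : Finset (Fin n)) (d d' : Fin n) (hd : d ∉ S) (hd' : d' ∉ S) :
    (Same f (insert d S)).card = (Same f (insert d' S)).card := by
  have key : ∀ d d' : Fin n, d ∉ S → d' ∉ S → ∀ v ∈ Same f (insert d S),
      v * swap d d' ∈ Same f (insert d' S) := by
    intro d d' hd hd' v hv
    simp only [Same, mem_filter, mem_univ, true_and] at hv ⊢
    have h1 : ∀ x ∈ insert d' S, swap d d' x ∈ insert d S := by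
      intro x hx
      rcases mem_insert.1 hx with rfl | hxS
      · simp
      · rw [swap_apply_of_ne_of_ne (ne_of_mem_of_not_mem hxS hd) (ne_of_mem_of_not_mem hxS hd')]
        exact mem_insert_of_mem hxS
    intro x hx y hy
    exact hv _ (h1 x hx) _ (h1 y hy)
  apply Finset.card_bij' (fun v _ => v * swap d d') (fun v _ => v * swap d d')
  · exact key d d' hd hd'
  · intro v hv
    rw [swap_comm]
    exact key d' d hd' hd v hv
  · intro v _; simp [mul_assoc]
  · intro v _; simp [mul_assoc]

variable {f}
variable {m : ℕ} (hf : ∀ i, (univ.filter fun j => f j = f i).card = m)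
include hf

lemma card_fibre (v : Perm (Fin n)) (a : Fin n) :
    (univ.filter fun j => f (v j) = f (v a)).card = m := by
  rw [← hf (v a)]
  apply Finset.card_bij' (fun j _ => v j) (fun j _ => v⁻¹ j) <;> simp

lemma card_same_insert (S : Finset (Fin n)) (a d : Fin n) (ha : a ∈ S) (hd : d ∉ S) :
    (n - S.card) * (Same f (insert d S)).card = (m - S.card) * (Same f S).card := by
  have h1 : ∑ x ∈ Sᶜ, (Same f (insert x S)).card = (n - S.card) * (Same f (insert d S)).card := by
    rw [Finset.sum_const_nat (m := (Same f (insert d S)).card)]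
    · rw [card_compl, Fintype.card_fin]
    · intro x hx
      exact card_same_insert_eq f S x d (by simpa using hx) hd
  rw [← h1]
  have h2 : ∀ x ∈ Sᶜ, (Same f (insert x S)).card =
      ∑ v ∈ Same f S, if f (v x) = f (v a) then 1 else 0 := by
    intro x hx
    rw [← Finset.card_filter]
    congr 1
    ext v
    simp only [Same, mem_filter, mem_univ, true_and]
    constructor
    · intro h
      exact ⟨fun y hy z hz => h y (mem_insert_of_mem hy) z (mem_insert_of_mem hz),
        h x (mem_insert_self _ _) a (mem_insert_of_mem ha)⟩
    · rintro ⟨h, hxa⟩ y hy z hz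
      have : ∀ y ∈ insert x S, f (v y) = f (v a) := by
        intro y hy
        rcases mem_insert.1 hy with rfl | hy
        · exact hxa
        · exact h y hy a ha
      rw [this y hy, this z hz]
  rw [Finset.sum_congr rfl h2, Finset.sum_comm, Finset.sum_const_nat (m := m - S.card), mul_comm]
  intro v hv
  rw [← Finset.card_filter]
  have : (Sᶜ.filter fun x => f (v x) = f (v a)) = (univ.filter fun x => f (v x) = f (v a)) \ S := by
    ext x; simp [and_comm]
  rw [this, card_sdiff_of_subset, card_fibre hf]
  intro x hx
  simp only [Same, mem_filter, mem_univ, true_and] at hv ⊢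
  exact hv x hx a ha

lemma two_card_same_insert (hn : 2 * m ≤ n) (S : Finset (Fin n)) (a d : Fin n)
    (ha : a ∈ S) (hd : d ∉ S) :
    2 * (Same f (insert d S)).card ≤ (Same f S).card := by
  have h := card_same_insert hf S a d ha hd
  have hS : S.card < n := by
    have := Finset.card_lt_univ_of_notMem hd
    simpa using this
  have : (n - S.card) * (2 * (Same f (insert d S)).card) ≤ (n - S.card) * (Same f S).card := by
    calc _ = 2 * ((n - S.card) * (Same f (insert d S)).card) := by ring
      _ = (2 * (m - S.card)) * (Same f S).card := by rw [h]; ring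
      _ ≤ _ := Nat.mul_le_mul_right _ (by omega)
  exact Nat.le_of_mul_le_mul_left this (by omega)

omit hf in
lemma card_same_singleton (a : Fin n) : (Same f {a}).card = n.factorial := by
  have : Same f {a} = univ := by
    ext v; simp [Same]
  rw [this, card_univ, Fintype.card_perm, Fintype.card_fin]

lemma two_blocks (hn : n = 2 * m) (x y z : Fin n) (hx : f x ≠ f z) (hy : f y ≠ f z) :
    f x = f y := by
  by_contra hxy
  have h3 : ((univ.filter fun j => f j = f x) ∪ (univ.filter fun j => f j = f y) ∪
      (univ.filter fun j => f j = f z)).card = m + m + m := by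
    rw [card_union_of_disjoint, card_union_of_disjoint, hf, hf, hf]
    · rw [Finset.disjoint_left]; intro i; simp only [mem_filter, mem_univ, true_and]
      intro h1 h2; exact hxy (h1.symm.trans h2)
    · rw [Finset.disjoint_left]; intro i; simp only [mem_union, mem_filter, mem_univ, true_and]
      rintro (h1 | h1) h2
      · exact hx (h1.symm.trans h2)
      · exact hy (h1.symm.trans h2)
  have h4 := Finset.card_le_univ ((univ.filter fun j => f j = f x) ∪ (univ.filter fun j => f j = f y) ∪
      (univ.filter fun j => f j = f z))
  rw [h3, Fintype.card_fin] at h4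
  have : 0 < m := by
    rw [← hf x]; exact Finset.card_pos.2 ⟨x, by simp⟩
  omega

/-- Three or more blocks. -/
lemma good_three (hm : 2 ≤ m) (hn : 3 * m ≤ n) (g : Perm (Fin n)) (hg : g ≠ 1) :
    2 * (univ.filter fun v => Good f g v).card ≤ n.factorial := by
  obtain ⟨a, hab⟩ : ∃ a, g a ≠ a := by
    by_contra h; push Not at h; exact hg (Equiv.ext h)
  set b := g a with hb
  have hC := card_same_insert hf {a} a b (by simp) (by simpa using hab)
  rw [card_same_singleton, card_singleton] at hC
  set C := (Same f (insert b {a})).card with hCdef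
  let X : Finset (Perm (Fin n)) := univ.filter fun v => Good f g v ∧ f (v a) ≠ f (v b)
  let Y : Finset (Perm (Fin n)) := univ.filter fun v => ¬ Good f g v ∧ f (v a) ≠ f (v b)
  have hN : (univ.filter fun v => Good f g v).card ≤ C + X.card := by
    rw [hCdef]
    refine (Finset.card_le_card ?_).trans (Finset.card_union_le _ _)
    intro v hv
    simp only [Same, X, mem_union, mem_filter, mem_univ, true_and] at hv ⊢
    by_cases h : f (v a) = f (v b)
    · left
      intro x hx y hy
      simp only [mem_insert, mem_singleton] at hx hy
      rcases hx with rfl | rfl <;> rcases hy with rfl | rfl <;> simp [h]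
    · exact Or.inr ⟨hv, h⟩
  have hXY : C + (X.card + Y.card) ≤ n.factorial := by
    have h1 : Disjoint X Y := by
      rw [Finset.disjoint_left]; intro v h1 h2
      simp only [X, Y, mem_filter] at h1 h2
      exact h2.2.1 h1.2.1
    have h2 : Disjoint (Same f (insert b {a})) (X ∪ Y) := by
      rw [Finset.disjoint_left]; intro v h1 h2
      simp only [Same, X, Y, mem_filter, mem_univ, true_and, mem_union] at h1 h2
      have := h1 a (by simp) b (by simp)
      tauto
    rw [← card_union_of_disjoint h1, hCdef, ← card_union_of_disjoint h2]
    refine (Finset.card_le_univ _).trans ?_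
    rw [Fintype.card_perm, Fintype.card_fin]
  -- the relation
  have hrel : X.card * ((m - 1) * (n - 2 * m)) ≤ Y.card := by
    let T : Finset (Σ _ : Perm (Fin n), Fin n × Fin n) := X.sigma fun v =>
      ((univ.filter fun u => f (v u) = f (v b)).erase b) ×ˢ
        (univ.filter fun w => f (v w) ≠ f (v a) ∧ f (v w) ≠ f (v b))
    have hT : T.card = X.card * ((m - 1) * (n - 2 * m)) := by
      rw [Finset.card_sigma]
      apply Finset.sum_const_nat
      intro v hv
      have hv' : f (v a) ≠ f (v b) := by
        simp only [X, mem_filter, mem_univ, true_and] at hv; exact hv.2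
      rw [card_product, card_erase_of_mem (by simp), card_fibre hf]
      congr 1
      have : (univ.filter fun w => f (v w) ≠ f (v a) ∧ f (v w) ≠ f (v b)) =
          ((univ.filter fun w => f (v w) = f (v a)) ∪ (univ.filter fun w => f (v w) = f (v b)))ᶜ := by
        ext w; simp
      rw [this, card_compl, card_union_of_disjoint, card_fibre hf, card_fibre hf, Fintype.card_fin,
        two_mul]
      rw [Finset.disjoint_left]; intro i; simp only [mem_filter, mem_univ, true_and]
      intro h1 h2; exact hv' (h1.symm.trans h2)
    rw [← hT]
    have basic : ∀ v u w, (⟨v, u, w⟩ : Σ _ : Perm (Fin n), Fin n × Fin n) ∈ T →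
        (Good f g v ∧ f (v a) ≠ f (v b) ∧ u ≠ b ∧ f (v u) = f (v b) ∧ f (v w) ≠ f (v a) ∧
          f (v w) ≠ f (v b)) := by
      intro v u w h
      simp only [T, X, mem_sigma, mem_filter, mem_univ, true_and, mem_product, mem_erase] at h
      tauto
    have facts : ∀ v u w, (⟨v, u, w⟩ : Σ _ : Perm (Fin n), Fin n × Fin n) ∈ T →
        f ((v * swap u w) a) ≠ f ((v * swap u w) b) ∧
        (∀ x, (f ((v * swap u w) (g⁻¹ x)) = f ((v * swap u w) a) ∧
          f ((v * swap u w) x) ≠ f ((v * swap u w) b)) ↔ x = u) ∧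
        (∀ x, (f ((v * swap u w) (g⁻¹ x)) ≠ f ((v * swap u w) a) ∧
          f ((v * swap u w) x) = f ((v * swap u w) b)) ↔ x = w) := by
      intro v u w h
      obtain ⟨hgood, h1, h2, h3, h4, h5⟩ := basic v u w h
      have hau : a ≠ u := by rintro rfl; exact h1 h3
      have haw : a ≠ w := by rintro rfl; exact h4 rfl
      have hbw : b ≠ w := by rintro rfl; exact h5 rfl
      have huw : u ≠ w := by rintro rfl; exact h5 h3
      have eA : (v * swap u w) a = v a := by
        rw [Perm.mul_apply, swap_apply_of_ne_of_ne hau haw]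
      have eB : (v * swap u w) b = v b := by
        rw [Perm.mul_apply, swap_apply_of_ne_of_ne h2.symm hbw]
      have eU : (v * swap u w) u = v w := by rw [Perm.mul_apply, swap_apply_left]
      have eW : (v * swap u w) w = v u := by rw [Perm.mul_apply, swap_apply_right]
      have eO : ∀ z, z ≠ u → z ≠ w → (v * swap u w) z = v z := by
        intro z hz hz'
        rw [Perm.mul_apply, swap_apply_of_ne_of_ne hz hz']
      have clsA : ∀ z, f ((v * swap u w) z) = f (v a) ↔ f (v z) = f (v a) := by
        intro z
        by_cases hzu : z = u
        · subst hzu; rw [eU, h3]; exact ⟨fun h => absurd h h4, fun h => absurd h.symm h1⟩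
        by_cases hzw : z = w
        · subst hzw; rw [eW, h3]; exact ⟨fun h => absurd h.symm h1, fun h => absurd h h4⟩
        rw [eO z hzu hzw]
      have clsG : ∀ x, f (v (g⁻¹ x)) = f (v a) ↔ f (v x) = f (v b) := by
        intro x
        have := hgood (g⁻¹ x) a
        simpa using this
      rw [eA, eB]
      refine ⟨h1, ?_, ?_⟩
      · intro x
        rw [clsA, clsG]
        constructor
        · rintro ⟨hx1, hx2⟩
          by_contra hxu
          by_cases hxw : x = w
          · subst hxw; exact h5 hx1
          · rw [eO x hxu hxw] at hx2; exact hx2 hx1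
        · rintro rfl
          rw [eU]; exact ⟨h3, h5⟩
      · intro x
        rw [ne_eq, clsA, clsG]
        constructor
        · rintro ⟨hx1, hx2⟩
          by_contra hxw
          by_cases hxu : x = u
          · subst hxu; exact hx1 h3
          · rw [eO x hxu hxw] at hx2; exact hx1 hx2
        · rintro rfl
          rw [eW]; exact ⟨h5, h3⟩
    apply Finset.card_le_card_of_injOn (fun t => t.1 * swap t.2.1 t.2.2)
    · rintro ⟨v, u, w⟩ h
      obtain ⟨k1, k2, k3⟩ := facts v u w h
      simp only [Y, coe_filter, mem_univ, true_and, Set.mem_ofPred_eq]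
      refine ⟨?_, k1⟩
      intro hgood
      obtain ⟨h1, h2⟩ := (k2 u).2 rfl
      apply h2
      have := (hgood (g⁻¹ u) a).1 h1
      simpa using this
    · rintro ⟨v, u, w⟩ h ⟨v', u', w'⟩ h' heq
      simp only at heq
      obtain ⟨-, k2, k3⟩ := facts v u w h
      obtain ⟨-, k2', k3'⟩ := facts v' u' w' h'
      rw [← heq] at k2' k3'
      have hu : u = u' := (k2' u).1 ((k2 u).2 rfl)
      have hw : w = w' := (k3' w).1 ((k3 w).2 rfl)
      subst hu hw
      have : v = v' := mul_right_cancel heq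
      subst this
      rfl
  -- arithmetic
  set F := n.factorial
  set x := X.card
  set y := Y.card
  set N := (univ.filter fun v => Good f g v).card
  obtain ⟨μ, rfl⟩ : ∃ μ, m = μ + 2 := ⟨m - 2, by omega⟩
  obtain ⟨ν, rfl⟩ : ∃ ν, n = 3 * (μ + 2) + ν := ⟨n - 3 * (μ + 2), by omega⟩
  have e1 : 3 * (μ + 2) + ν - 1 = 3 * μ + ν + 5 := by omega
  have e2 : μ + 2 - 1 = μ + 1 := by omega
  have e3 : 3 * (μ + 2) + ν - 2 * (μ + 2) = μ + ν + 2 := by omega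
  rw [e1, e2] at hC
  rw [e2, e3] at hrel
  clear_value F x y N C
  clear X Y hf hg hab hb
  have hx : x * ((μ + 1) * (μ + ν + 2) + 1) + C ≤ F := by nlinarith
  suffices h : 2 * (C + x) ≤ F by omega
  -- multiply out
  set E := (μ + 1) * (μ + ν + 2) with hE
  have hE2 : 2 ≤ E := by nlinarith
  have key : 2 * (μ + 1) * E + 2 * (3 * μ + ν + 5) ≤ (E + 1) * (3 * μ + ν + 5) := by
    rcases Nat.eq_zero_or_pos μ with rfl | hμ
    · simp only [hE]; nlinarith
    · have : 6 ≤ E := by nlinarith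
      nlinarith
  have : (3 * μ + ν + 5) * (E + 1) * (2 * (C + x)) ≤ (3 * μ + ν + 5) * (E + 1) * F := by
    have i1 : (3 * μ + ν + 5) * (2 * (x * (E + 1) + C)) ≤ (3 * μ + ν + 5) * (2 * F) :=
      Nat.mul_le_mul_left _ (by omega)
    have i2 : F * (2 * (μ + 1) * E + 2 * (3 * μ + ν + 5)) ≤ F * ((E + 1) * (3 * μ + ν + 5)) :=
      Nat.mul_le_mul_left _ key
    have i3 : 2 * E * ((3 * μ + ν + 5) * C) = 2 * E * ((μ + 1) * F) := by rw [hC]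
    nlinarith
  exact Nat.le_of_mul_le_mul_left this (by positivity)

omit hf in
lemma good_conj_card (g t : Perm (Fin n)) :
    (univ.filter fun v => Good f (t * g * t⁻¹) v).card = (univ.filter fun v => Good f g v).card := by
  apply Finset.card_bij' (fun v _ => v * t) (fun v _ => v * t⁻¹)
  · intro v hv
    simp only [mem_filter, mem_univ, true_and] at hv ⊢
    intro i j
    simpa using hv (t i) (t j)
  · intro v hv
    simp only [mem_filter, mem_univ, true_and] at hv ⊢
    intro i j
    simpa using hv (t⁻¹ i) (t⁻¹ j)
  · simp
  · simp


lemma good_two_swap (hn : n = 2 * m) (g v : Perm (Fin n)) (hv : Good f g v) (a : Fin n)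
    (ha : f (v a) ≠ f (v (g a))) (x : Fin n) : f (v x) ≠ f (v (g x)) := by
  intro hx
  by_cases h : f (v x) = f (v a)
  · have h2 := (hv x a).1 h
    exact ha (by rw [← h2, ← hx, h])
  · have h2 : f (v (g x)) ≠ f (v (g a)) := fun h' => h ((hv x a).2 h')
    rw [← hx] at h2
    exact h (two_blocks hf hn (v x) (v a) (v (g a)) h2 ha)

lemma good_two_of_same (hn : n = 2 * m) (g : Perm (Fin n)) (a : Fin n) (ha : g a ≠ a)
    (h : ∀ v, Good f g v → f (v a) = f (v (g a))) :
    2 * (univ.filter fun v => Good f g v).card ≤ n.factorial := by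
  have h1 := two_card_same_insert hf hn.ge {a} a (g a) (by simp) (by simpa using ha)
  rw [card_same_singleton] at h1
  refine le_trans (Nat.mul_le_mul_left 2 (Finset.card_le_card ?_)) h1
  intro v hv
  simp only [Same, mem_filter, mem_univ, true_and, mem_insert, mem_singleton] at hv ⊢
  have := h v hv
  rintro x (rfl | rfl) y (rfl | rfl) <;> simp [this]

lemma good_two_fpf (hn : n = 2 * m) (hn5 : 5 ≤ n) (g : Perm (Fin n)) (hg : ∀ x, g (g x) = x)
    (hfix : ∀ x, g x ≠ x) :
    2 * (univ.filter fun v => Good f g v).card ≤ n.factorial := by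
  obtain ⟨φ, hφ⟩ := exists_six (by omega) g hg hfix
  choose y hy using mt5_conj
  set N := (univ.filter fun v => Good f g v).card with hN
  let S4 : Finset (Fin n) := {φ 3, φ 2, φ 1, φ 0}
  have hne : ∀ i j : Fin 6, i ≠ j → φ i ≠ φ j := fun i j h h' => h (φ.injective h')
  have hS4 : 8 * (Same f S4).card ≤ n.factorial := by
    have h1 := two_card_same_insert hf hn.ge {φ 0} (φ 0) (φ 1) (by simp) (by simp)
    have h2 := two_card_same_insert hf hn.ge {φ 1, φ 0} (φ 0) (φ 2) (by simp) (by simp)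
    have h3 := two_card_same_insert hf hn.ge {φ 2, φ 1, φ 0} (φ 0) (φ 3) (by simp) (by simp)
    rw [card_same_singleton] at h1
    have : Same f S4 = Same f (insert (φ 3) {φ 2, φ 1, φ 0}) := rfl
    rw [this]
    omega
  have hsum : ∑ v : Perm (Fin n), (univ.filter fun i : Fin 5 =>
      Good f (emb φ (y i) * g * (emb φ (y i))⁻¹) v).card = 5 * N := by
    simp_rw [Finset.card_filter]
    rw [Finset.sum_comm]
    simp_rw [← Finset.card_filter, good_conj_card]
    simp [hN]
  have hpt : ∀ v : Perm (Fin n), (univ.filter fun i : Fin 5 =>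
      Good f (emb φ (y i) * g * (emb φ (y i))⁻¹) v).card ≤ 2 + if v ∈ Same f S4 then 3 else 0 := by
    intro v
    let c : Fin 6 → Bool := fun x => decide (f (v (φ x)) = f (v (φ 0)))
    have hc : ∀ x z, c x = c z ↔ f (v (φ x)) = f (v (φ z)) := by
      intro x z
      simp only [c, decide_eq_decide]
      constructor
      · intro h
        by_cases hx : f (v (φ x)) = f (v (φ 0))
        · rw [hx, h.1 hx]
        · exact two_blocks hf hn _ _ _ hx (fun h' => hx (h.2 h'))
      · intro h; rw [h]
    rcases mt5_count c with h | h
    · have : v ∈ Same f S4 := by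
        simp only [Same, mem_filter, mem_univ, true_and]
        have h' : ∀ x z, f (v (φ x)) = f (v (φ z)) := fun x z => (hc x z).1 (h x z)
        intro x hx z hz
        simp only [S4, mem_insert, mem_singleton] at hx hz
        rcases hx with rfl | rfl | rfl | rfl <;> rcases hz with rfl | rfl | rfl | rfl <;> exact h' _ _
      rw [if_pos this]
      exact (Finset.card_le_univ _).trans (by simp)
    · refine le_trans (le_trans (Finset.card_le_card ?_) h) (Nat.le_add_right _ _)
      intro i hi
      simp only [mem_filter, mem_univ, true_and] at hi ⊢
      intro x z
      have hgi : ∀ x, (emb φ (y i) * g * (emb φ (y i))⁻¹) (φ x) = φ (mt5 i x) := by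
        intro x
        rw [← map_inv, Perm.mul_apply, Perm.mul_apply, emb_apply, hφ, emb_apply, hy i]
        simp
      have := hi (φ x) (φ z)
      rw [hgi, hgi] at this
      rw [hc, hc, this]
  have hle := Finset.sum_le_sum (fun v (_ : v ∈ (univ : Finset (Perm (Fin n)))) => hpt v)
  rw [hsum, Finset.sum_add_distrib, ← Finset.sum_filter] at hle
  simp only [sum_const, card_univ, Fintype.card_perm, Fintype.card_fin, smul_eq_mul,
    Finset.filter_univ_mem] at hle
  omega

lemma good_two (hn : n = 2 * m) (hn5 : 5 ≤ n) (g : Perm (Fin n)) (hg : (orderOf g).Prime) :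
    2 * (univ.filter fun v => Good f g v).card ≤ n.factorial := by
  have hg1 : g ≠ 1 := by rintro rfl; simp at hg; exact Nat.not_prime_one hg
  obtain ⟨a, ha⟩ : ∃ a, g a ≠ a := by
    by_contra h; push Not at h; exact hg1 (Equiv.ext h)
  by_cases hfix : ∃ x, g x = x
  · obtain ⟨x, hx⟩ := hfix
    apply good_two_of_same hf hn g a ha
    intro v hv
    by_contra h
    exact good_two_swap hf hn g v hv a h x (by rw [hx])
  push Not at hfix
  rcases hg.eq_two_or_odd' with h2 | hodd
  · apply good_two_fpf hf hn hn5 g _ hfix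
    intro x
    have := pow_orderOf_eq_one g
    rw [h2, pow_two] at this
    rw [← Perm.mul_apply, this, Perm.one_apply]
  · apply good_two_of_same hf hn g a ha
    intro v hv
    by_contra h
    have hs := good_two_swap hf hn g v hv a h
    have key : ∀ k : ℕ, f (v ((g ^ (2 * k)) a)) = f (v a) := by
      intro k
      induction k with
      | zero => simp
      | succ k ih =>
        rw [← ih]
        have e : (g ^ (2 * (k + 1))) a = g (g ((g ^ (2 * k)) a)) := by
          rw [show 2 * (k + 1) = (2 * k + 1) + 1 by ring, pow_succ', pow_succ']; rfl
        rw [e]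
        exact two_blocks hf hn _ _ _ (hs _).symm (hs _)
    obtain ⟨k, hk⟩ := hodd
    have := pow_orderOf_eq_one g
    rw [hk, pow_succ'] at this
    have h3 : g ((g ^ (2 * k)) a) = a := by rw [← Perm.mul_apply, this, Perm.one_apply]
    have h4 := hs ((g ^ (2 * k)) a)
    rw [h3, key k] at h4
    exact h4 rfl

/-- The imprimitive count. -/
lemma good_all (hm : 2 ≤ m) (hn5 : 5 ≤ n) (hdvd : m ∣ n) (hmn : m < n) (g : Perm (Fin n))
    (hg : (orderOf g).Prime) :
    2 * (univ.filter fun v => Good f g v).card ≤ n.factorial := by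
  obtain ⟨k, hk⟩ := hdvd
  by_cases hk2 : k = 2
  · exact good_two hf (by rw [hk, hk2, mul_comm]) hn5 g hg
  · have hg1 : g ≠ 1 := by rintro rfl; simp at hg; exact Nat.not_prime_one hg
    have : 3 ≤ k := by
      rcases k with _ | _ | _ | k
      · omega
      · omega
      · omega
      · omega
    exact good_three hf hm (by rw [hk, mul_comm]; exact Nat.mul_le_mul_left _ this) g hg1

end Impr

/-- Eight perfect matchings of `K₆`. -/
def mt8 : Fin 8 → Perm (Fin 6) :=
  ![swap 0 5 * swap 1 2 * swap 3 4, swap 0 4 * swap 1 3 * swap 2 5,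
    swap 0 3 * swap 1 5 * swap 2 4, swap 0 2 * swap 1 4 * swap 3 5,
    swap 0 3 * swap 1 4 * swap 2 5, swap 0 2 * swap 1 5 * swap 3 4,
    swap 0 4 * swap 1 2 * swap 3 5, swap 0 5 * swap 1 3 * swap 2 4]

/-- Base matching. -/
def mt0 : Perm (Fin 6) := swap 0 1 * swap 2 3 * swap 4 5

set_option maxRecDepth 100000 in
lemma mt8_conj : ∀ i, ∃ t : Perm (Fin 6), Perm.sign t = 1 ∧ mt8 i = t * mt0 * t⁻¹ := by
  decide +kernel

set_option maxRecDepth 100000 in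
lemma mt8_five : ∀ b : Fin 8 → Bool, 5 ≤ (univ.filter fun i => b i = true).card →
    ∃ i j k l, b i = true ∧ b j = true ∧ b k = true ∧ b l = true ∧
      (mt8 i * mt8 j * mt8 k * mt8 l) ≠ 1 ∧ (mt8 i * mt8 j * mt8 k * mt8 l) ^ 5 = 1 := by
  decide +kernel

set_option maxRecDepth 100000 in
lemma mt8_inv : ∀ b : Fin 8 → Bool, 5 ≤ (univ.filter fun i => b i = true).card →
    ∃ i j, b i = true ∧ b j = true ∧ i ≠ j ∧ (mt8 i * mt8 j) * (mt8 i * mt8 j) = 1 := by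
  decide +kernel

set_option maxRecDepth 100000 in
lemma mt8_dt : ∀ i j, i ≠ j → (mt8 i * mt8 j) * (mt8 i * mt8 j) = 1 →
    ∃ p q r s, p ≠ q ∧ r ≠ s ∧ p ≠ r ∧ p ≠ s ∧ q ≠ r ∧ q ≠ s ∧
      mt8 i * mt8 j = swap p q * swap r s := by
  decide +kernel

lemma emb_sign {n k : ℕ} (φ : Fin k ↪ Fin n) (w : Perm (Fin k)) :
    Perm.sign (emb φ w) = Perm.sign w := by
  classical
  rw [emb, Perm.viaEmbeddingHom_apply, Perm.viaEmbedding]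
  convert Perm.sign_extendDomain w (Equiv.ofInjective φ.1 φ.2)

lemma emb_isCycle {n k : ℕ} (φ : Fin k ↪ Fin n) (w : Perm (Fin k)) (hw : w.IsCycle) :
    (emb φ w).IsCycle := by
  classical
  rw [emb, Perm.viaEmbeddingHom_apply, Perm.viaEmbedding]
  convert hw.extendDomain (Equiv.ofInjective φ.1 φ.2)

lemma emb_card_support {n k : ℕ} (φ : Fin k ↪ Fin n) (w : Perm (Fin k)) :
    (emb φ w).support.card = w.support.card := by
  classical
  rw [emb, Perm.viaEmbeddingHom_apply, Perm.viaEmbedding]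
  convert Perm.card_support_extend_domain (Equiv.ofInjective φ.1 φ.2)

lemma emb_swap {n k : ℕ} (φ : Fin k ↪ Fin n) (p q : Fin k) :
    emb φ (swap p q) = swap (φ p) (φ q) := by
  ext x
  congr 1
  by_cases hx : x ∈ Set.range φ
  · obtain ⟨y, rfl⟩ := hx
    rw [emb_apply, φ.injective.map_swap]
  · rw [emb_apply_not _ _ _ hx, swap_apply_of_ne_of_ne]
    · rintro rfl; exact hx ⟨_, rfl⟩
    · rintro rfl; exact hx ⟨_, rfl⟩

lemma conj_emb {n k : ℕ} (φ : Fin k ↪ Fin n) (g : Perm (Fin n)) (e y : Perm (Fin k))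
    (h : ∀ x, g (φ x) = φ (e x)) : g * emb φ y * g⁻¹ = emb φ (e * y * e⁻¹) := by
  have h' : ∀ x, g⁻¹ (φ x) = φ (e⁻¹ x) := by
    intro x
    rw [Perm.inv_eq_iff_eq, h]; simp
  ext x
  congr 1
  by_cases hx : x ∈ Set.range φ
  · obtain ⟨z, rfl⟩ := hx
    simp only [Perm.mul_apply, h', emb_apply, h]
  · rw [emb_apply_not _ _ _ hx, Perm.mul_apply, Perm.mul_apply, emb_apply_not]
    · simp
    · rintro ⟨z, hz⟩
      exact hx ⟨e z, by rw [← h, hz]; simp⟩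

lemma isThreeCycle_conj {n : ℕ} (v z : Perm (Fin n)) (hz : z.IsThreeCycle) :
    (v * z * v⁻¹).IsThreeCycle := by
  rw [Perm.IsThreeCycle, Perm.cycleType_conj]; exact hz

open MulAction in
lemma jordan_five {n : ℕ} (hn : 8 ≤ n) (L : Subgroup (Perm (Fin n)))
    (hL : IsPreprimitive L (Fin n)) (z : Perm (Fin n)) (hz : z ∈ L) (hc : z.IsCycle)
    (h5 : z.support.card = 5) (p q r s : Fin n) (hpq : p ≠ q) (hrs : r ≠ s) (hpr : p ≠ r)
    (hps : p ≠ s) (hqr : q ≠ r) (hqs : q ≠ s) (hd : swap p q * swap r s ∈ L) :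
    alternatingGroup (Fin n) ≤ L := by
  classical
  have hmult : IsMultiplyPreprimitive L (Fin n) ((n - 6) + 2) := by
    apply hL.isMultiplyPreprimitive (s := (z.supportᶜ : Set (Fin n)))
    · have := Set.ncard_add_ncard_compl (z.support : Set (Fin n))
      rw [Set.ncard_coe_finset, h5, Nat.card_eq_fintype_card, Fintype.card_fin] at this
      omega
    · rw [Nat.card_eq_fintype_card, Fintype.card_fin]; omega
    have := Perm.isPretransitive_of_isCycle_mem hc hz
    apply IsPreprimitive.of_prime_card
    convert! Nat.prime_five
    rw [Nat.card_eq_fintype_card, Fintype.card_subtype, ← h5]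
    apply congr_arg
    ext x
    simp [SubMulAction.mem_ofFixingSubgroup_iff]
  have h4 : IsMultiplyPretransitive L (Fin n) 4 := by
    have := hmult.isMultiplyPretransitive
    apply isMultiplyPretransitive_of_le' (n := n - 6 + 2) (by omega)
    rw [ENat.card_eq_coe_fintype_card, Fintype.card_fin]
    exact_mod_cast (by omega)
  rw [isMultiplyPretransitive_iff] at h4
  obtain ⟨x, hx⟩ : ∃ x, x ∉ ({p, q, r, s} : Finset (Fin n)) := by
    by_contra h
    push Not at h
    have h1 : ({p, q, r, s} : Finset (Fin n)) = univ := by ext; simp [h]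
    have h2 : ({p, q, r, s} : Finset (Fin n)).card ≤ 4 := card_le_four
    rw [h1, card_univ, Fintype.card_fin] at h2
    omega
  simp only [mem_insert, mem_singleton, not_or] at hx
  have inj : ∀ y, y ≠ p → y ≠ q → y ≠ r → Function.Injective ![p, q, r, y] := by
    intro y h1 h2 h3
    rw [← List.nodup_ofFn]
    simp only [List.ofFn_succ, List.ofFn_zero, List.nodup_cons, List.mem_cons, List.not_mem_nil,
      not_or, Matrix.cons_val_zero, Matrix.cons_val_succ, List.nodup_nil, not_false_eq_true,
      and_true]
    grind
  obtain ⟨t, ht⟩ := h4 ⟨_, inj s hps.symm hqs.symm hrs.symm⟩ ⟨_, inj x hx.1 hx.2.1 hx.2.2.1⟩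
  have ht' : ∀ i, (t : Perm (Fin n)) (![p, q, r, s] i) = ![p, q, r, x] i :=
    fun i => DFunLike.congr_fun ht i
  have tp : (t : Perm (Fin n)) p = p := ht' 0
  have tq : (t : Perm (Fin n)) q = q := ht' 1
  have tr : (t : Perm (Fin n)) r = r := ht' 2
  have ts : (t : Perm (Fin n)) s = x := ht' 3
  have hconj : (t : Perm (Fin n)) * (swap p q * swap r s) * (t : Perm (Fin n))⁻¹ =
      swap p q * swap r x := by
    have e1 := Equiv.swap_apply_apply (t : Perm (Fin n)) p q
    have e2 := Equiv.swap_apply_apply (t : Perm (Fin n)) r s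
    rw [tp, tq] at e1
    rw [tr, ts] at e2
    rw [e2]
    conv_rhs => rw [e1]
    group
  have hmem : swap r s * swap r x ∈ L := by
    have h1 := L.mul_mem (L.inv_mem hd) (L.mul_mem (L.mul_mem t.2 hd) (L.inv_mem t.2))
    rw [hconj] at h1
    simpa [mul_assoc] using h1
  exact Perm.alternatingGroup_le_of_isPreprimitive_of_isThreeCycle_mem hL
    (Perm.isThreeCycle_swap_mul_swap_same hrs (Ne.symm hx.2.2.1) (Ne.symm hx.2.2.2)) hmem

lemma avg {G ι : Type*} [Group G] [Fintype G] [Fintype ι] [DecidableEq G] (S : Finset G) (t : ι → G)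
    (hι : 0 < Fintype.card ι)
    (hS : Fintype.card G < 2 * S.card) :
    ∃ v, Fintype.card ι < 2 * (univ.filter fun i => v * t i ∈ S).card := by
  by_contra h
  push Not at h
  have h1 := Finset.sum_le_sum (fun v (_ : v ∈ (univ : Finset G)) => h v)
  rw [← Finset.mul_sum] at h1
  have h2 : ∑ v : G, (univ.filter fun i => v * t i ∈ S).card = Fintype.card ι * S.card := by
    simp_rw [Finset.card_filter]
    rw [Finset.sum_comm]
    have : ∀ i, (∑ v : G, if v * t i ∈ S then 1 else 0) = S.card := by
      intro i
      rw [← Finset.card_filter]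
      apply Finset.card_bij' (fun v _ => v * t i) (fun v _ => v * (t i)⁻¹) <;> simp
    simp [this]
  rw [h2] at h1
  simp only [sum_const, card_univ, smul_eq_mul] at h1
  nlinarith

/-- Base element of order three. -/
def th0 : Perm (Fin 6) := swap 0 1 * swap 1 2 * (swap 3 4 * swap 4 5)

set_option maxRecDepth 100000 in
lemma th0_comm : ∃ y : Perm (Fin 6), Perm.sign y = 1 ∧ ∃ p q r : Fin 6, p ≠ q ∧ p ≠ r ∧ q ≠ r ∧
    th0 * y * th0⁻¹ * y⁻¹ = swap p q * swap p r := by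
  decide +kernel

set_option maxRecDepth 100000 in
lemma sw0_comm : ∃ y : Perm (Fin 3), Perm.sign y = 1 ∧ ∃ p q r : Fin 3, p ≠ q ∧ p ≠ r ∧ q ≠ r ∧
    swap 0 1 * y * (swap 0 1)⁻¹ * y⁻¹ = swap p q * swap p r := by
  decide +kernel

set_option maxRecDepth 100000 in
lemma four_comm : ∃ p q r : Fin 4, p ≠ q ∧ p ≠ r ∧ q ≠ r ∧
    (swap 1 2 * swap 2 3) * (swap 0 1 * swap 1 2)⁻¹ = swap p q * swap p r := by
  decide +kernel

open MulAction in
lemma inv_case {n : ℕ} (hn : 5 ≤ n) (H : Subgroup (alternatingGroup (Fin n)))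
    (hnot : ¬ alternatingGroup (Fin n) ≤ H.map (alternatingGroup (Fin n)).subtype)
    (hL : IsPreprimitive (H.map (alternatingGroup (Fin n)).subtype) (Fin n))
    (g : alternatingGroup (Fin n)) (hinv : ∀ x, (g : Perm (Fin n)) ((g : Perm (Fin n)) x) = x)
    (hfix : ∀ x, (g : Perm (Fin n)) x ≠ x)
    (S : Finset (alternatingGroup (Fin n))) (hSmem : ∀ v, v ∈ S ↔ v * g * v⁻¹ ∈ H)
    (hS : Fintype.card (alternatingGroup (Fin n)) < 2 * S.card) : False := by
  set γ : Perm (Fin n) := (g : Perm (Fin n)) with hγ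
  have hγ2 : γ * γ = 1 := by
    ext x; simp [hinv]
  have hγi : γ⁻¹ = γ := inv_eq_of_mul_eq_one_left hγ2
  have hsupp : γ.support = univ := by ext x; simp [hfix]
  have h8 : 8 ≤ n := by
    have hsq : γ ^ 2 = 1 := by rw [pow_two, hγ2]
    have h1 := Perm.two_dvd_card_support hsq
    have h2 := Perm.sign_of_pow_two_eq_one hsq
    rw [hsupp, card_univ, Fintype.card_fin] at h1
    have h3 : Perm.sign γ = 1 := g.2
    have h4 : Fintype.card (Function.fixedPoints γ) = 0 := by
      rw [Fintype.card_eq_zero_iff]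
      exact ⟨fun x => hfix _ x.2⟩
    by_contra hlt
    have h6 : n = 6 := by omega
    subst h6
    rw [h3] at h2
    simp only [Fintype.card_fin, h4] at h2
    revert h2
    decide
  obtain ⟨φ, hφ⟩ := exists_six (by omega) γ hinv hfix
  replace hφ : ∀ x, γ (φ x) = φ (mt0 x) := hφ
  choose y hy1 hy2 using mt8_conj
  let t : Fin 8 → alternatingGroup (Fin n) := fun i =>
    ⟨emb φ (y i), by rw [Perm.mem_alternatingGroup, emb_sign, hy1]⟩
  obtain ⟨v, hv⟩ := avg S t (by simp) hS
  set ν : Perm (Fin n) := (v : Perm (Fin n)) with hν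
  let b : Fin 8 → Bool := fun i => decide (v * t i ∈ S)
  have hb : 5 ≤ (univ.filter fun i => b i = true).card := by
    simp only [b, decide_eq_true_eq]
    simp only [Fintype.card_fin] at hv
    omega
  have hmt0 : mt0⁻¹ * mt0⁻¹ = 1 := by decide
  have hgi : ∀ i, emb φ (y i) * γ * (emb φ (y i))⁻¹ = emb φ (mt8 i * mt0⁻¹) * γ := by
    intro i
    have h1 : emb φ (y i) * γ * (emb φ (y i))⁻¹ =
        emb φ (y i) * (γ * emb φ (y i)⁻¹ * γ⁻¹) * γ := by
      rw [map_inv]; group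
    have h2 : y i * (mt0 * (y i)⁻¹ * mt0⁻¹) = y i * mt0 * (y i)⁻¹ * mt0⁻¹ := by group
    rw [h1, conj_emb φ γ mt0 _ hφ, ← map_mul, hy2, h2]
  have hgij : ∀ i j, (emb φ (y i) * γ * (emb φ (y i))⁻¹) * (emb φ (y j) * γ * (emb φ (y j))⁻¹) =
      emb φ (mt8 i * mt8 j) := by
    intro i j
    rw [hgi, hgi]
    have h1 : emb φ (mt8 i * mt0⁻¹) * γ * (emb φ (mt8 j * mt0⁻¹) * γ) =
        emb φ (mt8 i * mt0⁻¹) * (γ * emb φ (mt8 j * mt0⁻¹) * γ⁻¹) * (γ * γ) := by group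
    rw [h1, conj_emb φ γ mt0 _ hφ, ← map_mul, hγ2, mul_one]
    congr 1
    have h2 : mt8 i * mt0⁻¹ * (mt0 * (mt8 j * mt0⁻¹) * mt0⁻¹) =
        mt8 i * mt8 j * (mt0⁻¹ * mt0⁻¹) := by group
    rw [h2, hmt0, mul_one]
  have hmem : ∀ i j, b i = true → b j = true → ν * emb φ (mt8 i * mt8 j) * ν⁻¹ ∈
      H.map (alternatingGroup (Fin n)).subtype := by
    intro i j hi hj
    simp only [b, decide_eq_true_eq] at hi hj
    have h1 := (hSmem _).1 hi
    have h2 := (hSmem _).1 hj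
    refine ⟨_, H.mul_mem h1 h2, ?_⟩
    rw [← hgij]
    simp only [Subgroup.subtype_apply, Subgroup.coe_mul, Subgroup.coe_inv, t, ← hγ, ← hν]
    group
  obtain ⟨i, j, k, l, hi, hj, hk, hl, hw1, hw5⟩ := mt8_five b hb
  obtain ⟨i', j', hi', hj', hij, hsq⟩ := mt8_inv b hb
  obtain ⟨p, q, r, s, hpq, hrs, hpr, hps, hqr, hqs, hdt⟩ := mt8_dt i' j' hij hsq
  set w := mt8 i * mt8 j * mt8 k * mt8 l with hw
  have hord : orderOf w = 5 := by
    have : Fact (Nat.Prime 5) := ⟨Nat.prime_five⟩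
    exact orderOf_eq_prime hw5 hw1
  have hcyc : w.IsCycle := by
    apply Perm.isCycle_of_prime_order'
    · rw [hord]; exact Nat.prime_five
    · rw [hord]; simp
  have hwL : ν * emb φ w * ν⁻¹ ∈ H.map (alternatingGroup (Fin n)).subtype := by
    have h1 := Subgroup.mul_mem _ (hmem i j hi hj) (hmem k l hk hl)
    convert h1 using 1
    rw [hw, mul_assoc (mt8 i * mt8 j), map_mul]
    group
  have hdL := hmem i' j' hi' hj'
  have hdE : ν * emb φ (mt8 i' * mt8 j') * ν⁻¹ =
      swap (ν (φ p)) (ν (φ q)) * swap (ν (φ r)) (ν (φ s)) := by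
    rw [hdt, map_mul, emb_swap, emb_swap, Equiv.swap_apply_apply ν, Equiv.swap_apply_apply ν]
    group
  rw [hdE] at hdL
  refine hnot (jordan_five h8 _ hL _ hwL (emb_isCycle φ w hcyc).conj ?_ _ _ _ _ ?_ ?_ ?_ ?_ ?_ ?_ hdL)
  · rw [Perm.card_support_conj, emb_card_support, ← hcyc.orderOf, hord]
  all_goals simpa

open MulAction in
lemma prim_case {n : ℕ} (hn : 5 ≤ n) (H : Subgroup (alternatingGroup (Fin n))) (hH : H ≠ ⊤)
    (hL : IsPreprimitive (H.map (alternatingGroup (Fin n)).subtype) (Fin n))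
    (g : alternatingGroup (Fin n)) (hg : (orderOf g).Prime)
    (S : Finset (alternatingGroup (Fin n))) (hSmem : ∀ v, v ∈ S ↔ v * g * v⁻¹ ∈ H)
    (hS : Fintype.card (alternatingGroup (Fin n)) < 2 * S.card) : False := by
  set L := H.map (alternatingGroup (Fin n)).subtype with hLdef
  set γ : Perm (Fin n) := (g : Perm (Fin n)) with hγ
  have hγord : orderOf γ = orderOf g := by
    rw [hγ]; exact Subgroup.orderOf_coe g
  have hmemL : ∀ x : alternatingGroup (Fin n), x ∈ H → (x : Perm (Fin n)) ∈ L := by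
    intro x hx; exact ⟨x, hx, rfl⟩
  have hnot : ¬ alternatingGroup (Fin n) ≤ L := by
    intro h
    apply hH
    rw [eq_top_iff]
    intro x _
    obtain ⟨y, hy, hyx⟩ := h x.2
    have : y = x := Subtype.ext hyx
    rwa [← this]
  have hthree : ∀ z : Perm (Fin n), z.IsThreeCycle → z ∉ L := fun z hz hzL =>
    hnot (Perm.alternatingGroup_le_of_isPreprimitive_of_isThreeCycle_mem hL hz hzL)
  have hcomm : ∀ t : Perm (Fin n), Perm.sign t = 1 → ¬ (γ * t * γ⁻¹ * t⁻¹).IsThreeCycle := by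
    intro t ht h3
    let t' : alternatingGroup (Fin n) := ⟨t, ht⟩
    obtain ⟨v, hv⟩ := avg S ![1, t'] (by simp) hS
    have hall : (univ.filter fun i => v * ![1, t'] i ∈ S) = univ := by
      apply Finset.eq_univ_of_card
      have := Finset.card_le_univ (univ.filter fun i => v * ![1, t'] i ∈ S)
      simp only [Fintype.card_fin] at *
      omega
    have hi : ∀ i, v * ![1, t'] i ∈ S := by
      intro i
      have : i ∈ (univ.filter fun i => v * ![1, t'] i ∈ S) := by rw [hall]; simp
      simpa using this
    have h0 := (hSmem _).1 (hi 0)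
    have h1 := (hSmem _).1 (hi 1)
    simp only [Matrix.cons_val_zero, Matrix.cons_val_one, mul_one] at h0 h1
    have h2 := hmemL _ (H.mul_mem h0 (H.inv_mem h1))
    apply hthree _ (isThreeCycle_conj (v : Perm (Fin n)) _ h3)
    convert h2 using 1
    simp only [Subgroup.coe_mul, Subgroup.coe_inv, t', ← hγ]
    group
  have hcommE : ∀ (k : ℕ) (φ : Fin k ↪ Fin n) (e : Perm (Fin k)), (∀ x, γ (φ x) = φ (e x)) →
      ¬ ∃ y : Perm (Fin k), Perm.sign y = 1 ∧ ∃ p q r : Fin k, p ≠ q ∧ p ≠ r ∧ q ≠ r ∧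
        e * y * e⁻¹ * y⁻¹ = swap p q * swap p r := by
    rintro k φ e he ⟨y, hy, p, q, r, hpq, hpr, hqr, h⟩
    apply hcomm (emb φ y) (by rw [emb_sign, hy])
    rw [conj_emb φ γ e y he, ← map_inv, ← map_mul, h, map_mul, emb_swap, emb_swap]
    exact Perm.isThreeCycle_swap_mul_swap_same (by simpa using hpq) (by simpa using hpr)
      (by simpa using hqr)
  have hγ1 : γ ≠ 1 := by
    intro h; rw [← hγord, h, orderOf_one] at hg; exact Nat.not_prime_one hg
  obtain ⟨a, ha⟩ : ∃ a, γ a ≠ a := by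
    by_contra h; push Not at h; exact hγ1 (Equiv.ext h)
  have hpow : ∀ k x, k.Coprime (orderOf γ) → (γ ^ k) x = x → γ x = x := by
    intro k x hk hx
    obtain ⟨l, hl⟩ := exists_pow_eq_self_of_coprime hk
    rw [← hl]
    exact Perm.pow_apply_eq_self_of_apply_eq_self hx l
  rw [← hγord] at hg
  by_cases h2 : orderOf γ = 2
  · have hinv : ∀ x, γ (γ x) = x := by
      intro x
      have := pow_orderOf_eq_one γ
      rw [h2, pow_two] at this
      rw [← Perm.mul_apply, this, Perm.one_apply]
    by_cases hfix : ∃ c, γ c = c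
    · obtain ⟨c, hc⟩ := hfix
      have hca : c ≠ a := by rintro rfl; exact ha hc
      have hcb : c ≠ γ a := by
        intro h; rw [h, hinv] at hc; exact ha hc.symm
      refine hcommE 3 ⟨![a, γ a, c], ?_⟩ (swap 0 1) ?_ sw0_comm
      · rw [← List.nodup_ofFn]
        simp only [List.ofFn_succ, List.ofFn_zero, List.nodup_cons, List.mem_cons,
          List.not_mem_nil, not_or, Matrix.cons_val_zero, Matrix.cons_val_succ, List.nodup_nil,
          not_false_eq_true, and_true]
        grind
      · intro x
        fin_cases x
        · rfl
        · exact hinv a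
        · exact hc
    · push Not at hfix
      exact inv_case hn H hnot hL g hinv hfix S hSmem hS
  by_cases h3 : orderOf γ = 3
  · have hinv : ∀ x, γ (γ (γ x)) = x := by
      intro x
      have := pow_orderOf_eq_one γ
      rw [h3, pow_succ, pow_two] at this
      rw [← Perm.mul_apply, ← Perm.mul_apply, this, Perm.one_apply]
    have hinj : ∀ x y, γ x = γ y ↔ x = y := fun x y => γ.injective.eq_iff
    have h22 : ∀ x, γ x ≠ x → γ (γ x) ≠ x := by
      intro x hx h
      have := hinv x
      rw [h] at this
      exact hx this
    by_cases hd : ∃ d, γ d ≠ d ∧ d ≠ a ∧ d ≠ γ a ∧ d ≠ γ (γ a)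
    · obtain ⟨d, hd, hda, hdb, hdc⟩ := hd
      have i1 := h22 a ha
      have i2 := h22 d hd
      have i3 := hinv a
      have i4 := hinv d
      refine hcommE 6 ⟨![a, γ a, γ (γ a), d, γ d, γ (γ d)], ?_⟩ th0 ?_ th0_comm
      · rw [← List.nodup_ofFn]
        simp only [List.ofFn_succ, List.ofFn_zero, List.nodup_cons, List.mem_cons,
          List.not_mem_nil, not_or, Matrix.cons_val_zero, Matrix.cons_val_succ, List.nodup_nil,
          not_false_eq_true, and_true]
        grind
      · intro x
        fin_cases x
        · rfl
        · rfl
        · exact hinv a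
        · rfl
        · rfl
        · exact hinv d
    · push Not at hd
      have hsupp : γ.support ⊆ {a, γ a, γ (γ a)} := by
        intro x hx
        rw [Perm.mem_support] at hx
        simp only [mem_insert, mem_singleton]
        by_contra h
        push Not at h
        exact h.2.2 (hd x hx h.1 h.2.1)
      have hcyc : γ.IsThreeCycle := by
        apply card_support_eq_three_iff.1
        apply le_antisymm ((Finset.card_le_card hsupp).trans card_le_three)
        rw [← h3]
        by_contra hlt
        push Not at hlt
        rw [h3] at hlt
        have h1 : γ.support.card ≠ 0 := by
          rw [Ne, Perm.card_support_eq_zero]; exact hγ1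
        have h1' := Perm.card_support_ne_one γ
        have h2' : γ.support.card = 2 := by omega
        rw [Perm.card_support_eq_two] at h2'
        rw [h2'.orderOf] at h3
        omega
      have : S.Nonempty := by
        rw [← Finset.card_pos]
        omega
      obtain ⟨v, hv⟩ := this
      rw [hSmem] at hv
      exact hthree _ (isThreeCycle_conj (v : Perm (Fin n)) γ hcyc) (hmemL _ hv)
  · have c1 : Nat.Coprime 2 (orderOf γ) :=
      (Nat.coprime_primes Nat.prime_two hg).2 (Ne.symm h2)
    have c2 : Nat.Coprime 3 (orderOf γ) :=
      (Nat.coprime_primes Nat.prime_three hg).2 (Ne.symm h3)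
    have k1 : γ (γ a) ≠ a := fun h => ha (hpow 2 a c1 (by rw [pow_two]; exact h))
    have k2 : γ (γ (γ a)) ≠ a := fun h => ha (hpow 3 a c2 (by rw [pow_succ, pow_two]; exact h))
    have hinj : ∀ x y, γ x = γ y ↔ x = y := fun x y => γ.injective.eq_iff
    let φ : Fin 4 ↪ Fin n := ⟨![a, γ a, γ (γ a), γ (γ (γ a))], by
      rw [← List.nodup_ofFn]
      simp only [List.ofFn_succ, List.ofFn_zero, List.nodup_cons, List.mem_cons,
          List.not_mem_nil, not_or, Matrix.cons_val_zero, Matrix.cons_val_succ, List.nodup_nil,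
          not_false_eq_true, and_true]
      grind⟩
    apply hcomm (emb φ (swap 0 1 * swap 1 2)) (by rw [emb_sign]; decide)
    have e1 : γ * emb φ (swap 0 1 * swap 1 2) * γ⁻¹ = emb φ (swap 1 2 * swap 2 3) := by
      rw [map_mul, map_mul, emb_swap, emb_swap, emb_swap]
      have f1 := Equiv.swap_apply_apply γ (φ 0) (φ 1)
      have f2 := Equiv.swap_apply_apply γ (φ 1) (φ 2)
      have g0 : γ (φ 0) = φ 1 := rfl
      have g1 : γ (φ 1) = φ 2 := rfl
      have g2 : γ (φ 2) = φ 3 := rfl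
      rw [g0, g1] at f1
      rw [g1, g2] at f2
      have f3 : γ * (swap (φ 0) (φ 1) * swap (φ 1) (φ 2)) * γ⁻¹ =
          (γ * swap (φ 0) (φ 1) * γ⁻¹) * (γ * swap (φ 1) (φ 2) * γ⁻¹) := by group
      rw [f3, ← f1, ← f2]
    obtain ⟨p, q, r, hpq, hpr, hqr, h⟩ := four_comm
    rw [e1, ← map_inv, ← map_mul, h, map_mul, emb_swap, emb_swap]
    exact Perm.isThreeCycle_swap_mul_swap_same (by simpa using hpq) (by simpa using hpr)
      (by simpa using hqr)

section Final
open scoped Classical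

open MulAction Pointwise in
/-- A transitive imprimitive group preserves a nontrivial uniform partition. -/
lemma exists_partition {n : ℕ} (L : Subgroup (Perm (Fin n)))
    (htr : ∀ a b : Fin n, ∃ h ∈ L, h a = b) (hnp : ¬ IsPreprimitive L (Fin n)) :
    ∃ (f : Fin n → Set (Fin n)) (m : ℕ),
      (∀ i, (univ.filter fun j => f j = f i).card = m) ∧ 2 ≤ m ∧ m ∣ n ∧ m < n ∧
      ∀ h ∈ L, ∀ i j, f i = f j ↔ f (h i) = f (h j) := by
  have hpt : IsPretransitive L (Fin n) := ⟨fun a b => by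
    obtain ⟨h, hL, hh⟩ := htr a b
    exact ⟨⟨h, hL⟩, hh⟩⟩
  obtain ⟨B, hB, hnt⟩ : ∃ B : Set (Fin n), IsBlock L B ∧ ¬ IsTrivialBlock B := by
    by_contra hcon
    push Not at hcon
    exact hnp { isTrivialBlock_of_isBlock := fun {B} hB => hcon B hB }
  rw [IsTrivialBlock, not_or] at hnt
  obtain ⟨hns, hnu⟩ := hnt
  rw [Set.not_subsingleton_iff] at hns
  obtain ⟨a0, ha0⟩ := hns.nonempty
  have hex : ∀ i, ∃ h : L, h • a0 = i := fun i => hpt.exists_smul_eq a0 i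
  choose τ hτ using hex
  have hself : ∀ i, i ∈ τ i • B := fun i => ⟨a0, ha0, hτ i⟩
  have heq : ∀ (s t : L) (x : Fin n), x ∈ s • B → x ∈ t • B → s • B = t • B := by
    intro s t x hs ht
    exact hB.smul_eq_smul_of_nonempty ⟨x, hs, ht⟩
  have hiff : ∀ i j, τ i • B = τ j • B ↔ j ∈ τ i • B := by
    intro i j
    constructor
    · intro h; rw [h]; exact hself j
    · intro h; exact heq _ _ j h (hself j)
  have hmove : ∀ (h : L) i, τ (h • i) • B = h • (τ i • B) := by
    intro h i
    rw [smul_smul]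
    refine heq _ _ (h • i) (hself _) ?_
    rw [← smul_smul]
    exact Set.smul_mem_smul_set (hself i)
  refine ⟨fun i => τ i • B, B.ncard, ?_, ?_, ?_, ?_, ?_⟩
  · intro i
    have : (univ.filter fun j => τ j • B = τ i • B) = (τ i • B).toFinset := by
      ext j
      simp only [mem_filter, mem_univ, true_and, Set.mem_toFinset]
      rw [eq_comm, hiff]
    rw [this, ← Set.ncard_eq_toFinset_card', Set.ncard_smul_set]
  · have := (Set.one_lt_ncard_iff_nontrivial (s := B)).2 hns
    omega
  · have := hB.ncard_dvd_card hns.nonempty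
    rwa [Nat.card_eq_fintype_card, Fintype.card_fin] at this
  · have := Set.ncard_lt_card hnu
    rwa [Nat.card_eq_fintype_card, Fintype.card_fin] at this
  · intro h hL i j
    have h1 := hmove ⟨h, hL⟩ i
    have h2 := hmove ⟨h, hL⟩ j
    have e1 : (⟨h, hL⟩ : L) • i = h i := rfl
    have e2 : (⟨h, hL⟩ : L) • j = h j := rfl
    rw [e1] at h1
    rw [e2] at h2
    show _ ↔ τ (h i) • B = τ (h j) • B
    rw [h1, h2]
    exact (smul_left_cancel_iff _).symm

lemma impr_case {n : ℕ} (hn : 5 ≤ n) (H : Subgroup (alternatingGroup (Fin n)))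
    (htr : ∀ a b : Fin n, ∃ h ∈ H, ((h : Equiv.Perm (Fin n)) a = b))
    (hL : ¬ MulAction.IsPreprimitive (H.map (alternatingGroup (Fin n)).subtype) (Fin n))
    (g : alternatingGroup (Fin n)) (hg : (orderOf g).Prime)
    (S : Finset (alternatingGroup (Fin n))) (hSmem : ∀ v, v ∈ S ↔ v * g * v⁻¹ ∈ H) :
    2 * S.card ≤ Fintype.card (alternatingGroup (Fin n)) := by
  obtain ⟨f, m, hf, hm, hdvd, hmn, hinv⟩ := exists_partition _ (fun a b => by
    obtain ⟨h, hH, hh⟩ := htr a b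
    exact ⟨h, ⟨h, hH, rfl⟩, hh⟩) hL
  have hgo : (orderOf (g : Perm (Fin n))).Prime := by rwa [Subgroup.orderOf_coe]
  have hall := good_all hf hm hn hdvd hmn (g : Perm (Fin n)) hgo
  -- an odd permutation preserving the fibres
  obtain ⟨a, b, hab, hfab⟩ : ∃ a b : Fin n, a ≠ b ∧ f a = f b := by
    have h0 := hf ⟨0, by omega⟩
    obtain ⟨a, ha, b, hb, hab⟩ := Finset.one_lt_card.1 (by rw [h0]; omega :
      1 < (univ.filter fun j => f j = f ⟨0, by omega⟩).card)
    simp only [mem_filter, mem_univ, true_and] at ha hb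
    exact ⟨a, b, hab, ha.trans hb.symm⟩
  have hfs : ∀ x, f (swap a b x) = f x := by
    intro x
    rcases eq_or_ne x a with rfl | hxa
    · rw [swap_apply_left, hfab]
    rcases eq_or_ne x b with rfl | hxb
    · rw [swap_apply_right, hfab]
    rw [swap_apply_of_ne_of_ne hxa hxb]
  have hgood : ∀ v ∈ S, Good f (g : Perm (Fin n)) (v : Perm (Fin n)) := by
    intro v hv i j
    have h1 := (hSmem v).1 hv
    have h2 := hinv _ ⟨_, h1, rfl⟩ ((v : Perm (Fin n)) i) ((v : Perm (Fin n)) j)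
    simpa using h2
  have hsub : (S.map (Function.Embedding.subtype _)) ∪
      ((S.map (Function.Embedding.subtype _)).image fun v => swap a b * v) ⊆
      univ.filter fun v => Good f (g : Perm (Fin n)) v := by
    intro x hx
    simp only [mem_filter, mem_univ, true_and]
    rcases Finset.mem_union.1 hx with hx | hx
    · obtain ⟨v, hv, rfl⟩ := Finset.mem_map.1 hx
      exact hgood v hv
    · obtain ⟨w, hw, rfl⟩ := Finset.mem_image.1 hx
      obtain ⟨v, hv, rfl⟩ := Finset.mem_map.1 hw
      intro i j
      simp only [Perm.mul_apply, hfs]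
      exact hgood v hv i j
  have hdisj : Disjoint (S.map (Function.Embedding.subtype _))
      ((S.map (Function.Embedding.subtype _)).image fun v => swap a b * v) := by
    rw [Finset.disjoint_left]
    intro x hx hx'
    obtain ⟨v, hv, rfl⟩ := Finset.mem_map.1 hx
    obtain ⟨w, hw, hwv⟩ := Finset.mem_image.1 hx'
    obtain ⟨u, hu, rfl⟩ := Finset.mem_map.1 hw
    have e1 : Perm.sign (v : Perm (Fin n)) = 1 := v.2
    have e2 : Perm.sign (u : Perm (Fin n)) = 1 := u.2
    have e3 := congrArg Perm.sign hwv
    simp only [Function.Embedding.subtype_apply, map_mul, Perm.sign_swap hab, e1, e2] at e3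
    revert e3
    decide
  have hcard := Finset.card_le_card hsub
  rw [Finset.card_union_of_disjoint hdisj,
    Finset.card_image_of_injective _ (mul_right_injective _), Finset.card_map] at hcard
  have hn2 : Nontrivial (Fin n) := Fin.nontrivial_iff_two_le.2 (by omega)
  have hA := two_mul_card_alternatingGroup (α := Fin n)
  rw [Fintype.card_perm, Fintype.card_fin] at hA
  have hA' : 2 * Fintype.card (alternatingGroup (Fin n)) = n.factorial := by
    rw [← hA]
  omega

lemma count_fixed {G : Type*} [Group G] [Fintype G] (H : Subgroup G) (g : G)
    (S : Finset G) (hS : ∀ v, v ∈ S ↔ v * g * v⁻¹ ∈ H) :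
    Nat.card {x : G ⧸ H // g • x = x} * Nat.card H = S.card := by
  have e := QuotientGroup.preimageMkEquivSubgroupProdSet H {x : G ⧸ H | g • x = x}
  have h1 := Nat.card_congr e
  rw [Nat.card_prod] at h1
  have h2 : Nat.card {x : G ⧸ H // g • x = x} * Nat.card H =
      Nat.card (QuotientGroup.mk ⁻¹' {x : G ⧸ H | g • x = x} : Set G) := by
    rw [h1, mul_comm]; rfl
  have h3 : S.card = Nat.card S := by simp
  rw [h2, h3]
  refine Nat.card_congr ⟨fun u => ⟨u.1⁻¹, ?_⟩, fun v => ⟨v.1⁻¹, ?_⟩, fun u => Subtype.ext (inv_inv u.1),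
    fun v => Subtype.ext (inv_inv v.1)⟩
  · have hu : g • (QuotientGroup.mk u.1 : G ⧸ H) = QuotientGroup.mk u.1 := u.2
    rw [hS, inv_inv]
    rw [MulAction.Quotient.smul_mk, eq_comm, QuotientGroup.eq] at hu
    simpa [mul_assoc] using hu
  · have hv := (hS _).1 v.2
    change g • (QuotientGroup.mk v.1⁻¹ : G ⧸ H) = QuotientGroup.mk v.1⁻¹
    rw [MulAction.Quotient.smul_mk, eq_comm, QuotientGroup.eq]
    simpa [mul_assoc] using hv

lemma prime_case {n : ℕ} (hn : 5 ≤ n) (H : Subgroup (alternatingGroup (Fin n)))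
    (hH : H ≠ ⊤) (htr : ∀ a b : Fin n, ∃ h ∈ H, ((h : Equiv.Perm (Fin n)) a = b))
    (g : alternatingGroup (Fin n)) (hg : (orderOf g).Prime) :
    2 * Nat.card {x : alternatingGroup (Fin n) ⧸ H // g • x = x} ≤
      Nat.card (alternatingGroup (Fin n) ⧸ H) := by
  let S : Finset (alternatingGroup (Fin n)) := univ.filter fun v => v * g * v⁻¹ ∈ H
  have hS : ∀ v, v ∈ S ↔ v * g * v⁻¹ ∈ H := fun v => by simp [S]
  have h1 : 2 * S.card ≤ Fintype.card (alternatingGroup (Fin n)) := by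
    by_cases hL : MulAction.IsPreprimitive (H.map (alternatingGroup (Fin n)).subtype) (Fin n)
    · by_contra hcon
      push Not at hcon
      exact prim_case hn H hH hL g hg S hS hcon
    · exact impr_case hn H htr hL g hg S hS
  rw [← count_fixed H g S hS, ← Nat.card_eq_fintype_card,
    Subgroup.card_eq_card_quotient_mul_card_subgroup H, ← mul_assoc] at h1
  exact Nat.le_of_mul_le_mul_right h1 Nat.card_pos

end Final

end FPR

/-- Let `n ≥ 5` and let `H` be a maximal subgroup of `A_n` that is transitive on
`{1,…,n}`. Then for every nonidentity `g ∈ A_n`, the fixed point ratio of `g` acting on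
the coset space `A_n/H` is at most `1/2`. -/
theorem fpr_alt_coset_le_half (n : ℕ) (hn : 5 ≤ n)
    (H : Subgroup (alternatingGroup (Fin n)))
    (hmax : IsCoatom H)
    (htrans : ∀ a b : Fin n, ∃ h ∈ H, ((h : Equiv.Perm (Fin n)) a = b)) :
    ∀ g : alternatingGroup (Fin n), g ≠ 1 →
      (Nat.card {x : alternatingGroup (Fin n) ⧸ H // g • x = x} : ℚ) /
          (Nat.card (alternatingGroup (Fin n) ⧸ H) : ℚ) ≤ 1 / 2 := by
  intro g hg
  have ho : orderOf g ≠ 1 := by rwa [Ne, orderOf_eq_one_iff]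
  obtain ⟨p, hp, k, hk⟩ := Nat.exists_prime_and_dvd ho
  have hpos := orderOf_pos g
  have hk0 : k ≠ 0 := by rintro rfl; rw [mul_zero] at hk; omega
  have hord : orderOf (g ^ k) = p := by
    rw [orderOf_pow_of_dvd hk0 ⟨p, by rw [hk, mul_comm]⟩, hk,
      Nat.mul_div_cancel _ (Nat.pos_of_ne_zero hk0)]
  have hmain := FPR.prime_case hn H hmax.1 htrans (g ^ k) (by rw [hord]; exact hp)
  have hle : Nat.card {x : alternatingGroup (Fin n) ⧸ H // g • x = x} ≤
      Nat.card {x : alternatingGroup (Fin n) ⧸ H // g ^ k • x = x} := by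
    apply Nat.card_le_card_of_injective
      (fun x : {x : alternatingGroup (Fin n) ⧸ H // g • x = x} =>
        (⟨x.1, by
          have hx := x.2
          clear hord hmain
          clear hk0 hk
          induction k with
          | zero => simp
          | succ k ih => rw [pow_succ, mul_smul, hx, ih]⟩ :
          {x : alternatingGroup (Fin n) ⧸ H // g ^ k • x = x}))
    intro x y hxy
    exact Subtype.ext (Subtype.mk.inj hxy)
  have hq : 0 < Nat.card (alternatingGroup (Fin n) ⧸ H) := Nat.card_pos
  rw [div_le_div_iff₀ (by exact_mod_cast hq) (by norm_num)]
  have : 2 * Nat.card {x : alternatingGroup (Fin n) ⧸ H // g • x = x} ≤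
      Nat.card (alternatingGroup (Fin n) ⧸ H) := by omega
  have h' : (2 * Nat.card {x : alternatingGroup (Fin n) ⧸ H // g • x = x} : ℚ) ≤
      Nat.card (alternatingGroup (Fin n) ⧸ H) := by exact_mod_cast this
  linarith
end

section
/- Let n ≥ 5 and let H be a maximal subgroup of A_n that is transitive on {1,…,n}. Then for every nonidentity g ∈ S_n, the fixed point ratio of g acting on the coset space S_n/H satisfies fpr(g, S_n/H) ≤ 3/4. -/
open Classical in
/-- The number of `σ` conjugating `g` into `H`. -/
noncomputable def conjCount {n : ℕ} (H : Subgroup (Equiv.Perm (Fin n)))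
    (g : Equiv.Perm (Fin n)) : ℕ :=
  (Finset.univ.filter fun σ : Equiv.Perm (Fin n) => σ⁻¹ * g * σ ∈ H).card

lemma conjCount_le {n : ℕ} (H : Subgroup (Equiv.Perm (Fin n)))
    (g : Equiv.Perm (Fin n)) : conjCount H g ≤ n.factorial := by
  classical
  unfold conjCount
  refine (Finset.card_filter_le _ _).trans ?_
  simp [Fintype.card_perm]

lemma exists_of_conjCount_pos {n : ℕ} (H : Subgroup (Equiv.Perm (Fin n)))
    (g : Equiv.Perm (Fin n)) (h : 0 < conjCount H g) :
    ∃ σ : Equiv.Perm (Fin n), σ⁻¹ * g * σ ∈ H := by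
  classical
  unfold conjCount at h
  obtain ⟨σ, hσ⟩ := Finset.card_pos.mp h
  exact ⟨σ, by simpa using hσ⟩

lemma conjCount_comm {n : ℕ} (H : Subgroup (Equiv.Perm (Fin n)))
    (g t : Equiv.Perm (Fin n)) :
    2 * conjCount H g ≤ conjCount H (g * t * g⁻¹ * t⁻¹) + n.factorial := by
  classical
  have h2 : conjCount H (t * g⁻¹ * t⁻¹) = conjCount H g := by
    unfold conjCount
    refine Finset.card_bij (fun σ _ => t⁻¹ * σ) ?_ ?_ ?_
    · intro σ hσ
      simp only [Finset.mem_filter, Finset.mem_univ, true_and] at hσ ⊢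
      rw [← H.inv_mem_iff]
      convert hσ using 1
      group
    · intro a _ b _ h
      simpa using h
    · intro b hb
      simp only [Finset.mem_filter, Finset.mem_univ, true_and] at hb
      refine ⟨t * b, ?_, by group⟩
      simp only [Finset.mem_filter, Finset.mem_univ, true_and]
      rw [← H.inv_mem_iff]
      convert hb using 1
      group
  have key : conjCount H g + conjCount H (t * g⁻¹ * t⁻¹) ≤
      conjCount H (g * t * g⁻¹ * t⁻¹) + n.factorial := by
    unfold conjCount
    rw [← Finset.card_inter_add_card_union]
    refine add_le_add (Finset.card_le_card ?_) ?_
    · intro σ hσ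
      simp only [Finset.mem_inter, Finset.mem_filter, Finset.mem_univ, true_and] at hσ ⊢
      convert H.mul_mem hσ.1 hσ.2 using 1
      group
    · refine (Finset.card_le_univ _).trans ?_
      simp [Fintype.card_perm]
  omega

lemma fpr_eq {n : ℕ} (H : Subgroup (Equiv.Perm (Fin n))) (g : Equiv.Perm (Fin n)) :
    conjCount H g = Nat.card H * Nat.card {x : Equiv.Perm (Fin n) ⧸ H // g • x = x} := by
  classical
  have := QuotientGroup.card_preimage_mk H {x : Equiv.Perm (Fin n) ⧸ H | g • x = x}
  rw [Set.coe_ofPred] at this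
  rw [← this]
  unfold conjCount
  rw [Nat.card_eq_card_toFinset]
  congr 1
  ext σ
  simp only [Finset.mem_filter, Finset.mem_univ, true_and, Set.mem_toFinset, Set.mem_preimage,
    Set.mem_ofPred_eq]
  rw [eq_comm, MulAction.Quotient.smul_coe, QuotientGroup.eq, smul_eq_mul, mul_assoc]

open scoped Pointwise in
lemma exists_block {n : ℕ} (H : Subgroup (Equiv.Perm (Fin n)))
    (hA : ¬ alternatingGroup (Fin n) ≤ H)
    (htrans : ∀ a b : Fin n, ∃ σ ∈ H, σ a = b)
    (y : Equiv.Perm (Fin n)) (hy : y ∈ H) (hy3 : y.IsThreeCycle) :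
    ∃ B : Finset (Fin n), 2 ≤ B.card ∧ B ≠ Finset.univ ∧
      ∀ g ∈ H, ∀ h ∈ H, B.image g ≠ B.image h → Disjoint (B.image g) (B.image h) := by
  classical
  by_contra hcon
  push Not at hcon
  apply hA
  refine Equiv.Perm.alternatingGroup_le_of_isPreprimitive_of_isThreeCycle_mem ?_ hy3 hy
  have : MulAction.IsPretransitive H (Fin n) := ⟨fun a b => by
    obtain ⟨σ, h1, h2⟩ := htrans a b
    exact ⟨⟨σ, h1⟩, h2⟩⟩
  refine ⟨?_⟩
  intro B hB
  by_contra hnt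
  unfold MulAction.IsTrivialBlock at hnt
  push Not at hnt
  obtain ⟨hns, hnu⟩ := hnt
  have him : ∀ g : H, ((B.toFinset.image (g : Equiv.Perm (Fin n)) : Finset (Fin n)) : Set (Fin n))
      = g • B := by
    intro g
    rw [Finset.coe_image, Set.coe_toFinset]
    rfl
  obtain ⟨g, hg, h, hh, hne, hnd⟩ := hcon B.toFinset (by
    obtain ⟨a, ha, b, hb, hab⟩ := hns
    exact Finset.one_lt_card.mpr ⟨a, by simpa using ha, b, by simpa using hb, hab⟩) (by
    intro h
    apply hnu
    rw [← Set.coe_toFinset B, h, Finset.coe_univ])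
  apply hnd
  rw [← Finset.disjoint_coe, him ⟨g, hg⟩, him ⟨h, hh⟩]
  apply hB
  intro heq
  apply hne
  rw [← Finset.coe_inj, him ⟨g, hg⟩, him ⟨h, hh⟩, heq]

lemma exists_family {n : ℕ} (H : Subgroup (Equiv.Perm (Fin n)))
    (hA : ¬ alternatingGroup (Fin n) ≤ H)
    (htrans : ∀ a b : Fin n, ∃ σ ∈ H, σ a = b)
    (y : Equiv.Perm (Fin n)) (hy : y ∈ H) (hy3 : y.IsThreeCycle) :
    ∃ (k : ℕ) (F : Fin n → Finset (Fin n)), 2 * k ≤ n ∧ (∀ p, (F p).card = k) ∧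
      (∀ p, p ∈ F p) ∧ ∀ x ∈ H, x.support.card ≤ 4 → ∀ p, x p ∈ F p := by
  classical
  obtain ⟨B, hB2, hBu, hB⟩ := exists_block H hA htrans y hy hy3
  obtain ⟨b, hb⟩ : B.Nonempty := Finset.card_pos.mp (by omega)
  choose h hH hh using fun p => htrans b p
  have hcard : ∀ g : Equiv.Perm (Fin n), (B.image g).card = B.card := fun g =>
    Finset.card_image_of_injective _ g.injective
  have hmem : ∀ p, p ∈ B.image (h p) := fun p => Finset.mem_image.mpr ⟨b, hb, hh p⟩
  -- stabilisation
  have hstab : ∀ x ∈ H, x.support.card < 2 * B.card → ∀ p, ∀ q ∈ B.image (h p),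
      x q ∈ B.image (h p) := by
    intro x hx hxs p q hq
    have hxim : B.image (x * h p : Equiv.Perm (Fin n)) = (B.image (h p)).image x := by
      rw [Finset.image_image]; rfl
    by_cases heq : B.image (x * h p : Equiv.Perm (Fin n)) = B.image (h p)
    · rw [← heq, hxim]
      exact Finset.mem_image_of_mem _ hq
    · exfalso
      have hd := hB _ (H.mul_mem hx (hH p)) _ (hH p) heq
      have hsub : B.image (x * h p : Equiv.Perm (Fin n)) ∪ B.image (h p) ⊆ x.support := by
        have h1 : ∀ z ∈ B.image (h p), x z ≠ z := by
          intro z hz hxz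
          apply Finset.disjoint_left.mp hd _ hz
          rw [hxim, ← hxz]
          exact Finset.mem_image_of_mem _ hz
        intro z hz
        rw [Equiv.Perm.mem_support]
        rcases Finset.mem_union.mp hz with hz | hz
        · rw [hxim] at hz
          obtain ⟨w, hw, rfl⟩ := Finset.mem_image.mp hz
          intro hc
          exact h1 w hw (x.injective hc)
        · exact h1 z hz
      have := Finset.card_le_card hsub
      rw [Finset.card_union_of_disjoint hd, hcard, hcard] at this
      omega
  have hk3 : 3 ≤ B.card := by
    obtain ⟨a, ha⟩ : y.support.Nonempty := Finset.card_pos.mp (by rw [hy3.card_support]; omega)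
    have hs := hstab y hy (by rw [hy3.card_support]; omega) a
    have h1 := hs a (hmem a)
    have h2 := hs _ h1
    have hya : y a ≠ a := Equiv.Perm.mem_support.mp ha
    have hyya : y (y a) ≠ a := by
      intro hc
      have hd := (hy3.nodup_iff_mem_support (a := a)).mpr ha
      simp [hc] at hd
    rw [← hcard (h a)]
    have hle := Finset.card_le_card (s := {a, y a, y (y a)}) (t := B.image (h a)) (by
      intro z hz
      simp only [Finset.mem_insert, Finset.mem_singleton] at hz
      rcases hz with rfl | rfl | rfl
      · exact hmem _
      · exact h1
      · exact h2)
    rw [Finset.card_eq_three.mpr ⟨a, y a, y (y a), hya.symm, hyya.symm,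
      fun hc => hya (y.injective hc).symm, rfl⟩] at hle
    exact hle
  refine ⟨B.card, fun p => B.image (h p), ?_, fun p => hcard _, hmem, ?_⟩
  · obtain ⟨c, hc⟩ : ∃ c, c ∉ B := by
      by_contra hcon
      push Not at hcon
      exact hBu (Finset.eq_univ_iff_forall.mpr hcon)
    have h1 : B.image (1 : Equiv.Perm (Fin n)) = B := by simp
    have hne : B.image (h c) ≠ B.image (1 : Equiv.Perm (Fin n)) := by
      rw [h1]
      intro heq
      exact hc (heq ▸ hmem c)
    have hd := hB _ (hH c) _ H.one_mem hne
    have := Finset.card_le_univ (B.image (h c) ∪ B.image (1 : Equiv.Perm (Fin n)))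
    rw [Finset.card_union_of_disjoint hd, hcard, hcard, Fintype.card_fin] at this
    omega
  · intro x hx hxs p
    exact hstab x hx (by omega) p p (hmem p)

lemma count_family {n k : ℕ} (F : Fin n → Finset (Fin n)) (hk : 2 * k ≤ n)
    (hF : ∀ p, (F p).card = k) (hpF : ∀ p, p ∈ F p) (a b : Fin n) (hab : b ≠ a) :
    2 * (Finset.univ.filter fun τ : Equiv.Perm (Fin n) => τ b ∈ F (τ a)).card ≤ n.factorial := by
  classical
  set f : Fin n → ℕ := fun c =>
    (Finset.univ.filter fun τ : Equiv.Perm (Fin n) => τ c ∈ F (τ a)).card with hf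
  have hconst : ∀ c ∈ Finset.univ.erase a, f c = f b := by
    intro c hc
    have hca : c ≠ a := Finset.ne_of_mem_erase hc
    refine Finset.card_bij (fun τ _ => τ * Equiv.swap b c) ?_ ?_ ?_
    · intro τ hτ
      simpa [Equiv.swap_apply_of_ne_of_ne hab.symm hca.symm] using hτ
    · intro x _ y _ h
      simpa using h
    · intro τ hτ
      refine ⟨τ * Equiv.swap b c, ?_, by simp [mul_assoc]⟩
      simpa [Equiv.swap_apply_of_ne_of_ne hab.symm hca.symm] using hτ
  have hsum : ∑ c ∈ Finset.univ.erase a, f c = n.factorial * (k - 1) := by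
    have h1 : ∀ c, f c = ∑ τ : Equiv.Perm (Fin n), if τ c ∈ F (τ a) then 1 else 0 := by
      intro c
      rw [hf]
      simp only [Finset.card_filter]
    simp_rw [h1]
    rw [Finset.sum_comm]
    have h2 : ∀ τ : Equiv.Perm (Fin n),
        (∑ c ∈ Finset.univ.erase a, if τ c ∈ F (τ a) then 1 else 0) = k - 1 := by
      intro τ
      rw [← Finset.card_filter, ← hF (τ a), ← Finset.card_erase_of_mem (hpF (τ a))]
      refine Finset.card_bij (fun c _ => τ c) ?_ ?_ ?_
      · intro c hc
        simpa using hc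
      · intro x _ y _ h
        exact τ.injective h
      · intro q hq
        refine ⟨τ⁻¹ q, ?_, by simp⟩
        simp only [Finset.mem_erase, Finset.mem_filter, Finset.mem_univ, and_true] at hq ⊢
        refine ⟨?_, by simpa using hq.2⟩
        intro h
        apply hq.1
        rw [← h]
        simp
    rw [Finset.sum_congr rfl (fun τ _ => h2 τ)]
    simp [Fintype.card_perm]
  rw [Finset.sum_congr rfl hconst] at hsum
  simp only [Finset.sum_const, Finset.card_erase_of_mem (Finset.mem_univ a), Finset.card_univ,
    Fintype.card_fin, smul_eq_mul] at hsum
  have hn : 2 ≤ n := by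
    have := a.isLt; have := b.isLt
    have : (b : ℕ) ≠ a := fun h => hab (Fin.ext h)
    omega
  have hkk : 2 * (k - 1) ≤ n - 1 := by omega
  change 2 * f b ≤ _
  have hpos : 0 < n - 1 := by omega
  refine Nat.le_of_mul_le_mul_left ?_ hpos
  calc (n - 1) * (2 * f b) = n.factorial * (2 * (k - 1)) := by
        rw [Nat.mul_left_comm, hsum]; ring
    _ ≤ n.factorial * (n - 1) := Nat.mul_le_mul_left _ hkk
    _ = _ := Nat.mul_comm _ _

lemma half_bound {n : ℕ} (H : Subgroup (Equiv.Perm (Fin n)))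
    (hA : ¬ alternatingGroup (Fin n) ≤ H)
    (htrans : ∀ a b : Fin n, ∃ σ ∈ H, σ a = b)
    (y : Equiv.Perm (Fin n)) (hy : y ∈ H) (hy3 : y.IsThreeCycle)
    (c : Equiv.Perm (Fin n)) (hc : c ≠ 1) (hc4 : c.support.card ≤ 4) :
    2 * conjCount H c ≤ n.factorial := by
  classical
  obtain ⟨k, F, hk, hF, hpF, hx⟩ := exists_family H hA htrans y hy hy3
  obtain ⟨a, ha⟩ : ∃ a, c a ≠ a := by
    by_contra hcon
    push Not at hcon
    exact hc (Equiv.ext hcon)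
  refine le_trans ?_ (count_family F hk hF hpF a (c a) ha)
  refine Nat.mul_le_mul_left _ ?_
  unfold conjCount
  refine Finset.card_le_card_of_injOn (fun σ => σ⁻¹) ?_ (fun x _ y _ h => inv_injective h)
  intro σ hσ
  simp only [Finset.coe_filter, Finset.mem_univ, true_and, Set.mem_ofPred_eq] at hσ ⊢
  have := hx _ hσ (by
    have h1 := Equiv.Perm.card_support_conj (σ := σ⁻¹) (τ := c)
    rw [inv_inv] at h1
    rw [h1]; exact hc4) (σ⁻¹ a)
  simpa using this

lemma three_bound {n : ℕ} (H : Subgroup (Equiv.Perm (Fin n)))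
    (hA : ¬ alternatingGroup (Fin n) ≤ H)
    (htrans : ∀ a b : Fin n, ∃ σ ∈ H, σ a = b)
    (c : Equiv.Perm (Fin n)) (hc : c.IsThreeCycle) :
    2 * conjCount H c ≤ n.factorial := by
  rcases Nat.eq_zero_or_pos (conjCount H c) with h0 | h0
  · simp [h0]
  · obtain ⟨σ, hσ⟩ := exists_of_conjCount_pos H c h0
    refine half_bound H hA htrans _ hσ ?_ c hc.ne_one (by rw [hc.card_support]; omega)
    rw [← card_support_eq_three_iff]
    have h1 := Equiv.Perm.card_support_conj (σ := σ⁻¹) (τ := c)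
    rw [inv_inv] at h1
    rw [h1, hc.card_support]

lemma double_bound {n : ℕ} (hn : 5 ≤ n) (H : Subgroup (Equiv.Perm (Fin n)))
    (hA : ¬ alternatingGroup (Fin n) ≤ H)
    (htrans : ∀ a b : Fin n, ∃ σ ∈ H, σ a = b)
    (a b c d : Fin n) (hab : a ≠ b) (hcd : c ≠ d) (hac : a ≠ c) (had : a ≠ d)
    (hbc : b ≠ c) (hbd : b ≠ d) :
    2 * conjCount H (Equiv.swap a b * Equiv.swap c d) ≤ n.factorial := by
  classical
  by_contra hlt
  push Not at hlt
  obtain ⟨e, he⟩ : ∃ e : Fin n, e ∉ ({a, b, c, d} : Finset (Fin n)) := by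
    by_contra hcon
    push Not at hcon
    have h1 := Finset.eq_univ_iff_forall.mpr hcon
    have h2 : ({a, b, c, d} : Finset (Fin n)).card ≤ 4 := Finset.card_le_four
    rw [h1, Finset.card_univ, Fintype.card_fin] at h2
    omega
  simp only [Finset.mem_insert, Finset.mem_singleton, not_or] at he
  obtain ⟨hea, heb, hec, hed⟩ := he
  set g := Equiv.swap a b * Equiv.swap c d with hg
  have hcomm := conjCount_comm H g (Equiv.swap d e)
  have hgd : g d = c := by
    simp [hg, Equiv.swap_apply_of_ne_of_ne hac.symm hbc.symm]
  have hge : g e = e := by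
    simp [hg, Equiv.swap_apply_of_ne_of_ne hec hed, Equiv.swap_apply_of_ne_of_ne hea heb]
  have heq : g * Equiv.swap d e * g⁻¹ * (Equiv.swap d e)⁻¹ = Equiv.swap e c * Equiv.swap e d := by
    rw [← Equiv.swap_apply_apply, hgd, hge, Equiv.swap_inv, Equiv.swap_comm c e,
      Equiv.swap_comm d e]
  have h3 : (Equiv.swap e c * Equiv.swap e d).IsThreeCycle :=
    Equiv.Perm.isThreeCycle_swap_mul_swap_same hec hed hcd
  rw [heq] at hcomm
  obtain ⟨σ, hσ⟩ := exists_of_conjCount_pos H (Equiv.swap e c * Equiv.swap e d) (by omega)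
  have := half_bound H hA htrans _ hσ (by
    rw [← card_support_eq_three_iff]
    have h1 := Equiv.Perm.card_support_conj (σ := σ⁻¹) (τ := Equiv.swap e c * Equiv.swap e d)
    rw [inv_inv] at h1
    rw [h1, h3.card_support]) g (by
      intro h
      rw [h] at hgd
      exact hcd hgd.symm) (by
      refine (Finset.card_le_card (Equiv.Perm.support_mul_le _ _)).trans ?_
      refine (Finset.card_union_le _ _).trans ?_
      rw [Equiv.Perm.card_support_swap hab, Equiv.Perm.card_support_swap hcd])
  omega

lemma main_bound {n : ℕ} (hn : 5 ≤ n) (H : Subgroup (Equiv.Perm (Fin n)))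
    (hlt : H < alternatingGroup (Fin n))
    (htrans : ∀ a b : Fin n, ∃ σ ∈ H, σ a = b)
    (g : Equiv.Perm (Fin n)) (hg : g ≠ 1) :
    4 * conjCount H g ≤ 3 * n.factorial := by
  classical
  have hA : ¬ alternatingGroup (Fin n) ≤ H := not_le_of_gt hlt
  obtain ⟨a, ha⟩ : ∃ a, g a ≠ a := by
    by_contra hcon
    push Not at hcon
    exact hg (Equiv.ext hcon)
  by_cases h3 : ∃ x, g (g x) ≠ x
  · obtain ⟨x, hx⟩ := h3
    have hx1 : g x ≠ x := fun h => hx (by rw [h, h])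
    have hx2 : g (g x) ≠ g x := fun h => hx1 (g.injective h)
    have hcomm := conjCount_comm H g (Equiv.swap x (g x))
    rw [← Equiv.swap_apply_apply, Equiv.swap_inv, Equiv.swap_comm x (g x)] at hcomm
    have := three_bound H hA htrans _
      (Equiv.Perm.isThreeCycle_swap_mul_swap_same hx2.symm hx1 hx)
    omega
  · push Not at h3
    by_cases hc : ∃ c, c ≠ a ∧ c ≠ g a ∧ g c ≠ c
    · obtain ⟨c, hca, hcb, hc⟩ := hc
      have hcomm := conjCount_comm H g (Equiv.swap a c)
      rw [← Equiv.swap_apply_apply, Equiv.swap_inv] at hcomm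
      have := double_bound hn H hA htrans (g a) (g c) a c
        (fun h => hca (g.injective h).symm) hca.symm ha hcb.symm
        (fun h => hcb (by rw [← h, h3])) hc
      omega
    · push Not at hc
      have hsw : g = Equiv.swap a (g a) := by
        ext x
        by_cases h1 : x = a
        · subst h1; simp
        · by_cases h2 : x = g a
          · subst h2; simp [h3]
          · rw [hc x h1 h2, Equiv.swap_apply_of_ne_of_ne h1 h2]
      have h0 : conjCount H g = 0 := by
        by_contra hne
        obtain ⟨σ, hσ⟩ := exists_of_conjCount_pos H g (Nat.pos_of_ne_zero hne)
        have h1 := hlt.le hσ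
        rw [Equiv.Perm.mem_alternatingGroup] at h1
        have h2 : Equiv.Perm.sign g = -1 := by
          rw [hsw]; exact Equiv.Perm.sign_swap ha.symm
        simp only [map_mul, map_inv, h2] at h1
        rcases Int.units_eq_one_or (Equiv.Perm.sign σ) with h | h <;> rw [h] at h1 <;>
          exact absurd h1 (by decide)
      omega

/-- Let `n ≥ 5` and let `H ≤ S_n` be a subgroup contained in `A_n`, maximal in `A_n`,
and transitive on `{1,…,n}`. Then for every nonidentity `g ∈ S_n`, the fixed point ratio
of `g` acting on the coset space `S_n/H` is at most `3/4`. -/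
theorem fpr_symm_coset_le_three_quarters (n : ℕ) (hn : 5 ≤ n)
    (H : Subgroup (Equiv.Perm (Fin n)))
    (hlt : H < alternatingGroup (Fin n))
    (hmax : ∀ K : Subgroup (Equiv.Perm (Fin n)), H < K →
      K ≤ alternatingGroup (Fin n) → K = alternatingGroup (Fin n))
    (htrans : ∀ a b : Fin n, ∃ σ ∈ H, σ a = b) :
    ∀ g : Equiv.Perm (Fin n), g ≠ 1 →
      (Nat.card {x : Equiv.Perm (Fin n) ⧸ H // g • x = x} : ℚ) /
          (Nat.card (Equiv.Perm (Fin n) ⧸ H) : ℚ) ≤ 3 / 4 := by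
  intro g hg
  have h1 := main_bound hn H hlt htrans g hg
  have h2 := fpr_eq H g
  have h3 := Subgroup.card_eq_card_quotient_mul_card_subgroup H
  have h4 : Nat.card (Equiv.Perm (Fin n)) = n.factorial := by
    simp [Nat.card_eq_fintype_card, Fintype.card_perm]
  rw [h2, ← h4, h3] at h1
  have hH : 0 < Nat.card H := Nat.card_pos
  have hQ : 0 < Nat.card (Equiv.Perm (Fin n) ⧸ H) := Nat.card_pos
  have h5 : 4 * Nat.card {x : Equiv.Perm (Fin n) ⧸ H // g • x = x} ≤
      3 * Nat.card (Equiv.Perm (Fin n) ⧸ H) := by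
    refine Nat.le_of_mul_le_mul_left ?_ hH
    linarith
  rw [div_le_div_iff₀ (by exact_mod_cast hQ) (by norm_num)]
  have h6 : (4 : ℚ) * Nat.card {x : Equiv.Perm (Fin n) ⧸ H // g • x = x} ≤
      3 * Nat.card (Equiv.Perm (Fin n) ⧸ H) := by exact_mod_cast h5
  linarith
end

section
/- Let n ≥ 5 and let H be a maximal transitive subgroup of A_n. Then the minimal index of A_n acting on A_n/H satisfies ind(A_n, A_n/H) ≥ [A_n : H]/4, where the minimal index is the minimum over nonidentity g ∈ A_n of |A_n/H| minus the number of orbits of g on A_n/H. -/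
namespace MinIdx

section
open Equiv Equiv.Perm
set_option linter.unusedVariables false
set_option linter.unusedSectionVars false
variable {α : Type*} [DecidableEq α]
def CC (i j k : α) : Perm α := swap i j * swap j k
theorem C_rot {i j k : α} (h1 : i ≠ j) (h2 : j ≠ k) (h3 : i ≠ k) : CC i j k = CC j k i := by
  ext x; simp only [CC, Perm.mul_apply, swap_apply_def]; grind
theorem C_inv {i j k : α} (h1 : i ≠ j) (h2 : j ≠ k) (h3 : i ≠ k) : (CC i j k)⁻¹ = CC j i k := by
  rw [inv_eq_iff_mul_eq_one]
  ext x; simp only [CC, Perm.mul_apply, swap_apply_def, Perm.one_apply]; grind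
theorem C_conj (g : Perm α) (i j k : α) : g * CC i j k * g⁻¹ = CC (g i) (g j) (g k) := by
  simp [CC, Equiv.swap_apply_apply, mul_assoc]

def CRel (P : Subgroup (Perm α)) (i j : α) : Prop := i = j ∨ ∃ k, k ≠ i ∧ k ≠ j ∧ CC i j k ∈ P

theorem CRel.refl (P : Subgroup (Perm α)) (i : α) : CRel P i i := Or.inl rfl

theorem CRel.of_mem {P : Subgroup (Perm α)} {i j k : α} (h1 : i ≠ j) (h2 : j ≠ k) (h3 : i ≠ k)
    (h : CC i j k ∈ P) : CRel P i j := Or.inr ⟨k, h3.symm, h2.symm, h⟩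

theorem CRel.symm {P : Subgroup (Perm α)} {i j : α} (h : CRel P i j) : CRel P j i := by
  by_cases hij : i = j
  · exact Or.inl hij.symm
  rcases h with h | ⟨k, h1, h2, h3⟩
  · exact Or.inl h.symm
  · refine Or.inr ⟨k, h2, h1, ?_⟩
    rw [← C_inv hij h2.symm h1.symm]
    exact P.inv_mem h3

theorem CRel.of_mem' {P : Subgroup (Perm α)} {i j k : α} (h1 : i ≠ j) (h2 : j ≠ k) (h3 : i ≠ k)
    (h : CC i j k ∈ P) : CRel P i k := by
  rw [C_rot h1 h2 h3, C_rot h2 h3.symm h1.symm] at h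
  exact (CRel.of_mem h3.symm h1 h2.symm h).symm

theorem conj_mem' {P : Subgroup (Perm α)} {g : Perm α} (hg : g ∈ P) {i j k : α} (h : CC i j k ∈ P) :
    CC (g i) (g j) (g k) ∈ P := by
  rw [← C_conj]; exact P.mul_mem (P.mul_mem hg h) (P.inv_mem hg)

theorem CRel.map {P : Subgroup (Perm α)} {g : Perm α} (hg : g ∈ P) {i j : α} (h : CRel P i j) :
    CRel P (g i) (g j) := by
  rcases h with h | ⟨k, h1, h2, h3⟩
  · exact Or.inl (by rw [h])
  · exact Or.inr ⟨g k, by simpa using h1, by simpa using h2, conj_mem' hg h3⟩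

theorem C_a {i j k : α} (h1 : i ≠ j) (h2 : j ≠ k) (h3 : i ≠ k) : CC i j k i = j := by
  simp only [CC, Perm.mul_apply, swap_apply_def]; grind
theorem C_b {i j k : α} (h1 : i ≠ j) (h2 : j ≠ k) (h3 : i ≠ k) : CC i j k j = k := by
  simp only [CC, Perm.mul_apply, swap_apply_def]; grind
theorem C_c {i j k : α} (h1 : i ≠ j) (h2 : j ≠ k) (h3 : i ≠ k) : CC i j k k = i := by
  simp only [CC, Perm.mul_apply, swap_apply_def]; grind
theorem C_d {i j k l : α} (h1 : l ≠ i) (h2 : l ≠ j) (h3 : l ≠ k) : CC i j k l = l := by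
  simp only [CC, Perm.mul_apply, swap_apply_def]; grind

theorem CRel.trans {P : Subgroup (Perm α)} {i j l : α} (h : CRel P i j) (h' : CRel P j l) :
    CRel P i l := by
  by_cases hij : i = j
  · rwa [hij]
  by_cases hjl : j = l
  · rwa [← hjl]
  by_cases hil : i = l
  · exact Or.inl hil
  rcases h with h | ⟨k, h1, h2, h3⟩
  · exact absurd h hij
  by_cases hkl : k = l
  · subst hkl
    exact CRel.of_mem' hij h2.symm h1.symm h3
  · rw [C_rot hij h2.symm h1.symm, C_rot h2.symm h1 (Ne.symm hij)] at h3
    have h4 : CC j i k ∈ P := by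
      rw [← C_inv hij h2.symm h1.symm, C_rot hij h2.symm h1.symm, C_rot h2.symm h1 (Ne.symm hij)]
      exact P.inv_mem h3
    have := CRel.map h4 h'
    rwa [C_a (Ne.symm hij) h1.symm h2.symm, C_d (Ne.symm hjl) (Ne.symm hil) (Ne.symm hkl)] at this

theorem C_mem_of_rel {P : Subgroup (Perm α)} {i j k : α} (h1 : i ≠ j) (h2 : j ≠ k) (h3 : i ≠ k)
    (hP : ∀ a b, CRel P a b) : CC i j k ∈ P := by
  rcases hP i j with h | ⟨m, hm1, hm2, hm⟩
  · exact absurd h h1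
  by_cases hmk : m = k
  · rwa [← hmk]
  rcases hP m k with h | ⟨q, hq1, hq2, hq⟩
  · exact absurd h hmk
  by_cases hqi : q = i
  · subst hqi
    have e := conj_mem' (P.inv_mem hq) hm
    rw [C_inv hmk hq2.symm hq1.symm, C_c (Ne.symm hmk) hm1 h3.symm,
      C_d h2 hm2.symm h1.symm, C_b (Ne.symm hmk) hm1 h3.symm] at e
    rw [← inv_mem_iff, C_inv h1 h2 h3, C_rot h1.symm h3 h2, C_rot h3 h2.symm h1]
    exact e
  by_cases hqj : q = j
  · subst hqj
    have e := conj_mem' (P.inv_mem hq) hm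
    rw [C_inv hmk hq2.symm hq1.symm, C_d h3 hm1.symm h1, C_c (Ne.symm hmk) hm2 h2.symm,
      C_b (Ne.symm hmk) hm2 h2.symm] at e
    rw [← inv_mem_iff, C_inv h1 h2 h3, C_rot h1.symm h3 h2]
    exact e
  · have e := conj_mem' hq hm
    rwa [C_d hm1.symm h3 (Ne.symm hqi), C_d hm2.symm h2 (Ne.symm hqj),
      C_a hmk hq2.symm hq1.symm] at e

theorem alt_le_of_rel [Fintype α] {P : Subgroup (Perm α)} (hP : ∀ a b, CRel P a b) :
    alternatingGroup α ≤ P := by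
  rw [← closure_three_cycles_eq_alternating, Subgroup.closure_le]
  intro σ hσ
  have hσ : σ.IsThreeCycle := hσ
  obtain ⟨a, ha⟩ : σ.support.Nonempty := by
    rw [← Finset.card_pos, hσ.card_support]; norm_num
  have h := hσ.eq_swap_mul_swap_iff_mem_support.mpr ha
  have h' := hσ.nodup_iff_mem_support.mpr ha
  simp at h'
  show σ ∈ P
  rw [h]
  exact C_mem_of_rel h'.2 (fun e => h'.2 (σ.injective e)) h'.1.2 hP

variable [Fintype α]

/-- `g` lies in the conjugate of `P` by `t`. -/
def Inn (P : Subgroup (Perm α)) (t : alternatingGroup α) (g : Perm α) : Prop :=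
  (t : Perm α)⁻¹ * g * t ∈ P

/-- The relation attached to the conjugate of `P` by `t`. -/
def QQ (P : Subgroup (Perm α)) (t : alternatingGroup α) (a b : α) : Prop :=
  CRel P ((t : Perm α)⁻¹ a) ((t : Perm α)⁻¹ b)

open Classical in
/-- number of `t` satisfying `E`. -/
noncomputable def cnt (E : alternatingGroup α → Prop) : ℕ := (Finset.univ.filter E).card

theorem Inn.mul {P : Subgroup (Perm α)} {t : alternatingGroup α} {g h : Perm α}
    (hg : Inn P t g) (hh : Inn P t h) : Inn P t (g * h) := by
  have := P.mul_mem hg hh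
  simpa [Inn, mul_assoc] using this

theorem Inn.inv {P : Subgroup (Perm α)} {t : alternatingGroup α} {g : Perm α}
    (hg : Inn P t g) : Inn P t g⁻¹ := by
  have := P.inv_mem hg
  simpa [Inn, mul_assoc] using this

theorem Inn.pow {P : Subgroup (Perm α)} {t : alternatingGroup α} {g : Perm α}
    (hg : Inn P t g) (k : ℕ) : Inn P t (g ^ k) := by
  have := P.pow_mem hg k
  have e : ((t : Perm α)⁻¹ * g * t) ^ k = (t : Perm α)⁻¹ * g ^ k * t := by
    have := conj_pow (i := k) (a := (t : Perm α)⁻¹) (b := g)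
    simpa using this
  rw [e] at this
  exact this

theorem QQ.refl (P : Subgroup (Perm α)) (t : alternatingGroup α) (a : α) : QQ P t a a :=
  CRel.refl _ _

theorem QQ.symm {P : Subgroup (Perm α)} {t : alternatingGroup α} {a b : α} (h : QQ P t a b) :
    QQ P t b a := CRel.symm h

theorem QQ.trans {P : Subgroup (Perm α)} {t : alternatingGroup α} {a b c : α} (h : QQ P t a b)
    (h' : QQ P t b c) : QQ P t a c := CRel.trans h h'

theorem QQ.map {P : Subgroup (Perm α)} {t : alternatingGroup α} {a b : α} {g : Perm α}
    (hg : Inn P t g) (h : QQ P t a b) : QQ P t (g a) (g b) := by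
  have := CRel.map hg h
  simpa [QQ, Perm.mul_apply] using this

theorem Inn.rel {P : Subgroup (Perm α)} {t : alternatingGroup α} {i j k : α}
    (h1 : i ≠ j) (h2 : j ≠ k) (h3 : i ≠ k) (h : Inn P t (CC i j k)) :
    QQ P t i j ∧ QQ P t i k := by
  have e : CC ((t : Perm α)⁻¹ i) ((t : Perm α)⁻¹ j) ((t : Perm α)⁻¹ k) ∈ P := by
    rw [← C_conj]; simpa [Inn] using h
  exact ⟨CRel.of_mem (by simpa using h1) (by simpa using h2) (by simpa using h3) e,
    CRel.of_mem' (by simpa using h1) (by simpa using h2) (by simpa using h3) e⟩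

theorem cnt_mono {E E' : alternatingGroup α → Prop} (h : ∀ t, E t → E' t) : cnt E ≤ cnt E' := by
  classical
  exact Finset.card_le_card (fun t => by simpa using h t)

theorem cnt_le (E : alternatingGroup α → Prop) : cnt E ≤ Fintype.card (alternatingGroup α) := by
  classical
  exact Finset.card_le_univ _

theorem cnt_shift {E E' : alternatingGroup α → Prop} (σ : alternatingGroup α)
    (h : ∀ t, E t ↔ E' (σ * t)) : cnt E = cnt E' := by
  classical
  refine Finset.card_bij (fun t _ => σ * t) ?_ ?_ ?_
  · intro t ht; simpa [← h] using ht
  · intro a _ b _ hab; simpa using hab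
  · intro b hb
    refine ⟨σ⁻¹ * b, ?_, by simp⟩
    simpa [h] using hb

theorem Inn_shift (P : Subgroup (Perm α)) (σ t : alternatingGroup α) (g : Perm α) :
    Inn P t g ↔ Inn P (σ * t) ((σ : Perm α) * g * (σ : Perm α)⁻¹) := by
  simp [Inn, mul_assoc]

theorem QQ_shift (P : Subgroup (Perm α)) (σ t : alternatingGroup α) (a b : α) :
    QQ P t a b ↔ QQ P (σ * t) ((σ : Perm α) a) ((σ : Perm α) b) := by
  simp [QQ]

/-- If the centralizer of `x` has an odd element, all conjugates of `x` have equal counts. -/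
theorem cnt_conj (P : Subgroup (Perm α)) (x σ τ : Perm α) (hσ : sign σ = -1) (hc : σ * x = x * σ) :
    cnt (fun t => Inn P t (τ * x * τ⁻¹)) = cnt (fun t => Inn P t x) := by
  symm
  have hcc : σ * x * σ⁻¹ = x := by rw [hc]; simp
  rcases Int.units_eq_one_or (sign τ) with h | h
  · exact cnt_shift ⟨τ, h⟩ (fun t => Inn_shift P _ t x)
  · refine cnt_shift ⟨τ * σ, by simp [mem_alternatingGroup, h, hσ]⟩ (fun t => ?_)
    rw [Inn_shift P ⟨τ * σ, by simp [mem_alternatingGroup, h, hσ]⟩ t x]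
    have : (τ * σ) * x * (τ * σ)⁻¹ = τ * x * τ⁻¹ := by
      calc _ = τ * (σ * x * σ⁻¹) * τ⁻¹ := by group
        _ = _ := by rw [hcc]
    simp only [this]

theorem class_size {P : Subgroup (Perm α)} (hP : ¬ alternatingGroup α ≤ P)
    (ht : ∀ a b : α, ∃ h ∈ P, h a = b) : ∃ c : ℕ, 2 * c ≤ Fintype.card α ∧ (c = 1 ∨ 3 ≤ c) ∧
    (∀ t a, ∀ S : Finset α, (∀ b, b ∈ S ↔ QQ P t a b) → S.card = c) := by
  classical
  have hne : ∃ a b, ¬ CRel P a b := by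
    by_contra! h; exact hP (alt_le_of_rel h)
  obtain ⟨a, b, hab⟩ := hne
  have key : ∀ a', (Finset.univ.filter (CRel P a')).card = (Finset.univ.filter (CRel P a)).card := by
    intro a'
    obtain ⟨h, hh, rfl⟩ := ht a a'
    symm
    refine Finset.card_bij (fun t _ => h t) ?_ ?_ ?_
    · intro t ht; simp only [Finset.mem_filter, Finset.mem_univ, true_and] at ht ⊢
      exact ht.map hh
    · intro a _ b _ hab; simpa using hab
    · intro b hb
      refine ⟨h⁻¹ b, ?_, by simp⟩
      simp only [Finset.mem_filter, Finset.mem_univ, true_and] at hb ⊢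
      simpa using hb.map (P.inv_mem hh)
  refine ⟨(Finset.univ.filter (CRel P a)).card, ?_, ?_, ?_⟩
  · have := key b
    have hd : Disjoint (Finset.univ.filter (CRel P a)) (Finset.univ.filter (CRel P b)) := by
      rw [Finset.disjoint_left]
      intro x hx hx'
      simp only [Finset.mem_filter, Finset.mem_univ, true_and] at hx hx'
      exact hab (hx.trans hx'.symm)
    have h2 := Finset.card_le_univ (Finset.univ.filter (CRel P a) ∪ Finset.univ.filter (CRel P b))
    rw [Finset.card_union_of_disjoint hd] at h2
    omega
  · by_cases hx : ∃ x, x ≠ a ∧ CRel P a x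
    · right
      obtain ⟨x, hxa, h⟩ := hx
      rcases h with h | ⟨k, h1, h2, h3⟩
      · exact absurd h.symm hxa
      have hs : ({a, x, k} : Finset α) ⊆ Finset.univ.filter (CRel P a) := by
        intro y hy
        simp only [Finset.mem_insert, Finset.mem_singleton] at hy
        simp only [Finset.mem_filter, Finset.mem_univ, true_and]
        rcases hy with rfl | rfl | rfl
        · exact CRel.refl _ _
        · exact CRel.of_mem hxa.symm h2.symm h1.symm h3
        · exact CRel.of_mem' hxa.symm h2.symm h1.symm h3
      have := Finset.card_le_card hs
      rwa [Finset.card_eq_three.mpr ⟨a, x, k, hxa.symm, h1.symm, h2.symm, rfl⟩] at this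
    · left
      rw [Finset.card_eq_one]
      refine ⟨a, ?_⟩
      ext y
      simp only [Finset.mem_filter, Finset.mem_univ, true_and, Finset.mem_singleton]
      constructor
      · intro h; by_contra h'; exact hx ⟨y, h', h⟩
      · rintro rfl; exact CRel.refl _ _
  · intro t a' S hS
    rw [← key ((t : Perm α)⁻¹ a')]
    refine Finset.card_bij (fun x _ => (t : Perm α)⁻¹ x) ?_ ?_ ?_
    · intro x hx
      simp only [Finset.mem_filter, Finset.mem_univ, true_and]
      exact (hS x).1 hx
    · intro a _ b _ hab; simpa using hab
    · intro b hb
      simp only [Finset.mem_filter, Finset.mem_univ, true_and] at hb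
      exact ⟨(t : Perm α) b, (hS _).2 (by simpa [QQ] using hb), by simp⟩

open Classical in
theorem avg (E : alternatingGroup α → α → Prop) (S : Finset α) {j : α} (hj : j ∉ S)
    (hinv : ∀ j', j' ∉ S → j' ≠ j → cnt (fun t => E t j) = cnt (fun t => E t j')) :
    (Fintype.card α - S.card) * cnt (fun t => E t j) =
      ∑ t : alternatingGroup α, (Finset.univ.filter (fun j => j ∉ S ∧ E t j)).card := by
  have h1 : ∑ j' ∈ Sᶜ, cnt (fun t => E t j') = (Fintype.card α - S.card) * cnt (fun t => E t j) := by
    rw [← Finset.card_compl, ← smul_eq_mul]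
    apply Finset.sum_eq_card_nsmul
    intro j' hj'
    by_cases h : j' = j
    · rw [h]
    · exact (hinv j' (by simpa using hj') h).symm
  rw [← h1]
  simp only [cnt, Finset.card_filter]
  rw [Finset.sum_comm]
  apply Finset.sum_congr rfl
  intro t _
  rw [← Finset.sum_filter_add_sum_filter_not Finset.univ (· ∈ S)]
  have e1 : ∑ x ∈ Finset.univ.filter (· ∈ S), (if x ∉ S ∧ E t x then 1 else 0) = 0 := by
    apply Finset.sum_eq_zero
    intro x hx
    simp at hx
    simp [hx]
  rw [e1, zero_add]
  apply Finset.sum_congr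
  · ext; simp
  · intro x hx
    simp at hx
    simp [hx]

open Classical in
theorem sum_ind (E : alternatingGroup α → Prop) :
    ∑ t : alternatingGroup α, (if E t then 1 else 0) = cnt E := by
  rw [cnt, Finset.card_filter]

/-- Class size hypothesis. -/
def Cls (P : Subgroup (Perm α)) (c : ℕ) : Prop :=
  ∀ t a, ∀ S : Finset α, (∀ b, b ∈ S ↔ QQ P t a b) → S.card = c

theorem sign_two {a b c d : α} (h : a ≠ b) (h' : c ≠ d) :
    swap a b * swap c d ∈ alternatingGroup α := by
  simp [mem_alternatingGroup, sign_swap h, sign_swap h']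

theorem exists_not_mem_three (h : 4 ≤ Fintype.card α) (a b c : α) :
    ∃ d, d ≠ a ∧ d ≠ b ∧ d ≠ c := by
  have : ∃ d, d ∉ ({a, b, c} : Finset α) := by
    by_contra! h'
    have := Finset.card_le_card (fun x _ => h' x : Finset.univ ⊆ ({a, b, c} : Finset α))
    have h3 := Finset.card_le_three (a := a) (b := b) (c := c)
    rw [Finset.card_univ] at this
    omega
  simpa using this

theorem cnt_two {P : Subgroup (Perm α)} {c : ℕ} (hc : Cls P c) (hn : 4 ≤ Fintype.card α)
    {a b : α} (hab : a ≠ b) :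
    (Fintype.card α - 1) * cnt (fun t => QQ P t a b) =
      (c - 1) * Fintype.card (alternatingGroup α) := by
  classical
  have := avg (fun t j => QQ P t a j) {a} (j := b) (by simpa using hab.symm) (by
    intro j' hj' hne
    simp at hj'
    obtain ⟨l, hl1, hl2, hl3⟩ := exists_not_mem_three hn a b j'
    refine cnt_shift ⟨CC b j' l, sign_two hne.symm hl3.symm⟩ (fun t => ?_)
    rw [QQ_shift P ⟨CC b j' l, sign_two hne.symm hl3.symm⟩ t]
    simp only
    rw [C_d hab (Ne.symm hj') hl1.symm, C_a hne.symm hl3.symm hl2.symm])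
  rw [Finset.card_singleton] at this
  rw [this, Finset.sum_eq_card_nsmul (b := c - 1), smul_eq_mul, mul_comm, Finset.card_univ]
  intro t _
  have h := hc t a (Finset.univ.filter (fun j => QQ P t a j)) (by simp)
  rw [← h, ← Finset.card_erase_of_mem (a := a) (by simp [QQ.refl])]
  congr 1
  ext x; simp

theorem cnt_three {P : Subgroup (Perm α)} {c : ℕ} (hc : Cls P c)
    {a b d : α} (hab : a ≠ b) (had : a ≠ d) (hbd : b ≠ d) :
    (Fintype.card α - 2) * cnt (fun t => QQ P t a b ∧ QQ P t a d) =
      (c - 2) * cnt (fun t => QQ P t a b) := by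
  classical
  have := avg (fun t j => QQ P t a b ∧ QQ P t a j) {a, b} (j := d)
    (by simp [had.symm, hbd.symm]) (by
    intro j' hj' hne
    simp at hj'
    refine cnt_shift ⟨swap d j' * swap a b, sign_two hne.symm hab⟩ (fun t => ?_)
    rw [QQ_shift P ⟨swap d j' * swap a b, sign_two hne.symm hab⟩ t a b,
      QQ_shift P ⟨swap d j' * swap a b, sign_two hne.symm hab⟩ t a d]
    simp only
    have e1 : (swap d j' * swap a b) a = b := by
      simp only [Perm.mul_apply, swap_apply_def]; grind
    have e2 : (swap d j' * swap a b) b = a := by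
      simp only [Perm.mul_apply, swap_apply_def]; grind
    have e3 : (swap d j' * swap a b) d = j' := by
      simp only [Perm.mul_apply, swap_apply_def]; grind
    rw [e1, e2, e3]
    constructor
    · rintro ⟨h1, h2⟩; exact ⟨h1.symm, h1.symm.trans h2⟩
    · rintro ⟨h1, h2⟩; exact ⟨h1.symm, h1.symm.trans h2⟩)
  rw [Finset.card_pair hab] at this
  rw [this, ← sum_ind, Finset.mul_sum]
  apply Finset.sum_congr rfl
  intro t _
  by_cases hq : QQ P t a b
  · have h := hc t a (Finset.univ.filter (fun j => QQ P t a j)) (by simp)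
    rw [← h, if_pos hq, mul_one, ← Finset.card_pair hab, ← Finset.card_sdiff_of_subset]
    · congr 1
      ext x; simp [hq]; tauto
    · intro x; simp; rintro (rfl | rfl)
      · exact QQ.refl _ _ _
      · exact hq
  · simp [hq]

theorem cnt_three_le {P : Subgroup (Perm α)} {c : ℕ} (hc : Cls P c) (hn : 4 ≤ Fintype.card α)
    (h2 : 2 * c ≤ Fintype.card α) {a b d : α} (hab : a ≠ b) (had : a ≠ d) (hbd : b ≠ d) :
    4 * cnt (fun t => QQ P t a b ∧ QQ P t a d) ≤ Fintype.card (alternatingGroup α) := by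
  have e1 := cnt_two hc hn hab
  have e2 := cnt_three hc hab had hbd
  set N2 := cnt (fun t => QQ P t a b)
  set N3 := cnt (fun t => QQ P t a b ∧ QQ P t a d)
  set n := Fintype.card α
  set g := Fintype.card (alternatingGroup α)
  have f1 : 2 * N2 ≤ g := by
    have : (n - 1) * (2 * N2) ≤ (n - 1) * g := by
      calc (n - 1) * (2 * N2) = 2 * ((n - 1) * N2) := by ring
        _ = (2 * (c - 1)) * g := by rw [e1]; ring
        _ ≤ (n - 1) * g := Nat.mul_le_mul_right _ (by omega)
    exact Nat.le_of_mul_le_mul_left this (by omega)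
  have f2 : 2 * N3 ≤ N2 := by
    have : (n - 2) * (2 * N3) ≤ (n - 2) * N2 := by
      calc (n - 2) * (2 * N3) = 2 * ((n - 2) * N3) := by ring
        _ = (2 * (c - 2)) * N2 := by rw [e2]; ring
        _ ≤ (n - 2) * N2 := Nat.mul_le_mul_right _ (by omega)
    exact Nat.le_of_mul_le_mul_left this (by omega)
  omega

theorem cnt_two_two {P : Subgroup (Perm α)} {c : ℕ} (hc : Cls P c) (hc3 : 3 ≤ c)
    {a b d e : α} (hab : a ≠ b) (had : a ≠ d) (hae : a ≠ e) (hbd : b ≠ d) (hbe : b ≠ e)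
    (hde : d ≠ e) :
    (Fintype.card α - 3) * cnt (fun t => QQ P t a b ∧ QQ P t d e) +
      2 * cnt (fun t => QQ P t d e ∧ QQ P t d a) = (c - 1) * cnt (fun t => QQ P t d e) := by
  classical
  have := avg (fun t j => QQ P t a j ∧ QQ P t d e) {a, d, e} (j := b)
    (by simp [hab.symm, hbd, hbe]) (by
    intro j' hj' hne
    simp at hj'
    refine cnt_shift ⟨swap b j' * swap d e, sign_two hne.symm hde⟩ (fun t => ?_)
    rw [QQ_shift P ⟨swap b j' * swap d e, sign_two hne.symm hde⟩ t a b,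
      QQ_shift P ⟨swap b j' * swap d e, sign_two hne.symm hde⟩ t d e]
    simp only
    have e1 : (swap b j' * swap d e) d = e := by
      simp only [Perm.mul_apply, swap_apply_def]; grind
    have e2 : (swap b j' * swap d e) e = d := by
      simp only [Perm.mul_apply, swap_apply_def]; grind
    have e3 : (swap b j' * swap d e) b = j' := by
      simp only [Perm.mul_apply, swap_apply_def]; grind
    have e4 : (swap b j' * swap d e) a = a := by
      simp only [Perm.mul_apply, swap_apply_def]; grind
    rw [e1, e2, e3, e4]
    constructor
    · rintro ⟨h1, h2⟩; exact ⟨h1, h2.symm⟩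
    · rintro ⟨h1, h2⟩; exact ⟨h1, h2.symm⟩)
  rw [Finset.card_eq_three.mpr ⟨a, d, e, had, hae, hde, rfl⟩] at this
  rw [this, ← sum_ind, ← sum_ind, Finset.mul_sum, Finset.mul_sum, ← Finset.sum_add_distrib]
  apply Finset.sum_congr rfl
  intro t _
  by_cases hq : QQ P t d e
  · have h := hc t a (Finset.univ.filter (fun j => QQ P t a j)) (by simp)
    by_cases hr : QQ P t d a
    · have : ∀ T : Finset α, (∀ j, j ∈ T ↔ j ∉ ({a, d, e} : Finset α) ∧ QQ P t a j ∧ QQ P t d e) →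
          T.card = c - 3 := by
        intro T hT
        have : T = (Finset.univ.filter (fun j => QQ P t a j)) \ {a, d, e} := by
          ext x; rw [hT]; simp [hq]; tauto
        rw [this, Finset.card_sdiff_of_subset, h,
          Finset.card_eq_three.mpr ⟨a, d, e, had, hae, hde, rfl⟩]
        intro x; simp; rintro (rfl | rfl | rfl)
        · exact QQ.refl _ _ _
        · exact hr.symm
        · exact hr.symm.trans hq
      rw [this _ (fun x => by simp)]
      simp [hq, hr]; omega
    · have : ∀ T : Finset α, (∀ j, j ∈ T ↔ j ∉ ({a, d, e} : Finset α) ∧ QQ P t a j ∧ QQ P t d e) →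
          T.card = c - 1 := by
        intro T hT
        have : T = (Finset.univ.filter (fun j => QQ P t a j)).erase a := by
          ext x; rw [hT]; simp [hq]
          intro hx hax
          constructor
          · rintro rfl; exact hr hx.symm
          · rintro rfl; exact hr (hq.trans hx.symm)
        rw [this, Finset.card_erase_of_mem (by simp [QQ.refl]), h]
      rw [this _ (fun x => by simp)]
      simp [hq, hr]
  · simp [hq]

theorem cnt_two_two_le {P : Subgroup (Perm α)} {c : ℕ} (hc : Cls P c) (hc3 : 3 ≤ c)
    (h2 : 2 * c ≤ Fintype.card α)
    {a b d e : α} (hab : a ≠ b) (had : a ≠ d) (hae : a ≠ e) (hbd : b ≠ d) (hbe : b ≠ e)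
    (hde : d ≠ e) :
    4 * cnt (fun t => QQ P t a b ∧ QQ P t d e) ≤ Fintype.card (alternatingGroup α) := by
  have e1 := cnt_two hc (by omega) hde
  have e2 := cnt_three hc hde had.symm hae.symm
  have e3 := cnt_two_two hc hc3 hab had hae hbd hbe hde
  set N2 := cnt (fun t => QQ P t d e)
  set N3 := cnt (fun t => QQ P t d e ∧ QQ P t d a)
  set M := cnt (fun t => QQ P t a b ∧ QQ P t d e)
  set n := Fintype.card α
  set g := Fintype.card (alternatingGroup α)
  obtain ⟨k, rfl⟩ := Nat.exists_eq_add_of_le hc3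
  obtain ⟨m, hm⟩ := Nat.exists_eq_add_of_le h2
  clear_value n g N2 N3 M
  subst hm
  have w1 : 2 * (3 + k) + m - 1 = 5 + 2 * k + m := by omega
  have w2 : 2 * (3 + k) + m - 2 = 4 + 2 * k + m := by omega
  have w3 : 2 * (3 + k) + m - 3 = 3 + 2 * k + m := by omega
  have w4 : 3 + k - 1 = 2 + k := by omega
  have w5 : 3 + k - 2 = 1 + k := by omega
  rw [w1, w4] at e1
  rw [w2, w5] at e2
  rw [w3, w4] at e3
  zify at e1 e2 e3 ⊢
  have hpos : (0:ℤ) < (5 + 2 * k + m) * ((4 + 2 * k + m) * (3 + 2 * k + m)) := by positivity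
  have key : ((5 + 2 * k + m) * ((4 + 2 * k + m) * (3 + 2 * k + m)) : ℤ) * M =
      (2 + k) * ((2 + k) * (4 + 2 * k + m) - 2 * (1 + k)) * g := by
    linear_combination (5 + 2 * k + m : ℤ) * (4 + 2 * k + m) * e3 - 2 * (5 + 2 * k + m : ℤ) * e2 +
      ((2 + k) * (4 + 2 * k + m) - 2 * (1 + k) : ℤ) * e1
  have key2 : (4 * ((2 + k) * ((2 + k) * (4 + 2 * k + m) - 2 * (1 + k))) : ℤ) ≤
    (5 + 2 * k + m) * ((4 + 2 * k + m) * (3 + 2 * k + m)) := by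
    have hk : (0:ℤ) ≤ k := by positivity
    have hm : (0:ℤ) ≤ m := by positivity
    rw [← sub_nonneg]
    ring_nf
    positivity
  have : ((5 + 2 * k + m) * ((4 + 2 * k + m) * (3 + 2 * k + m)) : ℤ) * (4 * M) ≤
    ((5 + 2 * k + m) * ((4 + 2 * k + m) * (3 + 2 * k + m)) : ℤ) * g := by
    calc _ = 4 * (((5 + 2 * k + m) * ((4 + 2 * k + m) * (3 + 2 * k + m)) : ℤ) * M) := by ring
      _ = (4 * ((2 + k) * ((2 + k) * (4 + 2 * k + m) - 2 * (1 + k))) : ℤ) * g := by rw [key]; ring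
      _ ≤ _ := mul_le_mul_of_nonneg_right key2 (by positivity)
  exact le_of_mul_le_mul_left this hpos

theorem dbl_rel {P : Subgroup (Perm α)} {c : ℕ} (hc : Cls P c) (hc3 : 3 ≤ c)
    {a b d e : α} (hab : a ≠ b) (had : a ≠ d) (hae : a ≠ e) (hbd : b ≠ d) (hbe : b ≠ e)
    (hde : d ≠ e) (t : alternatingGroup α) (h : Inn P t (swap a b * swap d e)) : QQ P t a b := by
  classical
  by_contra hn
  have e1 : (swap a b * swap d e) a = b := by
    simp only [Perm.mul_apply, swap_apply_def]; grind
  have e2 : (swap a b * swap d e) d = e := by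
    simp only [Perm.mul_apply, swap_apply_def]; grind
  have h3 := hc t a (Finset.univ.filter (fun j => QQ P t a j)) (by simp)
  have hsub : Finset.univ.filter (fun j => QQ P t a j) ⊆ {a, d, e} := by
    intro y hy
    simp only [Finset.mem_filter, Finset.mem_univ, true_and] at hy
    by_contra hy'
    simp at hy'
    have hyb : y ≠ b := by rintro rfl; exact hn hy
    have e3 : (swap a b * swap d e) y = y := by
      simp only [Perm.mul_apply, swap_apply_def]; grind
    have := hy.map h
    rw [e1, e3] at this
    exact hn (hy.trans this.symm)
  have heq := Finset.eq_of_subset_of_card_le hsub (by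
    rw [h3]; exact le_trans Finset.card_le_three hc3)
  have hd : QQ P t a d := by
    have : d ∈ Finset.univ.filter (fun j => QQ P t a j) := by rw [heq]; simp
    simpa using this
  have he : QQ P t a e := by
    have : e ∈ Finset.univ.filter (fun j => QQ P t a j) := by rw [heq]; simp
    simpa using this
  have := hd.map h
  rw [e1, e2] at this
  exact hn (he.trans this.symm)

theorem cnt_dbl {P : Subgroup (Perm α)} {c : ℕ} (hc : Cls P c) (hc3 : c = 1 ∨ 3 ≤ c)
    (h2 : 2 * c ≤ Fintype.card α) (hn : 7 ≤ Fintype.card α)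
    {a b d e : α} (hab : a ≠ b) (had : a ≠ d) (hae : a ≠ e) (hbd : b ≠ d) (hbe : b ≠ e)
    (hde : d ≠ e) :
    4 * cnt (fun t => Inn P t (swap a b * swap d e)) ≤ Fintype.card (alternatingGroup α) := by
  classical
  rcases hc3 with rfl | hc3
  · have := avg (fun t j => Inn P t (swap a b * swap d j)) {a, b, d} (j := e)
      (by simp [hae.symm, hbe.symm, hde.symm]) (by
      intro j' hj' hne
      simp at hj'
      refine cnt_shift ⟨swap e j' * swap a b, sign_two hne.symm hab⟩ (fun t => ?_)
      rw [Inn_shift P ⟨swap e j' * swap a b, sign_two hne.symm hab⟩ t]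
      have : (swap e j' * swap a b) * (swap a b * swap d e) * (swap e j' * swap a b)⁻¹
          = swap a b * swap d j' := by
        rw [mul_inv_eq_iff_eq_mul]
        ext x
        simp only [Perm.mul_apply, swap_apply_def]; grind
      simp only [this])
    rw [Finset.card_eq_three.mpr ⟨a, b, d, hab, had, hbd, rfl⟩] at this
    have hle : ∑ t : alternatingGroup α, (Finset.univ.filter
        (fun j => j ∉ ({a, b, d} : Finset α) ∧ Inn P t (swap a b * swap d j))).card ≤
        ∑ t : alternatingGroup α, 1 := by
      apply Finset.sum_le_sum
      intro t _
      rw [Finset.card_le_one]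
      intro x hx y hy
      simp at hx hy
      by_contra hxy
      have h1 := hx.2.mul hy.2
      have h3 : (swap a b * swap d x) * (swap a b * swap d y) = CC x d y := by
        ext x
        simp only [CC, Perm.mul_apply, swap_apply_def]; grind
      rw [h3] at h1
      have h4 := (Inn.rel hx.1.2.2 (Ne.symm hy.1.2.2) hxy h1).1
      have h5 := hc t x (Finset.univ.filter (fun j => QQ P t x j)) (by simp)
      rw [Finset.card_eq_one] at h5
      obtain ⟨w, hw⟩ := h5
      have w1 : x ∈ Finset.univ.filter (fun j => QQ P t x j) := by simp [QQ.refl]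
      have w2 : d ∈ Finset.univ.filter (fun j => QQ P t x j) := by simp [h4]
      rw [hw, Finset.mem_singleton] at w1 w2
      exact hx.1.2.2 (w1.trans w2.symm)
    simp only [Finset.sum_const, Finset.card_univ, smul_eq_mul, mul_one] at hle
    refine le_trans (Nat.mul_le_mul_right _ (by omega : 4 ≤ Fintype.card α - 3)) ?_
    rw [this]
    convert hle
  · refine le_trans (Nat.mul_le_mul_left 4 (cnt_mono (fun t ht => ⟨?_, ?_⟩)))
      (cnt_two_two_le hc hc3 h2 hab had hae hbd hbe hde)
    · exact dbl_rel hc hc3 hab had hae hbd hbe hde t ht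
    · refine dbl_rel hc hc3 hde had.symm hbd.symm hae.symm hbe.symm hab t ?_
      have : swap d e * swap a b = swap a b * swap d e := by
        ext x
        simp only [Perm.mul_apply, swap_apply_def]; grind
      rwa [this]

theorem inv_comm {x : Perm α} (hx : x * x = 1) (a : α) : swap a (x a) * x = x * swap a (x a) := by
  have : x * swap a (x a) * x⁻¹ = swap a (x a) := by
    rw [← swap_apply_apply, ← Perm.mul_apply, hx, Perm.one_apply, swap_comm]
  rw [mul_inv_eq_iff_eq_mul] at this
  exact this.symm

theorem inv_mul_conj {x : Perm α} (hx : x * x = 1) (a b : α) :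
    swap a b * x * (swap a b)⁻¹ = x * (swap (x a) (x b) * swap a b) := by
  have hx' : x⁻¹ = x := inv_eq_of_mul_eq_one_left hx
  rw [swap_apply_apply, hx']
  simp only [← mul_assoc, hx, one_mul, swap_inv]

open Classical in
theorem ind_three {A B C M : Prop} (h1 : A → B → M) (h2 : A → C → M) (h3 : B → C → M) :
    (if A then 1 else 0) + (if B then 1 else 0) + (if C then 1 else 0) ≤
      1 + 2 * (if M then 1 else 0) := by
  by_cases hM : M
  · simp only [hM, if_true]; split_ifs <;> simp
  · by_cases hA : A
    · have hB : ¬ B := fun h => hM (h1 hA h)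
      have hC : ¬ C := fun h => hM (h2 hA h)
      simp [hA, hB, hC, hM]
    · by_cases hB : B
      · have hC : ¬ C := fun h => hM (h3 hB h)
        simp [hA, hB, hC, hM]
      · simp only [hA, hB, hM, if_false]; split_ifs <;> simp

/-- Involutions with a fixed point. -/
theorem invol_fix {P : Subgroup (Perm α)} {c : ℕ} (hc : Cls P c)
    (h2 : 2 * c ≤ Fintype.card α) (hn : 5 ≤ Fintype.card α) {x : Perm α} (hx : x * x = 1)
    {z a : α} (hz : x z = z) (ha : x a ≠ a) :
    2 * cnt (fun t => Inn P t x) ≤ Fintype.card (alternatingGroup α) := by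
  classical
  obtain ⟨b, hb⟩ : ∃ b, x a = b := ⟨_, rfl⟩
  have hxb : x b = a := by rw [← hb, ← Perm.mul_apply, hx, Perm.one_apply]
  rw [hb] at ha
  have hza : z ≠ a := by rintro rfl; exact ha (hb.symm.trans hz)
  have hzb : z ≠ b := by rintro rfl; exact hza (hz.symm.trans hxb)
  have hs : sign (swap a b) = -1 := sign_swap (Ne.symm ha)
  have hcm : swap a b * x = x * swap a b := by rw [← hb]; exact inv_comm hx a
  have c1 := cnt_conj P x (swap a b) (swap z a) hs hcm
  have c2 := cnt_conj P x (swap a b) (swap z b) hs hcm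
  rw [inv_mul_conj hx, hz, hb] at c1
  rw [inv_mul_conj hx, hz, hxb] at c2
  have p1 : ∀ t, Inn P t x → Inn P t (x * (swap z b * swap z a)) → QQ P t z a ∧ QQ P t z b := by
    intro t h h'
    have := h.mul h'
    rw [← mul_assoc, hx, one_mul, swap_comm z b] at this
    have r := Inn.rel hzb.symm hza ha this
    exact ⟨r.1.symm.trans r.2, r.1.symm⟩
  have p2 : ∀ t, Inn P t x → Inn P t (x * (swap z a * swap z b)) → QQ P t z a ∧ QQ P t z b := by
    intro t h h'
    have := h.mul h'
    rw [← mul_assoc, hx, one_mul, swap_comm z a] at this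
    have r := Inn.rel hza.symm hzb (Ne.symm ha) this
    exact ⟨r.1.symm, r.1.symm.trans r.2⟩
  have p3 : ∀ t, Inn P t (x * (swap z b * swap z a)) → Inn P t (x * (swap z a * swap z b)) →
      QQ P t z a ∧ QQ P t z b := by
    intro t h h'
    have := h.inv.mul h'
    have e : (x * (swap z b * swap z a))⁻¹ * (x * (swap z a * swap z b)) = CC z a b := by
      rw [mul_inv_rev, mul_assoc, inv_mul_cancel_left, mul_inv_rev, swap_inv, swap_inv]
      ext y
      simp only [CC, Perm.mul_apply, swap_apply_def]; grind
    rw [e] at this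
    exact Inn.rel hza (Ne.symm ha) hzb this
  have h3 := cnt_three_le hc (by omega) h2 hza hzb (Ne.symm ha)
  have key : cnt (fun t => Inn P t x) + cnt (fun t => Inn P t (x * (swap z b * swap z a))) +
      cnt (fun t => Inn P t (x * (swap z a * swap z b))) ≤
      Fintype.card (alternatingGroup α) + 2 * cnt (fun t => QQ P t z a ∧ QQ P t z b) := by
    have hcard : Fintype.card (alternatingGroup α) = ∑ t : alternatingGroup α, 1 := by
      simp
    rw [← sum_ind, ← sum_ind, ← sum_ind, ← sum_ind, hcard, Finset.mul_sum,
      ← Finset.sum_add_distrib, ← Finset.sum_add_distrib, ← Finset.sum_add_distrib]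
    apply Finset.sum_le_sum
    intro t _
    have q1 := p1 t
    have q2 := p2 t
    have q3 := p3 t
    exact ind_three q1 q2 q3
  rw [c1, c2] at key
  omega

theorem bool_grid : ∀ a b c d e f g h i : Bool,
    a.toNat + b.toNat + c.toNat + d.toNat + e.toNat + f.toNat + g.toNat + h.toNat + i.toNat ≤
    3 + ((a && b || d && e || g && h).toNat + (a && c || d && f || g && i).toNat +
      (b && c || e && f || h && i).toNat) +
      ((a && d || b && e || c && f).toNat + (a && g || b && h || c && i).toNat +
      (d && g || e && h || f && i).toNat) := by
  decide

theorem grid_alg {G : Type*} [Group G] {x u u' v : G} (hx : x * x = 1) (hv : v * v = 1)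
    (hxu : Commute x u) (hxu' : Commute x u') (hxv : Commute x v) (huv : Commute u v)
    (hu'v : Commute u' v) :
    (x * u * v) * (x * u' * v) = u * u' ∧ (x * v * u) * (x * v * u') = u * u' := by
  have h1 : (x * u * v) * (x * u' * v) = u * u' := by
    calc (x * u * v) * (x * u' * v) = x * u * (v * x) * u' * v := by group
      _ = x * u * x * v * u' * v := by rw [← hxv.eq]; group
      _ = x * (u * x) * (v * u') * v := by group
      _ = (x * x) * u * u' * (v * v) := by rw [← hxu.eq, ← hu'v.eq]; group
      _ = u * u' := by rw [hx, hv]; group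
  refine ⟨h1, ?_⟩
  rw [mul_assoc x v u, mul_assoc x v u', ← huv.eq, ← hu'v.eq, ← mul_assoc x u v,
    ← mul_assoc x u' v, h1]

open Classical in
theorem grid_count (E : Fin 3 → Fin 3 → alternatingGroup α → Prop)
    (U V : Fin 3 → alternatingGroup α → Prop)
    (u1 : ∀ t j, E 0 j t → E 1 j t → U 0 t) (u2 : ∀ t j, E 0 j t → E 2 j t → U 1 t)
    (u3 : ∀ t j, E 1 j t → E 2 j t → U 2 t)
    (v1 : ∀ t i, E i 0 t → E i 1 t → V 0 t) (v2 : ∀ t i, E i 0 t → E i 2 t → V 1 t)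
    (v3 : ∀ t i, E i 1 t → E i 2 t → V 2 t) :
    ∑ i, ∑ j, cnt (E i j) ≤
      3 * Fintype.card (alternatingGroup α) + ∑ i, cnt (U i) + ∑ i, cnt (V i) := by
  have hcard : Fintype.card (alternatingGroup α) = ∑ t : alternatingGroup α, 1 := by
    simp
  simp only [← sum_ind, hcard, Fin.sum_univ_three, Finset.mul_sum]
  simp only [← Finset.sum_add_distrib]
  apply Finset.sum_le_sum
  intro t _
  have hb := bool_grid (decide (E 0 0 t)) (decide (E 0 1 t)) (decide (E 0 2 t))
    (decide (E 1 0 t)) (decide (E 1 1 t)) (decide (E 1 2 t))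
    (decide (E 2 0 t)) (decide (E 2 1 t)) (decide (E 2 2 t))
  have hi : ∀ p : Prop, (decide p).toNat = if p then 1 else 0 := by
    intro p; by_cases h : p <;> simp [h]
  have hm : ∀ (b : Bool) (p : Prop), (b = true → p) → b.toNat ≤ if p then 1 else 0 := by
    intro b p h
    cases b
    · simp
    · simp [h rfl]
  have w1 := hm (p := V 0 t) (b := decide (E 0 0 t) && decide (E 0 1 t) ||
    decide (E 1 0 t) && decide (E 1 1 t) || decide (E 2 0 t) && decide (E 2 1 t)) (by
      simp only [Bool.or_eq_true, Bool.and_eq_true, decide_eq_true_eq]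
      rintro ((h | h) | h) <;> exact v1 t _ h.1 h.2)
  have w2 := hm (p := V 1 t) (b := decide (E 0 0 t) && decide (E 0 2 t) ||
    decide (E 1 0 t) && decide (E 1 2 t) || decide (E 2 0 t) && decide (E 2 2 t)) (by
      simp only [Bool.or_eq_true, Bool.and_eq_true, decide_eq_true_eq]
      rintro ((h | h) | h) <;> exact v2 t _ h.1 h.2)
  have w3 := hm (p := V 2 t) (b := decide (E 0 1 t) && decide (E 0 2 t) ||
    decide (E 1 1 t) && decide (E 1 2 t) || decide (E 2 1 t) && decide (E 2 2 t)) (by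
      simp only [Bool.or_eq_true, Bool.and_eq_true, decide_eq_true_eq]
      rintro ((h | h) | h) <;> exact v3 t _ h.1 h.2)
  have w4 := hm (p := U 0 t) (b := decide (E 0 0 t) && decide (E 1 0 t) ||
    decide (E 0 1 t) && decide (E 1 1 t) || decide (E 0 2 t) && decide (E 1 2 t)) (by
      simp only [Bool.or_eq_true, Bool.and_eq_true, decide_eq_true_eq]
      rintro ((h | h) | h) <;> exact u1 t _ h.1 h.2)
  have w5 := hm (p := U 1 t) (b := decide (E 0 0 t) && decide (E 2 0 t) ||
    decide (E 0 1 t) && decide (E 2 1 t) || decide (E 0 2 t) && decide (E 2 2 t)) (by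
      simp only [Bool.or_eq_true, Bool.and_eq_true, decide_eq_true_eq]
      rintro ((h | h) | h) <;> exact u2 t _ h.1 h.2)
  have w6 := hm (p := U 2 t) (b := decide (E 1 0 t) && decide (E 2 0 t) ||
    decide (E 1 1 t) && decide (E 2 1 t) || decide (E 1 2 t) && decide (E 2 2 t)) (by
      simp only [Bool.or_eq_true, Bool.and_eq_true, decide_eq_true_eq]
      rintro ((h | h) | h) <;> exact u3 t _ h.1 h.2)
  simp only [hi] at hb
  refine le_trans (le_of_eq (by ring)) (le_trans hb ?_)
  linarith

theorem swap_commute {a b c d : α} (h1 : a ≠ c) (h2 : a ≠ d) (h3 : b ≠ c) (h4 : b ≠ d) :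
    Commute (swap a b) (swap c d) := by
  show _ * _ = _ * _
  ext x
  simp only [Perm.mul_apply, swap_apply_def]; grind

/-- Data for one side of the grid: four points `a,b,d,e` with `x` swapping `a,b` and `d,e`. -/
theorem side {x : Perm α} (hx : x * x = 1) {a b d e : α} (hab : a ≠ b) (had : a ≠ d)
    (hae : a ≠ e) (hbd : b ≠ d) (hbe : b ≠ e) (hde : d ≠ e) (xa : x a = b) (xd : x d = e) :
    ∃ u τ : Fin 3 → Perm α, (∀ i, τ i * x * (τ i)⁻¹ = x * u i) ∧ (∀ i, u i * u i = 1) ∧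
      (∀ i, Commute x (u i)) ∧
      u 0 * u 1 = swap a e * swap b d ∧ u 0 * u 2 = swap a d * swap b e ∧
      u 1 * u 2 = swap a b * swap d e ∧
      (∀ g : Perm α, Commute g (swap a e) → Commute g (swap b d) → Commute g (swap a d) →
        Commute g (swap b e) → ∀ i, Commute g (u i) ∧ Commute g (τ i)) := by
  have xb : x b = a := by rw [← xa, ← Perm.mul_apply, hx, Perm.one_apply]
  have xe : x e = d := by rw [← xd, ← Perm.mul_apply, hx, Perm.one_apply]
  have hsq : ∀ p q r s : α, Commute (swap p q) (swap r s) →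
      (swap p q * swap r s) * (swap p q * swap r s) = 1 := by
    intro p q r s h
    rw [h.symm.mul_mul_mul_comm]
    simp
  have hcx : ∀ p q r s : α, Commute (swap p q) (swap r s) → swap (x p) (x q) = swap r s →
      swap (x r) (x s) = swap p q → Commute x (swap p q * swap r s) := by
    intro p q r s h h1 h2
    rw [swap_apply_apply] at h1 h2
    rw [mul_inv_eq_iff_eq_mul] at h1 h2
    show x * (_ * _) = _ * _ * x
    rw [← mul_assoc, h1, mul_assoc, h2, ← mul_assoc, h.eq]
  have k1 : Commute (swap a e) (swap b d) := swap_commute hab had hbe.symm hde.symm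
  have k2 : Commute (swap a d) (swap b e) := swap_commute hab hae hbd.symm hde
  refine ⟨![1, swap a e * swap b d, swap a d * swap b e], ![1, swap b d, swap b e], ?_, ?_, ?_,
    ?_, ?_, ?_, ?_⟩
  · intro i
    fin_cases i
    · simp
    · have := inv_mul_conj hx b d
      rw [xb, xd] at this
      simpa using this
    · have := inv_mul_conj hx b e
      rw [xb, xe] at this
      simpa using this
  · intro i
    fin_cases i
    · simp
    · exact hsq _ _ _ _ k1
    · exact hsq _ _ _ _ k2
  · intro i
    fin_cases i
    · exact Commute.one_right _
    · exact hcx _ _ _ _ k1 (by rw [xa, xe]) (by rw [xb, xd])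
    · exact hcx _ _ _ _ k2 (by rw [xa, xd]) (by rw [xb, xe])
  · simp
  · simp
  · show (swap a e * swap b d) * (swap a d * swap b e) = _
    ext y
    simp only [Perm.mul_apply, swap_apply_def]; grind
  · intro g g1 g2 g3 g4 i
    fin_cases i
    · exact ⟨Commute.one_right _, Commute.one_right _⟩
    · exact ⟨g1.mul_right g2, g2⟩
    · exact ⟨g3.mul_right g4, g4⟩

theorem invol_free_aux {P : Subgroup (Perm α)} {c : ℕ} (hc : Cls P c) (hc3 : c = 1 ∨ 3 ≤ c)
    (h2 : 2 * c ≤ Fintype.card α) (hn : 7 ≤ Fintype.card α) {x : Perm α} (hx : x * x = 1)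
    {a b d e f h k l : α} (hnd : [a, b, d, e, f, h, k, l].Nodup)
    (xa : x a = b) (xd : x d = e) (xf : x f = h) (xk : x k = l) :
    2 * cnt (fun t => Inn P t x) ≤ Fintype.card (alternatingGroup α) := by
  simp only [List.nodup_cons, List.mem_cons, List.not_mem_nil, or_false, not_or, List.nodup_nil,
    and_true, not_false_eq_true] at hnd
  obtain ⟨⟨ab, ad, ae, af, ah, ak, al⟩, ⟨bd, be, bf, bh, bk, bl⟩, ⟨de, df, dh, dk, dl⟩,
    ⟨ef, eh, ek, el⟩, ⟨fh, fk, fl⟩, ⟨hk, hl⟩, kl⟩ := hnd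
  obtain ⟨u, τ, hτ, hu, hxu, u1, u2, u3, hcu⟩ := side hx ab ad ae bd be de xa xd
  obtain ⟨v, ρ, hρ, hv, hxv, v1, v2, v3, hcv⟩ := side hx fh fk fl hk hl kl xf xk
  have cuv : ∀ i j, Commute (u i) (v j) ∧ Commute (τ i) (v j) := by
    have base : ∀ p q : α, (p = a ∨ p = b) → (q = d ∨ q = e) → ∀ j, Commute (swap p q) (v j) := by
      intro p q hp hq j
      refine (hcv (swap p q) ?_ ?_ ?_ ?_ j).1 <;> apply swap_commute <;>
        rcases hp with rfl | rfl <;> rcases hq with rfl | rfl <;> assumption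
    intro i j
    have := hcu (v j) (base a e (by simp) (by simp) j).symm (base b d (by simp) (by simp) j).symm
      (base a d (by simp) (by simp) j).symm (base b e (by simp) (by simp) j).symm i
    exact ⟨this.1.symm, this.2.symm⟩
  have hcm : swap a b * x = x * swap a b := by rw [← xa]; exact inv_comm hx a
  have hcnt : ∀ i j, cnt (fun t => Inn P t (x * u i * v j)) = cnt (fun t => Inn P t x) := by
    intro i j
    rw [← cnt_conj P x (swap a b) (τ i * ρ j) (sign_swap ab) hcm]
    have : τ i * ρ j * x * (τ i * ρ j)⁻¹ = x * u i * v j := by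
      calc _ = τ i * (ρ j * x * (ρ j)⁻¹) * (τ i)⁻¹ := by group
        _ = τ i * x * (v j * (τ i)⁻¹) := by rw [hρ]; group
        _ = τ i * x * (τ i)⁻¹ * v j := by rw [(cuv i j).2.inv_left.symm.eq]; group
        _ = _ := by rw [hτ]
    rw [this]
  have colp : ∀ t i i' j, Inn P t (x * u i * v j) → Inn P t (x * u i' * v j) →
      Inn P t (u i * u i') := by
    intro t i i' j h1 h2
    have := h1.mul h2
    rwa [(grid_alg hx (hv j) (hxu i) (hxu i') (hxv j) (cuv i j).1 (cuv i' j).1).1] at this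
  have rowp : ∀ t i j j', Inn P t (x * u i * v j) → Inn P t (x * u i * v j') →
      Inn P t (v j * v j') := by
    intro t i j j' h1 h2
    have := h1.mul h2
    rwa [(grid_alg hx (hu i) (hxv j) (hxv j') (hxu i) (cuv i j).1.symm
      (cuv i j').1.symm).2] at this
  have key := grid_count (fun i j t => Inn P t (x * u i * v j))
    ![fun t => Inn P t (u 0 * u 1), fun t => Inn P t (u 0 * u 2), fun t => Inn P t (u 1 * u 2)]
    ![fun t => Inn P t (v 0 * v 1), fun t => Inn P t (v 0 * v 2), fun t => Inn P t (v 1 * v 2)]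
    (fun t j => colp t 0 1 j) (fun t j => colp t 0 2 j) (fun t j => colp t 1 2 j)
    (fun t i => rowp t i 0 1) (fun t i => rowp t i 0 2) (fun t i => rowp t i 1 2)
  simp only [hcnt, Fin.sum_univ_three] at key
  have d1 := cnt_dbl hc hc3 h2 hn ae ab ad (Ne.symm be) (Ne.symm de) bd
  have d2 := cnt_dbl hc hc3 h2 hn ad ab ae (Ne.symm bd) de be
  have d3 := cnt_dbl hc hc3 h2 hn ab ad ae bd be de
  have d4 := cnt_dbl hc hc3 h2 hn fl fh fk (Ne.symm hl) (Ne.symm kl) hk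
  have d5 := cnt_dbl hc hc3 h2 hn fk fh fl (Ne.symm hk) kl hl
  have d6 := cnt_dbl hc hc3 h2 hn fh fk fl hk hl kl
  rw [← u1] at d1
  rw [← u2] at d2
  rw [← u3] at d3
  rw [← v1] at d4
  rw [← v2] at d5
  rw [← v3] at d6
  simp only [Matrix.cons_val] at key
  omega

theorem invol {P : Subgroup (Perm α)} {c : ℕ} (hc : Cls P c) (hc3 : c = 1 ∨ 3 ≤ c)
    (h2 : 2 * c ≤ Fintype.card α) (hn : 5 ≤ Fintype.card α) {x : Perm α} (hx : x * x = 1)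
    (hs : sign x = 1) (h1 : x ≠ 1) :
    2 * cnt (fun t => Inn P t x) ≤ Fintype.card (alternatingGroup α) := by
  classical
  obtain ⟨a, ha⟩ : ∃ a, x a ≠ a := by
    by_contra! h
    exact h1 (Perm.ext h)
  by_cases hf : ∃ z, x z = z
  · obtain ⟨z, hz⟩ := hf
    exact invol_fix hc h2 hn hx hz ha
  push Not at hf
  have hxx : ∀ y, x (x y) = y := fun y => by rw [← Perm.mul_apply, hx, Perm.one_apply]
  obtain ⟨b, xa⟩ : ∃ b, x a = b := ⟨_, rfl⟩
  have xb : x b = a := by rw [← xa, hxx]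
  have ex : ∀ S : Finset α, S.card < Fintype.card α → ∃ d, d ∉ S := by
    intro S hS
    by_contra! h
    have := Finset.card_le_card (fun x _ => h x : Finset.univ ⊆ S)
    rw [Finset.card_univ] at this
    omega
  obtain ⟨d, hd⟩ := ex {a, b} (lt_of_le_of_lt Finset.card_le_two (by omega))
  obtain ⟨e, xd⟩ : ∃ e, x d = e := ⟨_, rfl⟩
  have xe : x e = d := by rw [← xd, hxx]
  obtain ⟨f, hf'⟩ := ex {a, b, d, e} (lt_of_le_of_lt Finset.card_le_four (by omega))
  obtain ⟨h, xf⟩ : ∃ e, x f = e := ⟨_, rfl⟩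
  have xh : x h = f := by rw [← xf, hxx]
  simp only [Finset.mem_insert, Finset.mem_singleton, not_or] at hd hf'
  obtain ⟨d1, d2⟩ := hd
  obtain ⟨f1, f2, f3, f4⟩ := hf'
  have ab : a ≠ b := by have := hf a; grind
  have de : d ≠ e := by have := hf d; grind
  have fh : f ≠ h := by have := hf f; grind
  have e1 : e ≠ a := by rintro rfl; grind
  have e2 : e ≠ b := by rintro rfl; grind
  have g1 : h ≠ a := by rintro rfl; grind
  have g2 : h ≠ b := by rintro rfl; grind
  have g3 : h ≠ d := by rintro rfl; grind
  have g4 : h ≠ e := by rintro rfl; grind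
  have hk : ∃ k, k ∉ ({a, b, d, e, f, h} : Finset α) := by
    by_contra! hk
    have : x = swap a b * (swap d e * swap f h) := by
      ext y
      have := hk y
      simp only [Finset.mem_insert, Finset.mem_singleton] at this
      simp only [Perm.mul_apply, swap_apply_def]
      rcases this with rfl | rfl | rfl | rfl | rfl | rfl <;> grind
    rw [this] at hs
    simp [sign_swap ab, sign_swap de, sign_swap fh] at hs
  obtain ⟨k, hk⟩ := hk
  simp only [Finset.mem_insert, Finset.mem_singleton, not_or] at hk
  obtain ⟨k1, k2, k3, k4, k5, k6⟩ := hk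
  obtain ⟨l, xk⟩ : ∃ e, x k = e := ⟨_, rfl⟩
  have xl : x l = k := by rw [← xk, hxx]
  have kl : k ≠ l := by have := hf k; grind
  have l1 : l ≠ a := by rintro rfl; grind
  have l2 : l ≠ b := by rintro rfl; grind
  have l3 : l ≠ d := by rintro rfl; grind
  have l4 : l ≠ e := by rintro rfl; grind
  have l5 : l ≠ f := by rintro rfl; grind
  have l6 : l ≠ h := by rintro rfl; grind
  have hnd : [a, b, d, e, f, h, k, l].Nodup := by
    simp only [List.nodup_cons, List.mem_cons, List.not_mem_nil, or_false, not_or, List.nodup_nil,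
      and_true, not_false_eq_true]
    refine ⟨⟨ab, Ne.symm d1, Ne.symm e1, Ne.symm f1, Ne.symm g1, Ne.symm k1, Ne.symm l1⟩,
      ⟨Ne.symm d2, Ne.symm e2, Ne.symm f2, Ne.symm g2, Ne.symm k2, Ne.symm l2⟩,
      ⟨de, Ne.symm f3, Ne.symm g3, Ne.symm k3, Ne.symm l3⟩, ⟨Ne.symm f4, Ne.symm g4, Ne.symm k4, Ne.symm l4⟩,
      ⟨fh, Ne.symm k5, Ne.symm l5⟩, ⟨Ne.symm k6, Ne.symm l6⟩, kl⟩
  have hn8 := hnd.length_le_card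
  simp only [List.length_cons, List.length_nil] at hn8
  exact invol_free_aux hc hc3 h2 (by omega) hx hnd xa xd xf xk

theorem five_eight {P : Subgroup (Perm α)} {c : ℕ} (hc : Cls P c)
    (h2 : 2 * c ≤ Fintype.card α) (hn : 5 ≤ Fintype.card α) {x y : Perm α} {a b d : α}
    (hab : a ≠ b) (had : a ≠ d) (hbd : b ≠ d)
    (hcnt : cnt (fun t => Inn P t y) = cnt (fun t => Inn P t x))
    (hy : y * x⁻¹ = CC a b d) :
    8 * cnt (fun t => Inn P t x) ≤ 5 * Fintype.card (alternatingGroup α) := by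
  classical
  have h3 := cnt_three_le hc (by omega) h2 hab had hbd
  have key : cnt (fun t => Inn P t x) + cnt (fun t => Inn P t y) ≤
      Fintype.card (alternatingGroup α) + cnt (fun t => QQ P t a b ∧ QQ P t a d) := by
    have hcard : Fintype.card (alternatingGroup α) = ∑ t : alternatingGroup α, 1 := by
      simp
    simp only [← sum_ind, hcard]
    simp only [← Finset.sum_add_distrib]
    apply Finset.sum_le_sum
    intro t _
    by_cases h : Inn P t x
    · by_cases h' : Inn P t y
      · have h4 := h'.mul h.inv
        rw [hy] at h4
        have h5 := Inn.rel hab hbd had h4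
        rw [if_pos h, if_pos h', if_pos h5]
      · rw [if_pos h, if_neg h']; omega
    · rw [if_neg h]; split_ifs <;> omega
  omega

theorem order_three {P : Subgroup (Perm α)} {c : ℕ} (hc : Cls P c)
    (h2 : 2 * c ≤ Fintype.card α) (hn : 5 ≤ Fintype.card α) {x : Perm α} (hx : x ^ 3 = 1)
    (h1 : x ≠ 1) :
    8 * cnt (fun t => Inn P t x) ≤ 5 * Fintype.card (alternatingGroup α) := by
  classical
  have hxx : ∀ y, x (x (x y)) = y := fun y => by
    have := congrArg (fun z : Perm α => z y) hx
    simpa [pow_succ, Perm.mul_apply] using this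
  obtain ⟨a, ha⟩ : ∃ a, x a ≠ a := by
    by_contra! h
    exact h1 (Perm.ext h)
  obtain ⟨b, xa⟩ : ∃ b, x a = b := ⟨_, rfl⟩
  obtain ⟨d, xb⟩ : ∃ d, x b = d := ⟨_, rfl⟩
  have xd : x d = a := by rw [← xb, ← xa, hxx]
  have ab : a ≠ b := by grind
  have bd : b ≠ d := by rintro rfl; grind
  have ad : a ≠ d := by rintro rfl; grind
  by_cases h : ∃ e, e ≠ a ∧ e ≠ b ∧ e ≠ d ∧ x e ≠ e
  · obtain ⟨e, e1, e2, e3, he⟩ := h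
    obtain ⟨f, xe⟩ : ∃ b, x e = b := ⟨_, rfl⟩
    obtain ⟨g, xf⟩ : ∃ d, x f = d := ⟨_, rfl⟩
    have xg : x g = e := by rw [← xf, ← xe, hxx]
    have ef : e ≠ f := by grind
    have fg : f ≠ g := by rintro rfl; grind
    have eg : e ≠ g := by rintro rfl; grind
    have f1 : f ≠ a := by rintro rfl; grind
    have f2 : f ≠ b := by rintro rfl; grind
    have f3 : f ≠ d := by rintro rfl; grind
    have g1 : g ≠ a := by rintro rfl; grind
    have g2 : g ≠ b := by rintro rfl; grind
    have g3 : g ≠ d := by rintro rfl; grind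
    have c1 : Commute (swap a e) (swap b f) := swap_commute ab f1.symm e2 ef
    have c2 : Commute (swap a e) (swap d g) := swap_commute ad g1.symm e3 eg
    have c3 : Commute (swap b f) (swap d g) := swap_commute bd g2.symm f3 fg
    have hcm : swap a e * swap b f * swap d g * x = x * (swap a e * swap b f * swap d g) := by
      have k1 : x * swap a e = swap b f * x := by
        rw [← mul_inv_eq_iff_eq_mul, ← swap_apply_apply, xa, xe]
      have k2 : x * swap b f = swap d g * x := by
        rw [← mul_inv_eq_iff_eq_mul, ← swap_apply_apply, xb, xf]
      have k3 : x * swap d g = swap a e * x := by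
        rw [← mul_inv_eq_iff_eq_mul, ← swap_apply_apply, xd, xg]
      symm
      calc x * (swap a e * swap b f * swap d g) = (x * swap a e) * swap b f * swap d g := by group
        _ = swap b f * (x * swap b f) * swap d g := by rw [k1]; group
        _ = swap b f * swap d g * (x * swap d g) := by rw [k2]; group
        _ = swap b f * swap d g * swap a e * x := by rw [k3]; group
        _ = swap a e * swap b f * swap d g * x := by
          rw [mul_assoc (swap b f), ← c2.eq, ← mul_assoc, c1.eq]
    have := cnt_conj P x _ (swap a b) (by
      simp [sign_swap e1.symm, sign_swap f2.symm, sign_swap g3.symm]) hcm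
    refine five_eight hc h2 hn ab ad bd this ?_
    rw [CC, ← xa, ← xb, ← xa, swap_apply_apply]
    simp [mul_assoc]
  · push Not at h
    have hxe : x = CC a b d := by
      ext y
      by_cases y1 : y = a
      · rw [y1, C_a ab bd ad, xa]
      by_cases y2 : y = b
      · rw [y2, C_b ab bd ad, xb]
      by_cases y3 : y = d
      · rw [y3, C_c ab bd ad, xd]
      rw [C_d y1 y2 y3, h y y1 y2 y3]
    have h3 := cnt_three_le hc (by omega) h2 ab ad bd
    have : cnt (fun t => Inn P t x) ≤ cnt (fun t => QQ P t a b ∧ QQ P t a d) := by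
      apply cnt_mono
      intro t ht
      rw [hxe] at ht
      exact Inn.rel ab bd ad ht
    omega

theorem order_big {P : Subgroup (Perm α)} {c : ℕ} (hc : Cls P c)
    (h2 : 2 * c ≤ Fintype.card α) (hn : 5 ≤ Fintype.card α) {x : Perm α} 
    (h1 : x ≠ 1) (hp : (orderOf x).Prime) (hp5 : 5 ≤ orderOf x) :
    8 * cnt (fun t => Inn P t x) ≤ 5 * Fintype.card (alternatingGroup α) := by
  classical
  obtain ⟨a, ha⟩ : ∃ a, x a ≠ a := by
    by_contra! h
    exact h1 (Perm.ext h)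
  have hk : ∀ k, 0 < k → k < 5 → (x ^ k) a ≠ a := by
    intro k hk hk5 h
    have hco : k.Coprime (orderOf x) :=
      (Nat.coprime_of_lt_prime (by omega) (by omega) hp).symm
    obtain ⟨m, hm⟩ := exists_pow_eq_self_of_coprime hco
    apply ha
    rw [← hm]
    exact pow_apply_eq_self_of_apply_eq_self h m
  obtain ⟨b, xa⟩ : ∃ b, x a = b := ⟨_, rfl⟩
  obtain ⟨d, xb⟩ : ∃ d, x b = d := ⟨_, rfl⟩
  obtain ⟨e, xd⟩ : ∃ e, x d = e := ⟨_, rfl⟩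
  have q2 := hk 2 (by omega) (by omega)
  have q3 := hk 3 (by omega) (by omega)
  simp only [pow_succ, pow_zero, one_mul, Perm.mul_apply, xa, xb, xd] at q2 q3
  have inj : ∀ u v, x u = x v → u = v := fun u v h => x.injective h
  have ab : a ≠ b := by grind
  have bd : b ≠ d := by intro h; apply ab; apply inj; rw [xa, xb, h]
  have de : d ≠ e := by intro h; apply bd; apply inj; rw [xb, xd, h]
  have be : b ≠ e := by intro h; apply q2; apply inj; rw [xa, xd, h]
  have hs : CC a b d ∈ alternatingGroup α := sign_two ab bd
  have hcnt : cnt (fun t => Inn P t (CC a b d * x * (CC a b d)⁻¹)) = cnt (fun t => Inn P t x) :=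
    (cnt_shift ⟨_, hs⟩ (fun t => Inn_shift P ⟨_, hs⟩ t x)).symm
  refine five_eight hc h2 hn (a := a) (b := b) (d := e) ab q3.symm be hcnt ?_
  have : x * (CC a b d)⁻¹ * x⁻¹ = CC d b e := by
    rw [C_inv ab bd q2.symm, C_conj, xa, xb, xd]
  rw [mul_assoc, mul_assoc, ← mul_assoc x, this]
  ext y; simp only [CC, Perm.mul_apply, swap_apply_def]; grind

theorem gen_bound {P : Subgroup (Perm α)} {c : ℕ} (hc : Cls P c) (hc3 : c = 1 ∨ 3 ≤ c)
    (h2 : 2 * c ≤ Fintype.card α) (hn : 5 ≤ Fintype.card α) {y : Perm α}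
    (hs : sign y = 1) (h1 : y ≠ 1) :
    8 * cnt (fun t => Inn P t y) ≤ 5 * Fintype.card (alternatingGroup α) := by
  have ho : orderOf y ≠ 1 := by rwa [Ne, orderOf_eq_one_iff]
  have hp := Nat.minFac_prime ho
  have hd := Nat.minFac_dvd (orderOf y)
  set p := (orderOf y).minFac
  set z := y ^ (orderOf y / p) with hz
  have hoz : orderOf z = p := by
    rw [hz, orderOf_pow_orderOf_div (orderOf_pos y).ne' hd]
  have hz1 : z ≠ 1 := by
    intro h
    rw [h, orderOf_one] at hoz
    exact hp.one_lt.ne hoz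
  have hle : cnt (fun t => Inn P t y) ≤ cnt (fun t => Inn P t z) :=
    cnt_mono (fun t ht => ht.pow _)
  have hsz : sign z = 1 := by rw [hz, map_pow, hs, one_pow]
  have hzp : z ^ p = 1 := by rw [← hoz, pow_orderOf_eq_one]
  by_cases p2 : p = 2
  · rw [p2, pow_two] at hzp
    have := invol hc hc3 h2 hn hzp hsz hz1
    omega
  by_cases p3 : p = 3
  · rw [p3] at hzp
    have := order_three hc h2 hn hzp hz1
    omega
  have : p ≠ 4 := by
    intro h; rw [h] at hp; exact absurd hp (by norm_num)
  have := order_big hc h2 hn hz1 (hoz ▸ hp) (by have := hp.two_le; omega)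
  omega

theorem fixed_link {G : Type*} [Group G] [Fintype G] (H : Subgroup G) (y : G) :
    Nat.card {t : G // t⁻¹ * y * t ∈ H} = Nat.card H * Nat.card (MulAction.fixedBy (G ⧸ H) y) := by
  rw [← Nat.card_prod, ← Nat.card_congr
    (QuotientGroup.preimageMkEquivSubgroupProdSet H (MulAction.fixedBy (G ⧸ H) y))]
  apply Nat.card_congr
  apply Equiv.subtypeEquivRight
  intro t
  rw [Set.mem_preimage, MulAction.mem_fixedBy]
  show _ ↔ ((y • t : G) : G ⧸ H) = (t : G ⧸ H)
  rw [eq_comm, QuotientGroup.eq, smul_eq_mul, mul_assoc]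

theorem burnside_bound {G : Type*} [Group G] [Fintype G] (H : Subgroup G) (g : G) (B : ℕ)
    (hB : ∀ y ∈ Subgroup.zpowers g, y ≠ 1 → 8 * Nat.card (MulAction.fixedBy (G ⧸ H) y) ≤ B) :
    8 * (Nat.card (MulAction.orbitRel.Quotient (Subgroup.zpowers g) (G ⧸ H)) * orderOf g) ≤
      8 * Nat.card (G ⧸ H) + (orderOf g - 1) * B := by
  classical
  have e := MulAction.sum_card_fixedBy_eq_card_orbits_mul_card_group (Subgroup.zpowers g) (G ⧸ H)
  rw [Fintype.card_zpowers] at e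
  rw [Nat.card_eq_fintype_card]
  have e' : Fintype.card (MulAction.orbitRel.Quotient (Subgroup.zpowers g) (G ⧸ H)) * orderOf g =
      ∑ a : Subgroup.zpowers g, Fintype.card (MulAction.fixedBy (G ⧸ H) a) := e.symm
  rw [e', ← Finset.add_sum_erase _ _ (Finset.mem_univ 1), mul_add, Finset.mul_sum]
  apply Nat.add_le_add
  · rw [← Nat.card_eq_fintype_card]
    exact Nat.mul_le_mul_left _ (Finite.card_subtype_le _)
  · have hc : (Finset.univ.erase (1 : Subgroup.zpowers g)).card = orderOf g - 1 := by
      rw [Finset.card_erase_of_mem (Finset.mem_univ _), Finset.card_univ, Fintype.card_zpowers]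
    rw [← hc, ← smul_eq_mul]
    apply Finset.sum_le_card_nsmul
    intro a ha
    have := hB a a.2 (by simpa using ha)
    rw [← Nat.card_eq_fintype_card]
    exact this

theorem main_aux (hn : 5 ≤ Fintype.card α) (H : Subgroup (alternatingGroup α)) (hH : H ≠ ⊤)
    (htrans : ∀ a b : α, ∃ h ∈ H, ((h : Perm α) a = b)) (g : alternatingGroup α) (hg : g ≠ 1) :
    4 * Nat.card (MulAction.orbitRel.Quotient (Subgroup.zpowers g) (alternatingGroup α ⧸ H)) ≤
      3 * Nat.card (alternatingGroup α ⧸ H) := by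
  classical
  set P : Subgroup (Perm α) := H.map (alternatingGroup α).subtype with hPdef
  have hmem : ∀ y : alternatingGroup α, (y : Perm α) ∈ P ↔ y ∈ H := by
    intro y
    constructor
    · rintro ⟨z, hz, hzy⟩
      have : z = y := Subtype.ext hzy
      exact this ▸ hz
    · intro h; exact ⟨y, h, rfl⟩
  have hP : ¬ alternatingGroup α ≤ P := by
    intro h
    apply hH
    rw [eq_top_iff]
    intro y _
    exact (hmem y).1 (h y.2)
  obtain ⟨c, h2, hc3, hc⟩ := class_size hP (by
    intro a b
    obtain ⟨h, hh, hab⟩ := htrans a b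
    exact ⟨h, (hmem h).2 hh, hab⟩)
  have hc : Cls P c := hc
  set N := Nat.card (alternatingGroup α ⧸ H) with hN
  have hcard : Fintype.card (alternatingGroup α) = Nat.card H * N := by
    rw [← Nat.card_eq_fintype_card, Subgroup.card_eq_card_quotient_mul_card_subgroup H, mul_comm]
  have hHpos : 0 < Nat.card H := Nat.card_pos
  have hcnt : ∀ y : alternatingGroup α, cnt (fun t => Inn P t y) =
      Nat.card H * Nat.card (MulAction.fixedBy (alternatingGroup α ⧸ H) y) := by
    intro y
    rw [← fixed_link, Nat.card_eq_fintype_card, Fintype.card_subtype, cnt]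
    congr 1
    ext t
    simp only [Finset.mem_filter, Finset.mem_univ, true_and]
    rw [← hmem]
    rfl
  have hs : ∀ y : alternatingGroup α, sign (y : Perm α) = 1 := fun y => y.2
  have hne : ∀ y : alternatingGroup α, y ≠ 1 → (y : Perm α) ≠ 1 := by
    intro y hy h; exact hy (Subtype.ext h)
  have gen : ∀ y : alternatingGroup α, y ≠ 1 →
      8 * Nat.card (MulAction.fixedBy (alternatingGroup α ⧸ H) y) ≤ 5 * N := by
    intro y hy
    have := gen_bound hc hc3 h2 hn (hs y) (hne y hy)
    rw [hcnt, hcard] at this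
    apply Nat.le_of_mul_le_mul_left _ hHpos
    linarith
  have ho : orderOf g ≠ 1 := by rwa [Ne, orderOf_eq_one_iff]
  have hpos := orderOf_pos g
  by_cases ho2 : orderOf g = 2
  · have inv : ∀ y ∈ Subgroup.zpowers g, y ≠ 1 →
        8 * Nat.card (MulAction.fixedBy (alternatingGroup α ⧸ H) y) ≤ 4 * N := by
      intro y hyg hy
      have hyy : y * y = 1 := by
        obtain ⟨k, rfl⟩ := hyg
        have hgg : g * g = 1 := by rw [← pow_two, ← ho2, pow_orderOf_eq_one]
        show g ^ k * g ^ k = 1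
        rw [← (Commute.refl g).mul_zpow, hgg, one_zpow]
      have := invol hc hc3 h2 hn (x := (y : Perm α)) (congrArg Subtype.val hyy) (hs y) (hne y hy)
      rw [hcnt, hcard] at this
      apply Nat.le_of_mul_le_mul_left _ hHpos
      linarith
    have := burnside_bound H g _ inv
    rw [ho2] at this
    omega
  · have := burnside_bound H g _ (fun y _ hy => gen y hy)
    obtain ⟨m, hm⟩ : ∃ m, orderOf g = m + 3 := ⟨orderOf g - 3, by omega⟩
    rw [hm, show m + 3 - 1 = m + 2 by omega, ← hN] at this
    set O := Nat.card (MulAction.orbitRel.Quotient (Subgroup.zpowers g) (alternatingGroup α ⧸ H))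
    by_contra! hlt
    have : 3 * N + 1 ≤ 4 * O := hlt
    nlinarith

end

end MinIdx


/-- Let `n ≥ 5` and `H` a maximal transitive subgroup of `A_n`. Then the minimal index of
`A_n` on `A_n/H` is at least `[A_n : H]/4`: for every nonidentity `g ∈ A_n`,
`[A_n:H]/4 ≤ [A_n:H] − #(orbits of g on A_n/H)`. -/
theorem min_index_alt_coset (n : ℕ) (hn : 5 ≤ n)
    (H : Subgroup (alternatingGroup (Fin n)))
    (hmax : IsCoatom H)
    (htrans : ∀ a b : Fin n, ∃ h ∈ H, ((h : Equiv.Perm (Fin n)) a = b)) :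
    ∀ g : alternatingGroup (Fin n), g ≠ 1 →
      (Nat.card (alternatingGroup (Fin n) ⧸ H) : ℚ) / 4 ≤
        (Nat.card (alternatingGroup (Fin n) ⧸ H) : ℚ) -
          (Nat.card (MulAction.orbitRel.Quotient (Subgroup.zpowers g)
            (alternatingGroup (Fin n) ⧸ H)) : ℚ) := by
  intro g hg
  have h := MinIdx.main_aux (α := Fin n) (by simpa using hn) H hmax.1 htrans g hg
  have h' : (4 : ℚ) * (Nat.card (MulAction.orbitRel.Quotient (Subgroup.zpowers g)
      (alternatingGroup (Fin n) ⧸ H)) : ℚ) ≤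
      3 * (Nat.card (alternatingGroup (Fin n) ⧸ H) : ℚ) := by
    exact_mod_cast h
  linarith
end

section
/- Let n ≥ 5 and let H be a maximal transitive subgroup of A_n. Then ind(S_n, S_n/H) ≥ [S_n : H]/8, where ind(S_n, S_n/H) is the minimum over nonidentity g ∈ S_n of [S_n:H] minus the number of orbits of g on the coset space S_n/H. -/
open Equiv

def T {n : ℕ} (a b c : Fin n) : Perm (Fin n) := swap a b * swap b c

lemma T_conj {n : ℕ} (σ : Perm (Fin n)) (a b c : Fin n) :
    σ * T a b c * σ⁻¹ = T (σ a) (σ b) (σ c) := by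
  have h1 : ∀ x y, swap (σ x) (σ y) = σ * swap x y * σ⁻¹ := by
    intro x y; rw [Equiv.mul_swap_eq_swap_mul]; group
  unfold T
  rw [h1, h1]; group

lemma T_rot {n : ℕ} {a b c : Fin n} (h1 : a ≠ b) (h2 : b ≠ c) (h3 : a ≠ c) :
    T a b c = T b c a := by
  ext x
  simp only [T, Perm.mul_apply, swap_apply_def]
  grind

lemma T_inv {n : ℕ} (a b c : Fin n) : (T a b c)⁻¹ = T c b a := by
  simp [T, swap_comm]

lemma T_fst {n : ℕ} {a b c : Fin n} (h1 : a ≠ b) (h3 : a ≠ c) : T a b c a = b := by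
  simp only [T, Perm.mul_apply, swap_apply_def]; grind
lemma T_snd {n : ℕ} {a b c : Fin n} (h2 : b ≠ c) (h3 : a ≠ c) : T a b c b = c := by
  simp only [T, Perm.mul_apply, swap_apply_def]; grind
lemma T_trd {n : ℕ} {a b c : Fin n}  : T a b c c = a := by
  simp only [T, Perm.mul_apply, swap_apply_def]; grind
lemma T_other {n : ℕ} {a b c x : Fin n} (h1 : x ≠ a) (h2 : x ≠ b) (h3 : x ≠ c) :
    T a b c x = x := by
  simp only [T, Perm.mul_apply, swap_apply_def]; grind

def R {n : ℕ} (H : Subgroup (Perm (Fin n))) (a b : Fin n) : Prop :=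
  a = b ∨ ∃ c, a ≠ b ∧ b ≠ c ∧ a ≠ c ∧ T a b c ∈ H

section
variable {n : ℕ} {H : Subgroup (Perm (Fin n))}

lemma conj_mem {σ τ : Perm (Fin n)} (h1 : σ ∈ H) (h2 : τ ∈ H) : σ * τ * σ⁻¹ ∈ H :=
  H.mul_mem (H.mul_mem h1 h2) (H.inv_mem h1)

lemma R_symm {a b : Fin n} (h : R H a b) : R H b a := by
  rcases h with rfl | ⟨c, h1, h2, h3, h⟩
  · exact Or.inl rfl
  · refine Or.inr ⟨c, h1.symm, h3, h2, ?_⟩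
    have := H.inv_mem h
    rwa [T_inv, T_rot h2.symm h1.symm h3.symm] at this

lemma R_trans {a b c : Fin n} (h : R H a b) (h' : R H b c) : R H a c := by
  by_cases hac : a = c
  · exact Or.inl hac
  rcases h with rfl | ⟨x, h1, h2, h3, h⟩
  · exact h'
  rcases h' with rfl | ⟨y, k1, k2, k3, k⟩
  · exact Or.inr ⟨x, h1, h2, h3, h⟩
  by_cases hy : y = a
  · subst hy
    rw [T_rot k1 k2 k3] at k
    exact R_symm (Or.inr ⟨b, k2, h1, k1.symm, k⟩)
  · have := conj_mem k h
    rw [T_conj, T_other h1 hac (Ne.symm hy), T_fst k1 k3] at this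
    refine Or.inr ⟨T b c y x, hac, ?_, ?_, this⟩
    · intro e
      exact h2 ((T b c y).injective ((T_fst k1 k3).trans e))
    · intro e
      exact h3 ((T b c y).injective ((T_other h1 hac (Ne.symm hy)).trans e))

lemma R_inv {σ : Perm (Fin n)} (hσ : σ ∈ H) {a b : Fin n} (h : R H a b) :
    R H (σ a) (σ b) := by
  rcases h with rfl | ⟨c, h1, h2, h3, h⟩
  · exact Or.inl rfl
  · refine Or.inr ⟨σ c, by simpa using h1, by simpa using h2, by simpa using h3, ?_⟩
    rw [← T_conj]; exact conj_mem hσ h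

lemma R_all {a b c : Fin n} (h : R H a b) (h' : R H b c) (hab : a ≠ b) (hbc : b ≠ c)
    (hac : a ≠ c) : T a b c ∈ H := by
  -- the case of a common third point
  have key : ∀ x, a ≠ x → b ≠ x → c ≠ x → T a b x ∈ H → T b c x ∈ H → T a b c ∈ H := by
    intro x hax hbx hcx h k
    have := conj_mem k h
    rw [T_conj, T_other hab hac hax, T_fst hbc hbx, T_trd] at this
    have := H.inv_mem this
    rwa [T_inv, ← T_rot hab hbc hac] at this
  rcases h with h | ⟨x, h1, h2, h3, h⟩
  · exact absurd h hab
  rcases h' with h' | ⟨y, k1, k2, k3, k⟩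
  · exact absurd h' hbc
  by_cases hx : x = c
  · subst hx; exact h
  by_cases hy : y = a
  · subst hy; rwa [T_rot hab hbc hac]
  by_cases hxy : x = y
  · subst hxy
    exact key x h3 h2 k2 h k
  · refine key x h3 h2 (Ne.symm hx) h ?_
    have e : T b c x = (T a b x * T b c y * (T a b x)⁻¹ * (T b c y)⁻¹)⁻¹ := by
      rw [T_conj, T_inv, mul_inv_rev, T_inv, T_inv, T_snd h2 h3, T_other hac.symm hbc.symm (Ne.symm hx),
        T_other hy k3.symm (Ne.symm hxy)]
      ext z
      simp only [T, Perm.mul_apply, swap_apply_def]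
      grind
    rw [e]
    exact H.inv_mem (H.mul_mem (conj_mem h k) (H.inv_mem k))

lemma top_of_R (h : ∀ a b, R H a b) : alternatingGroup (Fin n) ≤ H := by
  rw [← Perm.closure_three_cycles_eq_alternating, Subgroup.closure_le]
  intro σ hσ
  have hσ : σ.IsThreeCycle := hσ
  have hne : σ.support.Nonempty := by
    rw [← Finset.card_pos, hσ.card_support]; norm_num
  obtain ⟨a, ha⟩ := hne
  have e := (hσ.eq_swap_mul_swap_iff_mem_support).2 ha
  have nd := (hσ.nodup_iff_mem_support).2 ha
  have nd1 : a ≠ σ a := by grind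
  have nd2 : σ a ≠ σ (σ a) := by grind
  have nd3 : a ≠ σ (σ a) := by grind
  show σ ∈ H
  have := R_all (h a (σ a)) (h (σ a) (σ (σ a))) nd1 nd2 nd3
  unfold T at this
  rwa [e]

open Classical in
lemma class_le (htrans : ∀ a b : Fin n, ∃ σ ∈ H, σ a = b) (hn : ¬ ∀ a b, R H a b) (a : Fin n) :
    2 * (Finset.univ.filter (fun c => R H a c)).card ≤ n := by
  have : ∃ b, ¬ R H a b := by
    by_contra hc
    push Not at hc
    exact hn fun x y => R_trans (R_symm (hc x)) (hc y)
  obtain ⟨b, hb⟩ := this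
  obtain ⟨σ, hσ, rfl⟩ := htrans a b
  set C := Finset.univ.filter (fun c => R H a c)
  have hd : Disjoint C (C.map σ.toEmbedding) := by
    rw [Finset.disjoint_left]
    intro x hx hx'
    simp only [C, Finset.mem_map, Finset.mem_filter, Finset.mem_univ, true_and] at hx hx'
    obtain ⟨y, hy, rfl⟩ := hx'
    exact hb (R_trans hx (R_symm (R_inv hσ hy)))
  have := Finset.card_le_univ (C ∪ C.map σ.toEmbedding)
  rw [Finset.card_union_of_disjoint hd, Finset.card_map, Fintype.card_fin] at this
  omega

open Classical in
/-- the number of permutations sending `a`, `c` to related points is at most half. -/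
lemma pair_count (htrans : ∀ a b : Fin n, ∃ σ ∈ H, σ a = b) (hn : ¬ ∀ a b, R H a b)
    {a c : Fin n} (hac : a ≠ c) :
    2 * (Finset.univ.filter (fun π : Perm (Fin n) => R H (π⁻¹ a) (π⁻¹ c))).card
      ≤ Fintype.card (Perm (Fin n)) := by
  set N := (Finset.univ.filter (fun π : Perm (Fin n) => R H (π⁻¹ a) (π⁻¹ c))).card with hN
  have h1 : ∀ d ∈ Finset.univ.erase a,
      (Finset.univ.filter (fun π : Perm (Fin n) => R H (π⁻¹ a) (π⁻¹ d))).card = N := by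
    intro d hd
    have hda : d ≠ a := by simpa using hd
    rw [hN]
    refine Finset.card_bij' (fun π _ => swap c d * π) (fun π _ => swap c d * π) ?_ ?_ ?_ ?_
    · intro π hπ
      simpa [mul_inv_rev, Perm.mul_apply, swap_apply_of_ne_of_ne hac hda.symm, -Perm.coe_inv] using hπ
    · intro π hπ
      simpa [mul_inv_rev, Perm.mul_apply, swap_apply_of_ne_of_ne hac hda.symm, -Perm.coe_inv] using hπ
    · intro π _; simp
    · intro π _; simp
  have h2 := Finset.sum_const_nat h1
  rw [Finset.card_erase_of_mem (Finset.mem_univ a), Finset.card_univ, Fintype.card_fin] at h2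
  simp only [Finset.card_filter] at h2
  rw [Finset.sum_comm] at h2
  have h3 : ∀ π ∈ (Finset.univ : Finset (Perm (Fin n))),
      2 * (∑ d ∈ Finset.univ.erase a, if R H (π⁻¹ a) (π⁻¹ d) then 1 else 0) ≤ n - 1 := by
    intro π _
    have hc := class_le htrans hn (π⁻¹ a)
    have : (Finset.univ.filter (fun d => R H (π⁻¹ a) (π⁻¹ d))).card
        = (Finset.univ.filter (fun d => R H (π⁻¹ a) d)).card := by
      refine Finset.card_bij' (fun x _ => π⁻¹ x) (fun x _ => π x) ?_ ?_ ?_ ?_ <;> simp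
    rw [← this] at hc
    rw [← Finset.card_filter, Finset.filter_erase, Finset.card_erase_of_mem]
    · omega
    · simp [R]
  have h4 := Finset.sum_le_sum h3
  rw [← Finset.mul_sum, h2, Finset.sum_const, Finset.card_univ, smul_eq_mul] at h4
  have hn1 : 0 < n - 1 := by
    have := a.2; have := c.2
    have : (a:ℕ) ≠ c := fun h => hac (Fin.ext h)
    omega
  refine Nat.le_of_mul_le_mul_right (c := n - 1) ?_ hn1
  calc _ = 2 * ((n-1) * N) := by ring
    _ ≤ _ := h4

/-- permutations conjugating `g` into `H`. -/
noncomputable def cj (H : Subgroup (Perm (Fin n))) (g : Perm (Fin n)) : Finset (Perm (Fin n)) :=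
  open Classical in Finset.univ.filter (fun π => π⁻¹ * g * π ∈ H)

lemma mem_cj {g π : Perm (Fin n)} : π ∈ cj H g ↔ π⁻¹ * g * π ∈ H := by simp [cj]

lemma cj_conj (g t : Perm (Fin n)) : (cj H (t * g * t⁻¹)).card = (cj H g).card := by
  refine Finset.card_bij' (fun π _ => t⁻¹ * π) (fun π _ => t * π) ?_ ?_ ?_ ?_
  · intro π hπ; rw [mem_cj] at *; convert hπ using 1; group
  · intro π hπ; rw [mem_cj] at *; convert hπ using 1; group
  · intro π _; simp
  · intro π _; simp

lemma cj_inter (g k : Perm (Fin n)) :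
    (cj H g).card + (cj H k).card ≤ Fintype.card (Perm (Fin n)) + (cj H (g * k⁻¹)).card := by
  classical
  rw [← Finset.card_union_add_card_inter]
  refine add_le_add (Finset.card_le_univ _) (Finset.card_le_card ?_)
  intro π hπ
  rw [Finset.mem_inter, mem_cj, mem_cj] at hπ
  rw [mem_cj]
  convert H.mul_mem hπ.1 (H.inv_mem hπ.2) using 1
  group

lemma cj_comm (g t : Perm (Fin n)) :
    2 * (cj H g).card ≤ Fintype.card (Perm (Fin n)) + (cj H (g * (t * g * t⁻¹)⁻¹)).card := by
  have := cj_inter (H := H) g (t * g * t⁻¹)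
  rw [cj_conj] at this
  omega

/-- If `g` moves points related whenever conjugated into `H`. -/
lemma cj_le (htrans : ∀ a b : Fin n, ∃ σ ∈ H, σ a = b) (hn : ¬ ∀ a b, R H a b)
    {a c : Fin n} (hac : a ≠ c) (k : Perm (Fin n))
    (hk : ∀ π : Perm (Fin n), π⁻¹ * k * π ∈ H → R H (π⁻¹ a) (π⁻¹ c)) :
    2 * (cj H k).card ≤ Fintype.card (Perm (Fin n)) := by
  classical
  refine le_trans ?_ (pair_count htrans hn hac)
  gcongr
  intro π hπ
  rw [mem_cj] at hπ
  simpa using hk π hπ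

lemma T_conj' (π : Perm (Fin n)) (a b c : Fin n) :
    π⁻¹ * T a b c * π = T (π⁻¹ a) (π⁻¹ b) (π⁻¹ c) := by
  have := T_conj π⁻¹ a b c
  rwa [inv_inv] at this

lemma swap_conj' (π : Perm (Fin n)) (a b : Fin n) :
    π⁻¹ * swap a b * π = swap (π⁻¹ a) (π⁻¹ b) := by
  rw [Equiv.mul_swap_eq_swap_mul]; group

lemma double_R (htrans : ∀ a b : Fin n, ∃ σ ∈ H, σ a = b) {x y z : Fin n}
    (hxy : x ≠ y) (hyz : y ≠ z) (hxz : x ≠ z) (hT : T x y z ∈ H) {a b c d : Fin n}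
    (hab : a ≠ b) (hac : a ≠ c) (had : a ≠ d) (hbc : b ≠ c) (hbd : b ≠ d) (hcd : c ≠ d)
    (h : swap a c * swap b d ∈ H) : R H a c := by
  by_contra hR
  obtain ⟨σ, hσ, rfl⟩ := htrans x a
  have ry : R H (σ x) (σ y) := R_inv hσ (Or.inr ⟨z, hxy, hyz, hxz, hT⟩)
  have rz : R H (σ x) (σ z) := by
    refine R_inv hσ (R_symm (Or.inr ⟨y, hxz.symm, hxy, hyz.symm, ?_⟩))
    rwa [T_rot hxz.symm hxy hyz.symm]
  have hy : σ x ≠ σ y := by simpa using hxy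
  have hz : σ x ≠ σ z := by simpa using hxz
  have hyz' : σ y ≠ σ z := by simpa using hyz
  generalize σ x = a at *
  generalize σ y = u at *
  generalize σ z = v at *
  have himg : ∀ w, R H a w → (swap a c * swap b d) w ≠ w ∧ w ≠ c ∧
      ¬ R H a ((swap a c * swap b d) w) := by
    intro w hw
    have h1 := R_inv h hw
    have h2 : (swap a c * swap b d) a = c := by
      simp [swap_apply_of_ne_of_ne hab had]
    rw [h2] at h1
    have h3 : ¬ R H a ((swap a c * swap b d) w) := fun h4 => hR (R_trans h4 (R_symm h1))
    refine ⟨fun e => h3 (e.symm ▸ hw), ?_, h3⟩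
    rintro rfl; exact hR hw
  have hu := himg u ry
  have hv := himg v rz
  have e : ∀ w, (swap a c * swap b d) w = if w = a then c else if w = c then a else if w = b then d
      else if w = d then b else w := by
    intro w; simp only [Perm.mul_apply, swap_apply_def]; grind
  rw [e] at hu hv
  grind

lemma fpr_bound (h5 : 5 ≤ n) (hlt : H < alternatingGroup (Fin n))
    (htrans : ∀ a b : Fin n, ∃ σ ∈ H, σ a = b) (g : Perm (Fin n)) (hg : g ≠ 1) :
    4 * (cj H g).card ≤ 3 * Fintype.card (Perm (Fin n)) := by
  by_contra hcon
  push Not at hcon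
  have hR : ¬ ∀ a b, R H a b := fun h => not_le_of_gt hlt (top_of_R h)
  have hsw : ∀ x y, g * (swap x y * g * (swap x y)⁻¹)⁻¹ = swap (g x) (g y) * swap x y := by
    intro x y
    have := Equiv.mul_swap_eq_swap_mul g x y
    calc _ = g * swap x y * g⁻¹ * swap x y := by simp only [mul_inv_rev, inv_inv, swap_inv]; group
      _ = _ := by rw [this]; group
  by_cases h1 : ∃ a, g a ≠ a ∧ g (g a) ≠ a
  · obtain ⟨a, ha, hb⟩ := h1
    have key := cj_comm (H := H) g (swap a (g a))
    rw [hsw] at key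
    have hbc : g (g a) ≠ g a := by simpa using ha
    have e : swap (g a) (g (g a)) * swap a (g a) = T (g (g a)) (g a) a := by
      simp [T, swap_comm]
    rw [e] at key
    have := cj_le htrans hR ha (T (g (g a)) (g a) a) (by
      intro π hπ
      rw [T_conj', T_rot (by simpa using hbc) (by simpa using ha) (by simpa using hb)] at hπ
      exact Or.inr ⟨_, by simpa using ha, by simpa using hb.symm, by simpa using hbc.symm, hπ⟩)
    omega
  · push Not at h1
    have hev : Perm.sign g = 1 := by
      have : (cj H g).Nonempty := by
        rw [← Finset.card_pos]; omega
      obtain ⟨π, hπ⟩ := this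
      rw [mem_cj] at hπ
      have := hlt.le hπ
      rw [Perm.mem_alternatingGroup] at this
      rw [Perm.sign_mul, Perm.sign_mul, mul_right_comm, ← Perm.sign_mul] at this
      simpa using this
    obtain ⟨a, ha⟩ : ∃ a, g a ≠ a := by
      by_contra hc; push Not at hc; exact hg (Equiv.ext hc)
    have haa := h1 a ha
    obtain ⟨c, hca, hcb, hc⟩ : ∃ c, c ≠ a ∧ c ≠ g a ∧ g c ≠ c := by
      by_contra hc; push Not at hc
      have : g = swap a (g a) := by
        ext x
        rw [swap_apply_def]
        grind
      rw [this, Perm.sign_swap ha.symm] at hev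
      exact absurd hev (by decide)
    have hcc := h1 c hc
    have key := cj_comm (H := H) g (swap a c)
    rw [hsw] at key
    obtain ⟨b, hb⟩ : ∃ b, b = g a := ⟨_, rfl⟩
    obtain ⟨d, hd⟩ : ∃ d, d = g c := ⟨_, rfl⟩
    rw [← hb, ← hd] at key
    have hab : a ≠ b := by grind
    have hac : a ≠ c := by grind
    have had : a ≠ d := by grind
    have hbc : b ≠ c := by grind
    have hbd : b ≠ d := by rw [hb, hd]; simpa using hac
    have hcd : c ≠ d := by grind
    obtain ⟨e, he⟩ : ∃ e, e ∉ ({a, b, c, d} : Finset (Fin n)) := by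
      by_contra hh; push Not at hh
      have h6 := Finset.card_le_card (fun x _ => hh x : Finset.univ ⊆ ({a, b, c, d} : Finset (Fin n)))
      have h7 := Finset.card_le_four (a := a) (b := b) (c := c) (d := d)
      rw [Finset.card_univ, Fintype.card_fin] at h6
      omega
    simp only [Finset.mem_insert, Finset.mem_singleton, not_or] at he
    obtain ⟨hea, heb, hec, hed⟩ := he
    have key2 := cj_comm (H := H) (swap b d * swap a c) (swap d e)
    have e2 : (swap b d * swap a c) * (swap d e * (swap b d * swap a c) * (swap d e)⁻¹)⁻¹
        = T b e d := by
      ext x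
      simp only [mul_inv_rev, swap_inv, T, Perm.mul_apply, swap_apply_def]
      grind
    rw [e2] at key2
    have : (cj H (T b e d)).Nonempty := by
      rw [← Finset.card_pos]; omega
    obtain ⟨ρ, hρ⟩ := this
    rw [mem_cj, T_conj'] at hρ
    have := cj_le htrans hR hac (swap b d * swap a c) (by
      intro π hπ
      have e3 : π⁻¹ * (swap b d * swap a c) * π =
          swap (π⁻¹ a) (π⁻¹ c) * swap (π⁻¹ b) (π⁻¹ d) := by
        rw [← swap_conj', ← swap_conj', (Perm.disjoint_iff_disjoint_support.2 _ : 
          Perm.Disjoint (swap b d) (swap a c)).commute.eq]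
        · group
        · rw [Perm.support_swap hbd, Perm.support_swap hac]
          simp [hab, hbc.symm, had, hcd]
      rw [e3] at hπ
      refine double_R htrans ?_ ?_ ?_ hρ (b := π⁻¹ b) (d := π⁻¹ d) ?_ ?_ ?_ ?_ ?_ ?_ hπ <;>
        simp only [ne_eq, EmbeddingLike.apply_eq_iff_eq] <;> grind)
    omega

lemma orbit_bound {G Ω : Type*} [Group G] [MulAction G Ω] [Finite Ω] (g : G) :
    2 * Nat.card (MulAction.orbitRel.Quotient (Subgroup.zpowers g) Ω) ≤
      Nat.card Ω + Nat.card {x : Ω | g • x = x} := by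
  classical
  let s : MulAction.orbitRel.Quotient (Subgroup.zpowers g) Ω → Ω := Quotient.out
  have hs : ∀ q, (Quotient.mk _ (s q) : MulAction.orbitRel.Quotient (Subgroup.zpowers g) Ω) = q :=
    Quotient.out_eq
  have hgs : ∀ q, (Quotient.mk _ (g • s q) :
      MulAction.orbitRel.Quotient (Subgroup.zpowers g) Ω) = q := by
    intro q
    refine Eq.trans (Quotient.sound ?_) (hs q)
    exact ⟨⟨g, Subgroup.mem_zpowers g⟩, rfl⟩
  let f : MulAction.orbitRel.Quotient (Subgroup.zpowers g) Ω ⊕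
      MulAction.orbitRel.Quotient (Subgroup.zpowers g) Ω → Ω ⊕ {x : Ω | g • x = x} :=
    Sum.elim (fun q => Sum.inl (s q))
      (fun q => if h : g • s q = s q then Sum.inr ⟨s q, h⟩ else Sum.inl (g • s q))
  have hf : Function.Injective f := by
    have hinj : ∀ q q', s q = s q' → q = q' := fun q q' h => by rw [← hs q, h, hs]
    have hinj' : ∀ q q', g • s q = g • s q' → q = q' := fun q q' h => by rw [← hgs q, h, hgs]
    have hinj2 : ∀ q q', s q = g • s q' → q = q' := fun q q' h => by rw [← hs q, h, hgs]
    rintro (q | q) (q' | q') h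
    · simp only [f, Sum.elim_inl, Sum.inl.injEq] at h; rw [hinj _ _ h]
    · simp only [f, Sum.elim_inl, Sum.elim_inr] at h
      split_ifs at h with h1
      simp only [Sum.inl.injEq] at h
      have := hinj2 _ _ h
      subst this
      exact absurd h.symm h1
    · simp only [f, Sum.elim_inl, Sum.elim_inr] at h
      split_ifs at h with h1
      simp only [Sum.inl.injEq] at h
      have := hinj2 _ _ h.symm
      subst this
      exact absurd h h1
    · simp only [f, Sum.elim_inr] at h
      split_ifs at h with h1 h2 h2
      · simp only [Sum.inr.injEq, Subtype.mk.injEq] at h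
        rw [hinj _ _ h]
      · simp only [Sum.inl.injEq] at h
        rw [hinj' _ _ h]
  have : Finite (MulAction.orbitRel.Quotient (Subgroup.zpowers g) Ω) := Quotient.finite _
  have := Nat.card_le_card_of_injective f hf
  rw [Nat.card_sum, Nat.card_sum] at this
  omega

lemma fix_card (g : Perm (Fin n)) :
    (cj H g).card = Nat.card H * Nat.card {x : Perm (Fin n) ⧸ H | g • x = x} := by
  rw [← Nat.card_prod, ← Nat.card_congr (QuotientGroup.preimageMkEquivSubgroupProdSet H _),
    ← Fintype.card_coe, ← Nat.card_eq_fintype_card]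
  refine Nat.card_congr (Equiv.subtypeEquivRight fun π => ?_)
  rw [mem_cj]
  show _ ↔ g • (π : Perm (Fin n) ⧸ H) = π
  rw [MulAction.Quotient.smul_coe, eq_comm, QuotientGroup.eq, smul_eq_mul, mul_assoc]
end


/-- Let `n ≥ 5` and let `H ≤ S_n` be contained in `A_n`, maximal in `A_n`, and transitive
on `{1,…,n}`. Then the minimal index of `S_n` on `S_n/H` is at least `[S_n : H]/8`: for
every nonidentity `g ∈ S_n`, `[S_n:H]/8 ≤ [S_n:H] − #(orbits of g on S_n/H)`. -/
theorem min_index_symm_coset (n : ℕ) (hn : 5 ≤ n)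
    (H : Subgroup (Equiv.Perm (Fin n)))
    (hlt : H < alternatingGroup (Fin n))
    (hmax : ∀ K : Subgroup (Equiv.Perm (Fin n)), H < K →
      K ≤ alternatingGroup (Fin n) → K = alternatingGroup (Fin n))
    (htrans : ∀ a b : Fin n, ∃ σ ∈ H, σ a = b) :
    ∀ g : Equiv.Perm (Fin n), g ≠ 1 →
      (Nat.card (Equiv.Perm (Fin n) ⧸ H) : ℚ) / 8 ≤
        (Nat.card (Equiv.Perm (Fin n) ⧸ H) : ℚ) -
          (Nat.card (MulAction.orbitRel.Quotient (Subgroup.zpowers g)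
            (Equiv.Perm (Fin n) ⧸ H)) : ℚ) := by
  intro g hg
  have h1 := fpr_bound hn hlt htrans g hg
  have h2 : 2 * Nat.card (MulAction.orbitRel.Quotient (Subgroup.zpowers g)
      (Equiv.Perm (Fin n) ⧸ H)) ≤ Nat.card (Perm (Fin n) ⧸ H) +
      Nat.card {x : Perm (Fin n) ⧸ H | g • x = x} := orbit_bound (Ω := Perm (Fin n) ⧸ H) g
  rw [fix_card, ← Nat.card_eq_fintype_card, Subgroup.card_eq_card_quotient_mul_card_subgroup H] at h1
  have hH : 0 < Nat.card H := Nat.card_pos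
  have h3 : 4 * Nat.card {x : Perm (Fin n) ⧸ H | g • x = x} ≤ 3 * Nat.card (Perm (Fin n) ⧸ H) := by
    refine Nat.le_of_mul_le_mul_right (c := Nat.card H) ?_ hH
    linarith
  have h4 : 8 * Nat.card (MulAction.orbitRel.Quotient (Subgroup.zpowers g)
            (Equiv.Perm (Fin n) ⧸ H)) ≤ 7 * Nat.card (Perm (Fin n) ⧸ H) := by omega
  have h5 : (8 : ℚ) * Nat.card (MulAction.orbitRel.Quotient (Subgroup.zpowers g)
            (Equiv.Perm (Fin n) ⧸ H)) ≤ 7 * Nat.card (Perm (Fin n) ⧸ H) := by exact_mod_cast h4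
  linarith
end

section
/- For the symmetric group S₅ and any maximal transitive subgroup H of S₅ with H ≠ A₅ (i.e., H conjugate to F₅ = AGL(1,5) of order 20), the minimal index satisfies ind(S₅, S₅/H) = 2 and [S₅ : H] = 6, so ind(S₅, S₅/H)/[S₅:H] = 1/3 > 2/11. -/
open MulAction Equiv in
theorem aux_core (H : Subgroup (Perm (Fin 5))) (hmax : IsCoatom H)
    (hne : H ≠ alternatingGroup (Fin 5)) (N : Subgroup (Perm (Fin 5))) (hN : N.Normal)
    (hle : N ≤ H) : N = ⊥ := by
  by_contra hb
  have hnt : Nontrivial N := (Subgroup.nontrivial_iff_ne_bot N).2 hb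
  have hA : alternatingGroup (Fin 5) ≤ N :=
    Equiv.Perm.alternatingGroup_le_of_normal (by simp) hnt
  have hAH := hA.trans hle
  have h2 : (alternatingGroup (Fin 5)).index = 2 := alternatingGroup.index_eq_two
  have hd : H.index ∣ 2 := h2 ▸ Subgroup.index_dvd_of_le hAH
  rcases (Nat.dvd_prime Nat.prime_two).1 hd with h | h
  · exact hmax.1 (Subgroup.index_eq_one.1 h)
  · exact hne (Equiv.Perm.eq_alternatingGroup_of_index_eq_two h)

open MulAction Equiv in
theorem aux_inj (H : Subgroup (Perm (Fin 5))) (hmax : IsCoatom H)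
    (hne : H ≠ alternatingGroup (Fin 5)) :
    Function.Injective (MulAction.toPermHom (Perm (Fin 5)) (Perm (Fin 5) ⧸ H)) := by
  rw [← MonoidHom.ker_eq_bot_iff, ← Subgroup.normalCore_eq_ker]
  exact aux_core H hmax hne _ inferInstance H.normalCore_le

theorem aux_card : Nat.card (Equiv.Perm (Fin 5)) = 120 := by
  rw [Nat.card_perm, Nat.card_fin]; rfl

open MulAction Equiv in
theorem aux_five_le (H : Subgroup (Perm (Fin 5))) (hmax : IsCoatom H)
    (hne : H ≠ alternatingGroup (Fin 5)) : 5 ≤ H.index := by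
  have h := Nat.card_le_card_of_injective _ (aux_inj H hmax hne)
  rw [aux_card, Nat.card_perm] at h
  change 120 ≤ (H.index).factorial at h
  by_contra hlt
  have : H.index.factorial ≤ Nat.factorial 4 := Nat.factorial_le (by omega)
  have h4 : Nat.factorial 4 = 24 := rfl
  omega

open MulAction Equiv in
theorem aux_index (H : Subgroup (Perm (Fin 5))) (hmax : IsCoatom H)
    (htrans : ∀ a b : Fin 5, ∃ σ ∈ H, σ a = b)
    (hne : H ≠ alternatingGroup (Fin 5)) : H.index = 6 := by
  have h5 := aux_five_le H hmax hne
  have hmul : Nat.card H * H.index = 120 := by rw [H.card_mul_index, aux_card]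
  have hd : 5 ∣ Nat.card H := by
    have : IsPretransitive H (Fin 5) := ⟨fun a b => by
      obtain ⟨σ, hσ, h⟩ := htrans a b
      exact ⟨⟨σ, hσ⟩, h⟩⟩
    have h := index_stabilizer_of_transitive H (0 : Fin 5)
    rw [Nat.card_fin] at h
    have h' := Subgroup.index_dvd_card (stabilizer H (0 : Fin 5))
    rwa [h] at h'
  have hfp : Fact (Nat.Prime 5) := ⟨by norm_num⟩
  obtain ⟨m, hm⟩ := hd
  have hm24 : m * H.index = 24 := by
    rw [hm, mul_assoc] at hmul; omega
  have hm0 : m ≠ 0 := by rintro rfl; omega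
  have hm5 : ¬ 5 ∣ m := fun h => by
    have : 5 ∣ 24 := hm24 ▸ Dvd.dvd.mul_right h _
    omega
  obtain ⟨P⟩ : Nonempty (Sylow 5 H) := inferInstance
  have hPcard : Nat.card P = 5 := by
    rw [P.card_eq_multiplicity, hm, Nat.factorization_mul (by norm_num) hm0]
    simp [Nat.factorization_eq_zero_of_not_dvd hm5, Nat.Prime.factorization_self hfp.out]
  have hPi : P.index = m := by
    have := (P : Subgroup H).card_mul_index
    rw [hm] at this
    change Nat.card P * _ = _ at this
    rw [hPcard] at this
    exact Nat.eq_of_mul_eq_mul_left (by norm_num) this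
  have hs1 := card_sylow_modEq_one 5 H
  have hs2 : Nat.card (Sylow 5 H) ∣ m := hPi ▸ P.card_dvd_index
  have hmle : m ≤ 4 := by
    by_contra hc
    nlinarith
  have hs3 : Nat.card (Sylow 5 H) = 1 := by
    have h := Nat.le_of_dvd (by omega) hs2
    unfold Nat.ModEq at hs1
    omega
  have hsub : Subsingleton (Sylow 5 H) := (Nat.card_eq_one_iff_unique.1 hs3).1
  have hPn : (P : Subgroup H).Normal := P.normal_of_subsingleton
  set Q : Subgroup (Perm (Fin 5)) := (P : Subgroup H).map H.subtype with hQ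
  have hQH : Q ≤ H := by
    rintro _ ⟨x, _, rfl⟩; exact x.2
  have hQcard : Nat.card Q = 5 := by
    rw [hQ, Subgroup.card_map_of_injective H.subtype_injective]; exact hPcard
  have hHN : H ≤ Subgroup.normalizer (Q : Set (Perm (Fin 5))) := by
    have h := Subgroup.le_normalizer_map (H := (P : Subgroup H)) H.subtype
    rw [Subgroup.normalizer_eq_top] at h
    rw [← hQ] at h
    intro x hx
    exact h ⟨⟨x, hx⟩, trivial, rfl⟩
  have hHeq : H = Subgroup.normalizer (Q : Set (Perm (Fin 5))) := by
    rcases hmax.le_iff.1 hHN with h | h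
    · exfalso
      have hn : Q.Normal := Subgroup.normalizer_eq_top_iff.1 h
      have := aux_core H hmax hne Q hn hQH
      rw [this] at hQcard
      simp at hQcard
    · exact h.symm
  have hf : (Nat.card (Perm (Fin 5))).factorization 5 = 1 := by
    rw [aux_card, show 120 = 5 * 24 from rfl, Nat.factorization_mul (by norm_num) (by norm_num)]
    simp [Nat.factorization_eq_zero_of_not_dvd (show ¬ 5 ∣ 24 by norm_num),
      Nat.Prime.factorization_self hfp.out]
  let S : Sylow 5 (Perm (Fin 5)) := Sylow.ofCard Q (by rw [hf, hQcard]; rfl)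
  have hS := S.card_eq_index_normalizer
  change _ = (Subgroup.normalizer (Q : Set (Perm (Fin 5)))).index at hS
  rw [← hHeq] at hS
  have hS1 := card_sylow_modEq_one 5 (Perm (Fin 5))
  rw [hS] at hS1
  unfold Nat.ModEq at hS1
  have : m = 1 ∨ m = 2 ∨ m = 3 ∨ m = 4 := by omega
  rcases this with rfl | rfl | rfl | rfl <;> omega

open MulAction Equiv in
theorem aux_not_swap (H : Subgroup (Perm (Fin 5))) (hmax : IsCoatom H)
    (hi : H.index = 6) (g : Perm (Fin 5))
    (hg : ∃ x y : Perm (Fin 5) ⧸ H, x ≠ y ∧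
      MulAction.toPermHom (Perm (Fin 5)) (Perm (Fin 5) ⧸ H) g
        = (open Classical in Equiv.swap x y)) : False := by
  classical
  have hc : Nat.card (Perm (Fin 5) ⧸ H) = 6 := hi
  have hnt : Nontrivial (Perm (Fin 5) ⧸ H) := Finite.one_lt_card_iff_nontrivial.1 (by omega)
  have hp : IsPreprimitive (Perm (Fin 5)) (Perm (Fin 5) ⧸ H) := by
    rw [← isCoatom_stabilizer_iff_preprimitive _ ((1 : Perm (Fin 5)) : Perm (Fin 5) ⧸ H),
      stabilizer_quotient]
    exact hmax
  let φ := MulAction.toPermHom (Perm (Fin 5)) (Perm (Fin 5) ⧸ H)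
  let f : (Perm (Fin 5) ⧸ H) →ₑ[φ.rangeRestrict] (Perm (Fin 5) ⧸ H) :=
    { toFun := id, map_smul' := fun _ _ => rfl }
  have hp2 : IsPreprimitive φ.range (Perm (Fin 5) ⧸ H) :=
    IsPreprimitive.of_surjective (f := f) Function.surjective_id
  obtain ⟨x, y, hxy, h⟩ := hg
  have htop : φ.range = ⊤ :=
    Equiv.Perm.subgroup_eq_top_of_isPreprimitive_of_isSwap_mem hp2 (φ g) ⟨x, y, hxy, h⟩ ⟨g, rfl⟩
  have hsurj := Nat.card_le_card_of_surjective φ (MonoidHom.range_eq_top.1 htop)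
  rw [aux_card, Nat.card_perm, hc] at hsurj
  have : Nat.factorial 6 = 720 := rfl
  omega

theorem aux_quot {α β : Type*} [Finite α] (q : α → β) (hq : Function.Surjective q)
    (a b : α) (hab : a ≠ b) (ha : ∃ c, c ≠ a ∧ c ≠ b ∧ q c = q a)
    (hb : ∃ c, c ≠ a ∧ c ≠ b ∧ q c = q b) : Nat.card β + 2 ≤ Nat.card α := by
  classical
  have hs : Function.Surjective (fun x : (({a, b} : Set α)ᶜ : Set α) => q x) := by
    intro y
    obtain ⟨x, rfl⟩ := hq y
    by_cases hxa : x = a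
    · subst hxa
      obtain ⟨c, h1, h2, h3⟩ := ha
      exact ⟨⟨c, by simp [h1, h2]⟩, h3⟩
    by_cases hxb : x = b
    · subst hxb
      obtain ⟨c, h1, h2, h3⟩ := hb
      exact ⟨⟨c, by simp [h1, h2]⟩, h3⟩
    exact ⟨⟨x, by simp [hxa, hxb]⟩, rfl⟩
  have h := Nat.card_le_card_of_surjective _ hs
  have h2 := Set.ncard_add_ncard_compl ({a, b} : Set α)
  rw [Set.ncard_pair hab] at h2
  rw [Nat.card_coe_set_eq] at h
  omega

open MulAction Equiv in
theorem aux_lower (H : Subgroup (Perm (Fin 5))) (hmax : IsCoatom H)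
    (hne : H ≠ alternatingGroup (Fin 5)) (hi : H.index = 6) (g : Perm (Fin 5)) (hg : g ≠ 1) :
    Nat.card (MulAction.orbitRel.Quotient (Subgroup.zpowers g) (Perm (Fin 5) ⧸ H)) ≤ 4 := by
  classical
  have hc : Nat.card (Perm (Fin 5) ⧸ H) = 6 := hi
  set α := Perm (Fin 5) ⧸ H
  let q : α → MulAction.orbitRel.Quotient (Subgroup.zpowers g) α := fun x => Quotient.mk _ x
  have hq : Function.Surjective q := Quotient.mk_surjective
  have hqg : ∀ x, q (g • x) = q x := fun x =>
    Quotient.sound (s := MulAction.orbitRel (Subgroup.zpowers g) α)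
      ⟨⟨g, Subgroup.mem_zpowers g⟩, rfl⟩
  suffices Nat.card (MulAction.orbitRel.Quotient (Subgroup.zpowers g) α) + 2 ≤ Nat.card α by
    rw [hc] at this
    exact Nat.le_of_add_le_add_right this
  have hx : ∃ x : α, g • x ≠ x := by
    by_contra! hcon
    apply hg
    apply aux_inj H hmax hne
    rw [map_one]
    exact Equiv.ext hcon
  obtain ⟨x, hx⟩ := hx
  have hy : ∃ y : α, y ≠ x ∧ y ≠ g • x ∧ g • y ≠ y := by
    by_contra! hcon
    apply aux_not_swap H hmax hi g
    refine ⟨x, g • x, hx.symm, ?_⟩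
    have hfix : g • g • x = x := by
      by_contra hne2
      have h1 : g • g • x ≠ g • x := fun h => hx (MulAction.injective g h)
      exact h1 (MulAction.injective g (hcon _ hne2 h1))
    ext y
    by_cases h1 : y = x
    · subst h1; simp
    by_cases h2 : y = g • x
    · subst h2; simp [hfix]
    rw [Equiv.swap_apply_of_ne_of_ne h1 h2]
    exact hcon y h1 h2
  obtain ⟨y, hyx, hygx, hgy⟩ := hy
  by_cases hxy : g • y = x
  · refine aux_quot q hq x (g • x) hx.symm ⟨y, hyx, hygx, ?_⟩ ⟨y, hyx, hygx, ?_⟩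
    · rw [← hxy, hqg]
    · rw [hqg, ← hxy, hqg]
  · refine aux_quot q hq (g • x) (g • y) (fun h => hyx (MulAction.injective g h).symm)
      ⟨x, hx.symm, fun h => hxy h.symm, (hqg x).symm⟩ ⟨y, hygx, hgy.symm, (hqg y).symm⟩

open MulAction Equiv in
theorem aux_upper (H : Subgroup (Perm (Fin 5))) (hi : H.index = 6) :
    ∃ g : Perm (Fin 5), g ≠ 1 ∧
    4 ≤ Nat.card (MulAction.orbitRel.Quotient (Subgroup.zpowers g) (Perm (Fin 5) ⧸ H)) := by
  classical
  have hc : Nat.card (Perm (Fin 5) ⧸ H) = 6 := hi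
  have hmul : Nat.card H * H.index = 120 := by rw [H.card_mul_index, aux_card]
  have hfp : Fact (Nat.Prime 2) := ⟨by norm_num⟩
  obtain ⟨⟨g, hgH⟩, ho⟩ := exists_prime_orderOf_dvd_card' (G := H) 2 (by rw [hi] at hmul; omega)
  rw [Subgroup.orderOf_mk] at ho
  have hg1 : g ≠ 1 := by rintro rfl; simp at ho
  refine ⟨g, hg1, ?_⟩
  set α := Perm (Fin 5) ⧸ H
  have hcz : Nat.card (Subgroup.zpowers g) = 2 := by rw [Nat.card_zpowers, ho]
  have hpg : IsPGroup 2 (Subgroup.zpowers g) := IsPGroup.of_card (n := 1) (by rw [hcz]; rfl)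
  have hmod := hpg.card_modEq_card_fixedPoints α
  have hne : Nonempty (fixedPoints (Subgroup.zpowers g) α) := by
    refine ⟨⟨((1 : Perm (Fin 5)) : α), ?_⟩⟩
    rintro ⟨z, hz⟩
    have hzH : z ∈ H := (Subgroup.zpowers_le.2 hgH) hz
    have : z ∈ stabilizer (Perm (Fin 5)) ((1 : Perm (Fin 5)) : α) := by
      rw [stabilizer_quotient]; exact hzH
    exact this
  have hpos : 0 < Nat.card (fixedPoints (Subgroup.zpowers g) α) := Nat.card_pos
  have hfix2 : 2 ≤ Nat.card (fixedPoints (Subgroup.zpowers g) α) := by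
    rw [hc] at hmod
    unfold Nat.ModEq at hmod
    omega
  have : Fintype α := Fintype.ofFinite α
  have : Fintype (orbitRel.Quotient (Subgroup.zpowers g) α) := Fintype.ofFinite _
  have hB := sum_card_fixedBy_eq_card_orbits_mul_card_group (Subgroup.zpowers g) α
  rw [← Nat.card_eq_fintype_card, ← Nat.card_eq_fintype_card, hcz] at hB
  let g' : Subgroup.zpowers g := ⟨g, Subgroup.mem_zpowers g⟩
  have hg' : (1 : Subgroup.zpowers g) ≠ g' := fun h => hg1 (congrArg Subtype.val h).symm
  have hsum : ∑ z ∈ {1, g'}, Fintype.card (fixedBy α z) ≤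
      ∑ z : Subgroup.zpowers g, Fintype.card (fixedBy α z) :=
    Finset.sum_le_sum_of_subset (Finset.subset_univ _)
  rw [Finset.sum_pair hg', hB] at hsum
  have e1 : Fintype.card (fixedBy α (1 : Subgroup.zpowers g)) = 6 := by
    rw [← Nat.card_eq_fintype_card, fixedBy_one_eq_univ, Nat.card_univ, hc]
  have e2 : 2 ≤ Fintype.card (fixedBy α g') := by
    rw [← Nat.card_eq_fintype_card]
    refine hfix2.trans ?_
    exact Nat.card_mono (Set.toFinite _) (fun x hx => hx g')
  change 4 ≤ Nat.card (Quotient (orbitRel (Subgroup.zpowers g) α))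
  omega

/-- Let `H` be a maximal transitive subgroup of `S₅` with `H ≠ A₅`
(so `H` is conjugate to `F₅ = AGL(1,5)` of order `20`). Then `[S₅ : H] = 6` and the
minimal index `ind(S₅, S₅/H)` (the minimum over nonidentity `g` of
`[S₅:H] − #(orbits of g on S₅/H)`) equals `2`, so
`ind(S₅, S₅/H)/[S₅:H] = 2/6 = 1/3 > 2/11`. -/
theorem min_index_S5_F5 (H : Subgroup (Equiv.Perm (Fin 5)))
    (hmax : IsCoatom H)
    (htrans : ∀ a b : Fin 5, ∃ σ ∈ H, σ a = b)
    (hne : H ≠ alternatingGroup (Fin 5)) :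
    H.index = 6 ∧
      sInf {k : ℕ | ∃ g : Equiv.Perm (Fin 5), g ≠ 1 ∧
          k = Nat.card (Equiv.Perm (Fin 5) ⧸ H) -
            Nat.card (MulAction.orbitRel.Quotient (Subgroup.zpowers g)
              (Equiv.Perm (Fin 5) ⧸ H))} = 2 ∧
      (2 : ℚ) / 6 = 1 / 3 ∧ (2 : ℚ) / 11 < 1 / 3 := by
  have hi := aux_index H hmax htrans hne
  have hc : Nat.card (Equiv.Perm (Fin 5) ⧸ H) = 6 := hi
  refine ⟨hi, ?_, by norm_num, by norm_num⟩
  apply le_antisymm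
  · obtain ⟨g, hg, h4⟩ := aux_upper H hi
    have h2 : Nat.card (Equiv.Perm (Fin 5) ⧸ H) -
        Nat.card (MulAction.orbitRel.Quotient (Subgroup.zpowers g)
          (Equiv.Perm (Fin 5) ⧸ H)) ≤ 2 := by omega
    refine le_trans (Nat.sInf_le ?_) h2
    exact ⟨g, hg, rfl⟩
  · apply le_csInf
    · obtain ⟨g, hg, h4⟩ := aux_upper H hi
      exact ⟨_, g, hg, rfl⟩
    · rintro k ⟨g, hg, rfl⟩
      have := aux_lower H hmax hne hi g hg
      omega
end
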